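/- arXiv:2111.03611 — 13 statements merged into one kernel-verified Lean document; each statement's English description precedes it below -/
import Mathlib

section
/- FB ≤ 2·SP + 8·BuyerP. That is, the first-best gains-from-trade are at most twice the gains-from-trade of the seller-pricing mechanism plus eight times the gains-from-trade of the buyer-pricing mechanism. -/
open MeasureTheory Set

section helpers

set_option linter.unusedSectionVars false

variable (ν : Measure ℝ) [IsProbabilityMeasure ν] (F : ℝ → ℝ)

theorem aux_mono (h : ∀ x, F x = (ν (Iic x)).toReal) : Monotone F := by
  intro a b hab
  rw [h, h]
  exact ENNReal.toReal_mono (measure_ne_top _ _) (measure_mono (Iic_subset_Iic.2 hab))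

theorem aux_ofReal (h : ∀ x, F x = (ν (Iic x)).toReal) (x : ℝ) :
    ν (Iic x) = ENNReal.ofReal (F x) := by
  rw [h, ENNReal.ofReal_toReal (measure_ne_top _ _)]

theorem aux_nonneg (h : ∀ x, F x = (ν (Iic x)).toReal) (x : ℝ) : 0 ≤ F x := by
  rw [h]; exact ENNReal.toReal_nonneg

theorem aux_le_one (h : ∀ x, F x = (ν (Iic x)).toReal) (x : ℝ) : F x ≤ 1 := by
  rw [h]
  exact ENNReal.toReal_le_of_le_ofReal zero_le_one (by simpa using prob_le_one)

theorem aux_Ioc (h : ∀ x, F x = (ν (Iic x)).toReal) (a b : ℝ) (hab : a ≤ b) :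
    ν (Ioc a b) = ENNReal.ofReal (F b - F a) := by
  have h1 : Ioc a b = Iic b \ Iic a := by
    ext x; simp [and_comm]
  rw [h1, measure_sdiff (Iic_subset_Iic.2 hab) measurableSet_Iic.nullMeasurableSet
    (measure_ne_top _ _), aux_ofReal ν F h, aux_ofReal ν F h,
    ENNReal.ofReal_sub _ (aux_nonneg ν F h a)]

theorem aux_noAtoms (h : ∀ x, F x = (ν (Iic x)).toReal)
    (hc : ContinuousOn F (Icc 0 1)) (h0 : F 0 = 0) (h1 : F 1 = 1) : NullSingletonClass ν := by
  constructor
  intro x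
  rcases le_or_gt x 0 with hx | hx
  · have : ν (Iic 0) = 0 := by rw [aux_ofReal ν F h, h0]; simp
    exact measure_mono_null (by simpa using hx) this
  rcases le_or_gt x 1 with hx1 | hx1
  · have hle : ∀ y, y < x → ν {x} ≤ ENNReal.ofReal (F x - F y) := by
      intro y hy
      rw [← aux_Ioc ν F h y x hy.le]
      exact measure_mono (by simpa using hy)
    by_contra hne
    have hpos : 0 < (ν {x}).toReal := ENNReal.toReal_pos hne (measure_ne_top _ _)
    obtain ⟨δ, hδ, hd⟩ := Metric.continuousWithinAt_iff.1 (hc x ⟨hx.le, hx1⟩) _ hpos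
    have hy : max 0 (x - δ/2) < x := max_lt hx (by linarith)
    have h2 := hd (x := max 0 (x - δ/2)) ⟨le_max_left _ _, by linarith⟩ (by
      rw [Real.dist_eq, abs_lt]
      constructor
      · have := le_max_right 0 (x - δ/2); linarith
      · linarith)
    have h3 := ENNReal.toReal_le_of_le_ofReal
      (sub_nonneg.2 (aux_mono ν F h hy.le)) (hle _ hy)
    rw [Real.dist_eq, abs_lt] at h2
    linarith [h2.1]
  · have : ν (Ioi 1) = 0 := by
      have := prob_compl_eq_one_sub (μ := ν) (measurableSet_Iic (a := (1:ℝ)))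
      rw [compl_Iic] at this
      rw [this, aux_ofReal ν F h, h1]; simp
    exact measure_mono_null (by simpa using hx1) this

theorem aux_Icc [NullSingletonClass ν] (h : ∀ x, F x = (ν (Iic x)).toReal) (a b : ℝ) (hab : a ≤ b) :
    ν (Icc a b) = ENNReal.ofReal (F b - F a) := by
  rw [← aux_Ioc ν F h a b hab]
  exact measure_congr Ioc_ae_eq_Icc.symm

/-- quantile function -/
theorem aux_quantile (hc : ContinuousOn F (Icc 0 1)) (hm : StrictMonoOn F (Icc 0 1))
    (h0 : F 0 = 0) (h1 : F 1 = 1) :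
    ∃ Q : ℝ → ℝ, Monotone Q ∧ (∀ y, Q y ∈ Icc (0:ℝ) 1) ∧
      ∀ y, F (Q y) = max 0 (min 1 y) := by
  have : ∀ y : ℝ, ∃ x ∈ Icc (0:ℝ) 1, F x = max 0 (min 1 y) := by
    intro y
    have := intermediate_value_Icc (zero_le_one' ℝ) hc
    rw [h0, h1] at this
    exact this ⟨le_max_left _ _, max_le zero_le_one (min_le_left _ _)⟩
  choose Q hQ hF using this
  refine ⟨Q, ?_, hQ, hF⟩
  intro a b hab
  rw [← hm.le_iff_le (hQ a) (hQ b), hF, hF]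
  exact max_le_max le_rfl (min_le_min le_rfl hab)

/-- layer cake bound -/
theorem aux_layer [NullSingletonClass ν] (h : ∀ x, F x = (ν (Iic x)).toReal) (h1 : F 1 = 1)
    (c : ℝ) :
    ∫ v in Icc c 1, (v - c) ∂ν ≤ ∫ t in Ioc c 1, (1 - F t) := by
  have hmF := (aux_mono ν F h).measurable
  have hnn : ∀ t, 0 ≤ 1 - F t := fun t => sub_nonneg.2 (aux_le_one ν F h t)
  rw [← ENNReal.ofReal_le_ofReal_iff (integral_nonneg (fun t => hnn t))]
  rw [ofReal_integral_eq_lintegral_ofReal _ (Filter.Eventually.of_forall hnn),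
    ofReal_integral_eq_lintegral_ofReal]
  rotate_left
  · refine (Continuous.continuousOn (by fun_prop)).integrableOn_Icc
  · refine (ae_restrict_iff' measurableSet_Icc).2 (Filter.Eventually.of_forall ?_)
    intro v hv; exact sub_nonneg.2 hv.1
  · refine Measure.integrableOn_of_bounded (M := 1) (by simp) (by fun_prop) ?_
    refine Filter.Eventually.of_forall ?_
    intro t; rw [Real.norm_eq_abs, abs_le]
    constructor <;> linarith [hnn t, aux_nonneg ν F h t]
  calc ∫⁻ v in Icc c 1, ENNReal.ofReal (v - c) ∂ν
      = ∫⁻ v in Icc c 1, (∫⁻ t in Ioc c 1, {p : ℝ × ℝ | p.2 ≤ p.1}.indicator 1 (v, t)) ∂ν := by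
        refine setLIntegral_congr_fun measurableSet_Icc ?_
        intro v hv
        have : ∀ t : ℝ, {p : ℝ × ℝ | p.2 ≤ p.1}.indicator (1 : ℝ × ℝ → ENNReal) (v, t)
            = (Iic v).indicator 1 t := by
          intro t; simp [indicator]
        simp only [this]
        rw [lintegral_indicator_one measurableSet_Iic, Measure.restrict_apply measurableSet_Iic]
        have : Iic v ∩ Ioc c 1 = Ioc c v := by
          ext t; simp only [mem_inter_iff, mem_Iic, mem_Ioc]
          constructor
          · rintro ⟨a, b, d⟩; exact ⟨b, a⟩
          · rintro ⟨a, b⟩; exact ⟨b, a, b.trans hv.2⟩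
        rw [this, Real.volume_Ioc]
    _ = ∫⁻ t in Ioc c 1, (∫⁻ v in Icc c 1, {p : ℝ × ℝ | p.2 ≤ p.1}.indicator 1 (v, t) ∂ν) := by
        refine lintegral_lintegral_swap ?_
        have hs : MeasurableSet {p : ℝ × ℝ | p.2 ≤ p.1} :=
          measurableSet_le measurable_snd measurable_fst
        exact ((measurable_const (a := (1:ENNReal))).indicator hs).aemeasurable
    _ ≤ ∫⁻ t in Ioc c 1, ENNReal.ofReal (1 - F t) := by
        refine setLIntegral_mono' measurableSet_Ioc ?_
        intro t ht
        have : ∀ v : ℝ, {p : ℝ × ℝ | p.2 ≤ p.1}.indicator (1 : ℝ × ℝ → ENNReal) (v, t)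
            = (Ici t).indicator 1 v := by
          intro v; simp [indicator]
        simp only [this]
        rw [lintegral_indicator_one measurableSet_Ici, Measure.restrict_apply measurableSet_Ici]
        have h2 := aux_Icc ν F h t 1 ht.2
        rw [h1] at h2
        rw [← h2]
        refine measure_mono ?_
        rintro v ⟨a, b⟩; exact ⟨a, b.2⟩

/-- integrability of the gains function -/
theorem aux_integrable (μ : Measure ℝ) [IsProbabilityMeasure μ] (S : Set (ℝ × ℝ))
    (hS : MeasurableSet S)
    (hb : ∀ x y, x ∈ Icc (0:ℝ) 1 → (x, y) ∈ S → |x - y| ≤ 1) :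
    IntegrableOn (fun x => ∫ y in {y | (x, y) ∈ S}, (x - y) ∂ν) (Icc 0 1) μ := by
  have hmS : ∀ x, MeasurableSet {y | (x, y) ∈ S} := fun x => measurable_prodMk_left hS
  have heq : ∀ x, ∫ y in {y | (x, y) ∈ S}, (x - y) ∂ν
      = ∫ y, S.indicator (fun p => p.1 - p.2) (x, y) ∂ν := by
    intro x
    rw [← integral_indicator (hmS x)]
    rfl
  refine Measure.integrableOn_of_bounded (M := 1) (measure_ne_top _ _) ?_ ?_
  · simp only [heq]
    have : StronglyMeasurable (S.indicator (fun p : ℝ × ℝ => p.1 - p.2)) :=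
      ((measurable_fst.sub measurable_snd).indicator hS).stronglyMeasurable
    exact (this.integral_prod_right' (ν := ν)).aestronglyMeasurable
  · refine (ae_restrict_iff' measurableSet_Icc).2 (Filter.Eventually.of_forall ?_)
    intro x hx
    have h1 := norm_setIntegral_le_of_norm_le_const (μ := ν) (s := {y | (x, y) ∈ S})
      (f := fun y => x - y) (C := 1) (measure_lt_top _ _) (fun y hy => hb x y hx hy)
    refine h1.trans ?_
    rw [one_mul]
    exact ENNReal.toReal_le_of_le_ofReal zero_le_one (by simpa using prob_le_one)

end helpers

theorem stmt0
    (νF : Measure ℝ) [IsProbabilityMeasure νF]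
    (F : ℝ → ℝ) (hFcdf : ∀ x, F x = (νF (Iic x)).toReal)
    (hFcont : ContinuousOn F (Icc 0 1))
    (hFmono : StrictMonoOn F (Icc 0 1))
    (hF0 : F 0 = 0) (hF1 : F 1 = 1)
    (νG : Measure ℝ) [IsProbabilityMeasure νG]
    (G : ℝ → ℝ) (hGcdf : ∀ x, G x = (νG (Iic x)).toReal)
    (hGcont : ContinuousOn G (Icc 0 1))
    (hGmono : StrictMonoOn G (Icc 0 1))
    (hG0 : G 0 = 0) (hG1 : G 1 = 1)
    (r : ℝ → ℝ) (hrmeas : Measurable r)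
    (hrmem : ∀ c ∈ Icc (0:ℝ) 1, r c ∈ Icc (0:ℝ) 1)
    (hrmax : ∀ c ∈ Icc (0:ℝ) 1, ∀ p ∈ Icc (0:ℝ) 1,
      (p - c) * (1 - F p) ≤ (r c - c) * (1 - F (r c)))
    (r' : ℝ → ℝ) (hr'meas : Measurable r')
    (hr'mem : ∀ v ∈ Icc (0:ℝ) 1, r' v ∈ Icc (0:ℝ) 1)
    (hr'max : ∀ v ∈ Icc (0:ℝ) 1, ∀ p ∈ Icc (0:ℝ) 1,
      (v - p) * G p ≤ (v - r' v) * G (r' v))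
    (FB SP BuyerP : ℝ)
    (hFB : FB = ∫ c in Icc (0:ℝ) 1, (∫ v in Icc c 1, (v - c) ∂νF) ∂νG)
    (hSP : SP = ∫ c in Icc (0:ℝ) 1, (∫ v in Icc (r c) 1, (v - c) ∂νF) ∂νG)
    (hBuyerP : BuyerP = ∫ v in Icc (0:ℝ) 1, (∫ c in Icc 0 (r' v), (v - c) ∂νG) ∂νF)
    : FB ≤ 2 * SP + 8 * BuyerP := by
  haveI : NullSingletonClass νF := aux_noAtoms νF F hFcdf hFcont hF0 hF1
  haveI : NullSingletonClass νG := aux_noAtoms νG G hGcdf hGcont hG0 hG1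
  obtain ⟨Q, hQmono, hQmem, hFQ⟩ := aux_quantile F hFcont hFmono hF0 hF1
  have hFm := aux_mono νF F hFcdf
  have hGm := aux_mono νG G hGcdf
  have hF_nn := aux_nonneg νF F hFcdf
  have hF_le := aux_le_one νF F hFcdf
  have hG_nn := aux_nonneg νG G hGcdf
  have hG_le := aux_le_one νG G hGcdf
  have hFnn : ∀ t, 0 ≤ 1 - F t := fun t => sub_nonneg.2 (hF_le t)
  set m : ℝ → ℝ := fun c => Q ((1 + F c) / 2) with hm
  set b : ℝ → ℝ := fun w => Q (2 * F w - 1) with hb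
  have hm_mono : Monotone m := fun x y hxy => hQmono (by linarith [hFm hxy])
  have hb_mono : Monotone b := fun x y hxy => hQmono (by linarith [hFm hxy])
  have hFmc : ∀ c, F (m c) = (1 + F c) / 2 := by
    intro c
    simp only [hm, hFQ]
    rw [min_eq_right (by linarith [hF_le c]), max_eq_right (by linarith [hF_nn c])]
  have hFb : ∀ c, F (b c) = max 0 (2 * F c - 1) := by
    intro c
    simp only [hb, hFQ]
    rw [min_eq_right (by linarith [hF_le c])]
  have hle_iff : ∀ x ∈ Icc (0:ℝ) 1, ∀ y ∈ Icc (0:ℝ) 1, (F x ≤ F y ↔ x ≤ y) :=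
    fun x hx y hy => hFmono.le_iff_le hx hy
  have hm_ge : ∀ c ∈ Icc (0:ℝ) 1, c ≤ m c := by
    intro c hc
    rw [← hle_iff c hc _ (hQmem _), hFmc]; linarith [hF_le c]
  have hb_le : ∀ c ∈ Icc (0:ℝ) 1, b c ≤ c := by
    intro c hc
    rw [← hle_iff _ (hQmem _) c hc, hFb]
    exact max_le (hF_nn c) (by linarith [hF_le c])
  have hint : ∀ a d : ℝ, IntegrableOn (fun t => 1 - F t) (Ioc a d) := by
    intro a d
    refine Measure.integrableOn_of_bounded (M := 1) (by simp)
      (by have := hFm.measurable; fun_prop) ?_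
    refine Filter.Eventually.of_forall ?_
    intro t; rw [Real.norm_eq_abs, abs_le]
    constructor <;> linarith [hFnn t, hF_nn t]
  set L : ℝ → ℝ := fun c => ∫ t in Ioc (m c) 1, (1 - F t) with hL
  have hLnn : ∀ c, 0 ≤ L c := fun c => integral_nonneg (fun t => hFnn t)
  have hLanti : Antitone L := by
    intro x y hxy
    refine setIntegral_mono_set (hint _ _) (Filter.Eventually.of_forall hFnn) ?_
    exact (Ioc_subset_Ioc_left (hm_mono hxy)).eventuallyLE
  have hLint : IntegrableOn L (Icc 0 1) νG := by
    refine Measure.integrableOn_of_bounded (M := L 0) (measure_ne_top _ _)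
      hLanti.measurable.aestronglyMeasurable ?_
    refine (ae_restrict_iff' measurableSet_Icc).2 (Filter.Eventually.of_forall ?_)
    intro x hx
    rw [Real.norm_eq_abs, abs_of_nonneg (hLnn x)]
    exact hLanti hx.1
  -- seller profit bound
  have hSPc : ∀ c ∈ Icc (0:ℝ) 1,
      (r c - c) * (1 - F (r c)) ≤ ∫ v in Icc (r c) 1, (v - c) ∂νF := by
    intro c hc
    have hr := hrmem c hc
    calc (r c - c) * (1 - F (r c)) = ∫ v in Icc (r c) 1, (r c - c) ∂νF := by
          rw [setIntegral_const, measureReal_def, aux_Icc νF F hFcdf _ _ hr.2, hF1,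
            ENNReal.toReal_ofReal (hFnn _), smul_eq_mul, mul_comm]
      _ ≤ _ := by
          refine setIntegral_mono_on (by simp) 
            (Continuous.continuousOn (by fun_prop)).integrableOn_Icc measurableSet_Icc ?_
          intro v hv
          linarith [hv.1]
  -- buyer profit bound
  have hBPv : ∀ v ∈ Icc (0:ℝ) 1,
      (v - r' v) * G (r' v) ≤ ∫ c in Icc 0 (r' v), (v - c) ∂νG := by
    intro v hv
    have hr := hr'mem v hv
    calc (v - r' v) * G (r' v) = ∫ c in Icc 0 (r' v), (v - r' v) ∂νG := by
          rw [setIntegral_const, measureReal_def, aux_Icc νG G hGcdf _ _ hr.1, hG0, sub_zero,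
            ENNReal.toReal_ofReal (hG_nn _), smul_eq_mul, mul_comm]
      _ ≤ _ := by
          refine setIntegral_mono_on (by simp) 
            (Continuous.continuousOn (by fun_prop)).integrableOn_Icc measurableSet_Icc ?_
          intro c hc
          linarith [hc.2]
  have hBPnn : ∀ v ∈ Icc (0:ℝ) 1, 0 ≤ ∫ c in Icc 0 (r' v), (v - c) ∂νG := by
    intro v hv
    refine le_trans ?_ (hBPv v hv)
    simpa using hr'max v hv v hv
  have hFBc : ∀ c ∈ Icc (0:ℝ) 1, ∫ v in Icc c 1, (v - c) ∂νF
      ≤ 2 * (∫ v in Icc (r c) 1, (v - c) ∂νF) + L c := by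
    intro c hc
    have h1 := aux_layer νF F hFcdf hF1 c
    have h2 : ∫ t in Ioc c 1, (1 - F t) = (∫ t in Ioc c (m c), (1 - F t)) + L c := by
      rw [hL, ← setIntegral_union (Ioc_disjoint_Ioc_of_le le_rfl) measurableSet_Ioc
        (hint _ _) (hint _ _), Ioc_union_Ioc_eq_Ioc (hm_ge c hc) (hQmem _).2]
    have h3 : ∫ t in Ioc c (m c), (1 - F t) ≤ ∫ t in Ioc c (m c), (1 - F c) := by
      refine setIntegral_mono_on (hint _ _) (by simp) measurableSet_Ioc ?_
      intro t ht
      linarith [hFm ht.1.le]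
    rw [setIntegral_const, measureReal_def, Real.volume_Ioc,
      ENNReal.toReal_ofReal (sub_nonneg.2 (hm_ge c hc)), smul_eq_mul] at h3
    have h4 := hrmax c hc (m c) (hQmem _)
    rw [hFmc] at h4
    have h5 := hSPc c hc
    have h6 : (m c - c) * (1 - F c) = 2 * ((m c - c) * (1 - (1 + F c) / 2)) := by ring
    linarith
  have hSPint : IntegrableOn (fun c => ∫ v in Icc (r c) 1, (v - c) ∂νF) (Icc 0 1) νG := by
    have := aux_integrable νF νG {p : ℝ × ℝ | r p.1 ≤ p.2 ∧ p.2 ≤ 1}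
      ((measurableSet_le (hrmeas.comp measurable_fst) measurable_snd).inter
        (measurableSet_le measurable_snd measurable_const)) (by
        rintro x y hx ⟨h1, h2⟩
        have := (hrmem x hx).1
        simp only at h1 h2
        rw [abs_le]; constructor <;> linarith [hx.1, hx.2])
    refine this.neg.congr ?_
    refine Filter.Eventually.of_forall ?_
    intro x
    simp only [Pi.neg_apply, ← integral_neg, neg_sub]
    rfl
  have hBPint : IntegrableOn (fun v => ∫ c in Icc 0 (r' v), (v - c) ∂νG) (Icc 0 1) νF := by
    exact aux_integrable νG νF {p : ℝ × ℝ | 0 ≤ p.2 ∧ p.2 ≤ r' p.1}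
      ((measurableSet_le measurable_const measurable_snd).inter
        (measurableSet_le measurable_snd (hr'meas.comp measurable_fst))) (by
        rintro x y hx ⟨h1, h2⟩
        have := (hr'mem x hx).2
        simp only at h1 h2
        rw [abs_le]; constructor <;> linarith [hx.1, hx.2])
  have hBPtot : 0 ≤ BuyerP := by
    rw [hBuyerP]
    exact setIntegral_nonneg measurableSet_Icc hBPnn
  have hFBle : FB ≤ 2 * SP + ∫ c in Icc (0:ℝ) 1, L c ∂νG := by
    rw [hFB, hSP, ← integral_const_mul, ← integral_add (hSPint.const_mul 2) hLint]
    refine integral_mono_of_nonneg ?_ ((hSPint.const_mul 2).add hLint) ?_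
    · refine Filter.Eventually.of_forall ?_
      intro c
      exact setIntegral_nonneg measurableSet_Icc (fun v hv => sub_nonneg.2 hv.1)
    · refine (ae_restrict_iff' measurableSet_Icc).2 (Filter.Eventually.of_forall ?_)
      intro c hc
      exact hFBc c hc
  have hLB : ∫ c in Icc (0:ℝ) 1, L c ∂νG ≤ 2 * BuyerP := by
    rw [← ENNReal.ofReal_le_ofReal_iff (by linarith),
      ofReal_integral_eq_lintegral_ofReal hLint (Filter.Eventually.of_forall hLnn)]
    set f : ℝ → ENNReal := fun t => ENNReal.ofReal (1 - F t) with hf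
    set g : ℝ → ENNReal := fun t => ENNReal.ofReal (G (b t)) with hg
    have hfm : Measurable f := by have := hFm.measurable; fun_prop
    have hgm : Measurable g := by
      have := hGm.measurable; have := hb_mono.measurable; fun_prop
    set S : Set (ℝ × ℝ) := {p | m p.1 < p.2} with hS
    have hSm : MeasurableSet S :=
      measurableSet_lt (hm_mono.measurable.comp measurable_fst) measurable_snd
    set T : Set (ℝ × ℝ) := {p | b p.2 ≤ p.1 ∧ p.1 ≤ p.2} with hT
    have hTm : MeasurableSet T :=
      (measurableSet_le (hb_mono.measurable.comp measurable_snd) measurable_fst).inter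
        (measurableSet_le measurable_fst measurable_snd)
    calc ∫⁻ c in Icc (0:ℝ) 1, ENNReal.ofReal (L c) ∂νG
        = ∫⁻ c in Icc (0:ℝ) 1, (∫⁻ t in Icc (0:ℝ) 1,
            S.indicator (fun p => f p.2) (c, t)) ∂νG := by
          refine lintegral_congr fun c => ?_
          rw [hL, ofReal_integral_eq_lintegral_ofReal (hint _ _) (Filter.Eventually.of_forall hFnn)]
          have : ∀ t : ℝ, S.indicator (fun p => f p.2) (c, t) = (Ioi (m c)).indicator f t := by
            intro t; simp [indicator, hS]
          simp only [this]
          rw [lintegral_indicator measurableSet_Ioi, Measure.restrict_restrict measurableSet_Ioi]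
          have : Ioi (m c) ∩ Icc 0 1 = Ioc (m c) 1 := by
            ext t
            simp only [mem_inter_iff, mem_Ioi, mem_Icc, mem_Ioc]
            have := (hQmem ((1 + F c) / 2)).1
            constructor
            · rintro ⟨h1, h2, h3⟩; exact ⟨h1, h3⟩
            · rintro ⟨h1, h3⟩; exact ⟨h1, this.trans h1.le, h3⟩
          rw [this]
      _ = ∫⁻ t in Icc (0:ℝ) 1, (∫⁻ c in Icc (0:ℝ) 1,
            S.indicator (fun p => f p.2) (c, t) ∂νG) := by
          refine lintegral_lintegral_swap ?_
          exact ((hfm.comp measurable_snd).indicator hSm).aemeasurable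
      _ ≤ ∫⁻ t in Icc (0:ℝ) 1, f t * g t := by
          refine setLIntegral_mono' measurableSet_Icc ?_
          intro t ht
          have : ∀ c : ℝ, S.indicator (fun p => f p.2) (c, t)
              = {c | m c < t}.indicator (fun _ => f t) c := by
            intro c; simp [indicator, hS]
          simp only [this]
          have hms : MeasurableSet {c | m c < t} :=
            measurableSet_lt hm_mono.measurable measurable_const
          rw [lintegral_indicator_const hms, Measure.restrict_apply hms]
          gcongr
          rw [hg]
          simp only
          rw [← aux_ofReal νG G hGcdf]
          refine measure_mono ?_
          rintro c ⟨h1, h2⟩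
          simp only [mem_setOf_eq] at h1
          rw [mem_Iic, ← hle_iff c h2 _ (hQmem _), hFb]
          have := hFm h1.le
          rw [hFmc] at this
          exact le_max_of_le_right (by linarith)
      _ ≤ ∫⁻ t in Icc (0:ℝ) 1, 2 * (∫⁻ w in Icc (0:ℝ) 1,
            T.indicator (fun p => g p.1) (t, w) ∂νF) := by
          refine setLIntegral_mono' measurableSet_Icc ?_
          intro t ht
          have : ∀ w : ℝ, T.indicator (fun p => g p.1) (t, w)
              = {w | b w ≤ t ∧ t ≤ w}.indicator (fun _ => g t) w := by
            intro c; simp [indicator, hT]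
          simp only [this]
          have hms : MeasurableSet {w | b w ≤ t ∧ t ≤ w} :=
            (measurableSet_le hb_mono.measurable measurable_const).inter
              (measurableSet_le measurable_const measurable_id)
          rw [lintegral_indicator_const hms, Measure.restrict_apply hms]
          have key : νF (Icc t (m t)) ≤ νF ({w | b w ≤ t ∧ t ≤ w} ∩ Icc 0 1) := by
            refine measure_mono ?_
            rintro w ⟨h1, h2⟩
            have h3 : w ∈ Icc (0:ℝ) 1 := ⟨ht.1.trans h1, h2.trans (hQmem _).2⟩
            refine ⟨⟨?_, h1⟩, h3⟩
            rw [← hle_iff _ (hQmem _) t ht, hFb]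
            have := hFm h2
            rw [hFmc] at this
            exact max_le (hF_nn t) (by linarith)
          rw [aux_Icc νF F hFcdf _ _ (hm_ge t ht), hFmc] at key
          have h2 : f t = 2 * ENNReal.ofReal ((1 + F t) / 2 - F t) := by
            rw [hf, ← ENNReal.ofReal_ofNat, ← ENNReal.ofReal_mul (by norm_num)]
            have h3 : (1 - F t) = 2 * ((1 + F t) / 2 - F t) := by ring
            exact congrArg ENNReal.ofReal h3
          rw [h2, mul_assoc, mul_comm (g t)]
          gcongr
      _ = 2 * ∫⁻ t in Icc (0:ℝ) 1, (∫⁻ w in Icc (0:ℝ) 1,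
            T.indicator (fun p => g p.1) (t, w) ∂νF) := by
          rw [lintegral_const_mul' _ _ (by simp)]
      _ = 2 * ∫⁻ w in Icc (0:ℝ) 1, (∫⁻ t in Icc (0:ℝ) 1,
            T.indicator (fun p => g p.1) (t, w)) ∂νF := by
          congr 1
          refine lintegral_lintegral_swap ?_
          exact ((hgm.comp measurable_fst).indicator hTm).aemeasurable
      _ ≤ 2 * ∫⁻ w in Icc (0:ℝ) 1,
            ENNReal.ofReal (∫ c in Icc 0 (r' w), (w - c) ∂νG) ∂νF := by
          gcongr 2 * ?_
          refine setLIntegral_mono' measurableSet_Icc ?_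
          intro w hw
          calc ∫⁻ t in Icc (0:ℝ) 1, T.indicator (fun p => g p.1) (t, w)
              ≤ ∫⁻ t, (Icc (b w) w).indicator (fun _ => g w) t := by
                refine (setLIntegral_le_lintegral _ _).trans (lintegral_mono fun t => ?_)
                by_cases h : b w ≤ t ∧ t ≤ w
                · rw [indicator_of_mem (show (t, w) ∈ T from h),
                    indicator_of_mem (show t ∈ Icc (b w) w from h)]
                  exact ENNReal.ofReal_le_ofReal (hGm (hb_mono h.2))
                · rw [indicator_of_notMem (show (t, w) ∉ T from h)]
                  exact zero_le
            _ = ENNReal.ofReal ((w - b w) * G (b w)) := by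
                rw [lintegral_indicator_const measurableSet_Icc, Real.volume_Icc, mul_comm,
                  ENNReal.ofReal_mul (sub_nonneg.2 (hb_le w hw))]
            _ ≤ _ := ENNReal.ofReal_le_ofReal
                ((hr'max w hw (b w) (hQmem _)).trans (hBPv w hw))
      _ = ENNReal.ofReal (2 * BuyerP) := by
          rw [ENNReal.ofReal_mul (by norm_num), ENNReal.ofReal_ofNat, hBuyerP,
            ofReal_integral_eq_lintegral_ofReal hBPint
              ((ae_restrict_iff' measurableSet_Icc).2 (Filter.Eventually.of_forall hBPnn))]
  linarith
end

section
/- FB ≤ 10·max(SP, BuyerP). That is, the better of the seller-pricing mechanism and the buyer-pricing mechanism guarantees at least one tenth of the first-best gains-from-trade. -/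
open MeasureTheory Set

/-- Left-anchored rectangle bound. -/
lemma rect_left (T : Set ℝ) (h : ℝ → ℝ) (c M : ℝ) (hM : 0 ≤ M) (hT : T ⊆ Icc c 1)
    (H : ∀ x ∈ T, ∀ y ∈ T, h x * (y - c) ≤ M) (hTm : MeasurableSet T) :
    ∫⁻ x in T, ENNReal.ofReal (h x) ≤ ENNReal.ofReal M := by
  rcases T.eq_empty_or_nonempty with rfl | hne
  · simp
  have hbdd : BddAbove T := ⟨1, fun x hx => (hT hx).2⟩
  obtain ⟨t, ht⟩ := hne
  have hY : ∀ x ∈ T, x ≤ sSup T := fun x hx => le_csSup hbdd hx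
  have hcY : c ≤ sSup T := (hT ht).1.trans (hY t ht)
  have hsub : T ⊆ Icc c (sSup T) := fun x hx => ⟨(hT hx).1, hY x hx⟩
  rcases hcY.eq_or_lt with he | hlt
  · have : volume T = 0 := by
      refine measure_mono_null hsub ?_
      rw [← he]; simp
    rw [setLIntegral_measure_zero _ _ this]; simp
  · have hd : 0 < sSup T - c := by linarith
    have hb : ∀ x ∈ T, h x ≤ M / (sSup T - c) := by
      intro x hx
      rw [le_div_iff₀ hd]
      by_cases hx0 : h x ≤ 0
      · nlinarith
      · push Not at hx0
        have : sSup T ≤ M / h x + c := by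
          refine csSup_le ⟨t, ht⟩ fun y hy => ?_
          have := H x hx y hy
          have : y - c ≤ M / h x := by rw [le_div_iff₀ hx0]; linarith
          linarith
        have h2 : sSup T - c ≤ M / h x := by linarith
        rw [le_div_iff₀ hx0] at h2
        linarith
    calc ∫⁻ x in T, ENNReal.ofReal (h x) 
        ≤ ∫⁻ x in T, ENNReal.ofReal (M / (sSup T - c)) :=
          setLIntegral_mono' hTm fun x hx => ENNReal.ofReal_le_ofReal (hb x hx)
      _ = ENNReal.ofReal (M / (sSup T - c)) * volume T := by simp
      _ ≤ ENNReal.ofReal (M / (sSup T - c)) * volume (Icc c (sSup T)) := by gcongr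
      _ = ENNReal.ofReal M := by
          rw [Real.volume_Icc, ← ENNReal.ofReal_mul (by positivity), div_mul_cancel₀ _ hd.ne']

/-- Right-anchored rectangle bound. -/
lemma rect_right (T : Set ℝ) (h : ℝ → ℝ) (c M : ℝ) (hM : 0 ≤ M) (hT : T ⊆ Icc 0 c)
    (H : ∀ x ∈ T, ∀ y ∈ T, h x * (c - y) ≤ M) (hTm : MeasurableSet T) :
    ∫⁻ x in T, ENNReal.ofReal (h x) ≤ ENNReal.ofReal M := by
  rcases T.eq_empty_or_nonempty with rfl | hne
  · simp
  have hbdd : BddBelow T := ⟨0, fun x hx => (hT hx).1⟩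
  obtain ⟨t, ht⟩ := hne
  have hY : ∀ x ∈ T, sInf T ≤ x := fun x hx => csInf_le hbdd hx
  have hcY : sInf T ≤ c := (hY t ht).trans (hT ht).2
  have hsub : T ⊆ Icc (sInf T) c := fun x hx => ⟨hY x hx, (hT hx).2⟩
  rcases hcY.eq_or_lt with he | hlt
  · have : volume T = 0 := by
      refine measure_mono_null hsub ?_
      rw [he]; simp
    rw [setLIntegral_measure_zero _ _ this]; simp
  · have hd : 0 < c - sInf T := by linarith
    have hb : ∀ x ∈ T, h x ≤ M / (c - sInf T) := by
      intro x hx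
      rw [le_div_iff₀ hd]
      by_cases hx0 : h x ≤ 0
      · nlinarith
      · push Not at hx0
        have : c - M / h x ≤ sInf T := by
          refine le_csInf ⟨t, ht⟩ fun y hy => ?_
          have := H x hx y hy
          have : c - y ≤ M / h x := by rw [le_div_iff₀ hx0]; linarith
          linarith
        have h2 : c - sInf T ≤ M / h x := by linarith
        rw [le_div_iff₀ hx0] at h2
        linarith
    calc ∫⁻ x in T, ENNReal.ofReal (h x) 
        ≤ ∫⁻ x in T, ENNReal.ofReal (M / (c - sInf T)) :=
          setLIntegral_mono' hTm fun x hx => ENNReal.ofReal_le_ofReal (hb x hx)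
      _ = ENNReal.ofReal (M / (c - sInf T)) * volume T := by simp
      _ ≤ ENNReal.ofReal (M / (c - sInf T)) * volume (Icc (sInf T) c) := by gcongr
      _ = ENNReal.ofReal M := by
          rw [Real.volume_Icc, ← ENNReal.ofReal_mul (by positivity), div_mul_cancel₀ _ hd.ne']

/-- Charging lemma (Tonelli). -/
lemma charge (μ : Measure ℝ) [IsProbabilityMeasure μ] (A : Set ℝ) (hA : MeasurableSet A)
    (K : Set (ℝ × ℝ)) (hK : MeasurableSet K) (a b s : ℝ → ENNReal) (hb : Measurable b)
    (h1 : ∀ x ∈ A, a x ≤ 2 * μ.restrict (Icc 0 1) {c | (x, c) ∈ K})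
    (h2 : ∀ c ∈ Icc (0:ℝ) 1, ∫⁻ x in A ∩ {x | (x, c) ∈ K}, b x ≤ 2 * s c) :
    ∫⁻ x in A, a x * b x ≤ 4 * ∫⁻ c in Icc (0:ℝ) 1, s c ∂μ := by
  have hKx : ∀ x, MeasurableSet {c | (x, c) ∈ K} := fun x => measurable_prodMk_left hK
  have hKc : ∀ c, MeasurableSet {x | (x, c) ∈ K} := fun c => measurable_prodMk_right hK
  have hm : Measurable (fun p : ℝ × ℝ => K.indicator (fun q => 2 * b q.1) p) := by
    refine Measurable.indicator ?_ hK
    fun_prop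
  calc ∫⁻ x in A, a x * b x 
      ≤ ∫⁻ x in A, ∫⁻ c in Icc (0:ℝ) 1, K.indicator (fun q => 2 * b q.1) (x, c) ∂μ := by
        refine setLIntegral_mono' hA fun x hx => ?_
        have : (fun c => K.indicator (fun q => 2 * b q.1) (x, c)) =
            {c | (x, c) ∈ K}.indicator (fun _ => 2 * b x) := by
          ext c; simp [indicator]
        rw [this, lintegral_indicator (hKx x)]
        rw [lintegral_const, Measure.restrict_apply_univ]
        calc a x * b x ≤ (2 * μ.restrict (Icc 0 1) {c | (x, c) ∈ K}) * b x := by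
              gcongr; exact h1 x hx
          _ = _ := by ring
    _ = ∫⁻ c in Icc (0:ℝ) 1, (∫⁻ x in A, K.indicator (fun q => 2 * b q.1) (x, c)) ∂μ :=
        lintegral_lintegral_swap hm.aemeasurable
    _ ≤ ∫⁻ c in Icc (0:ℝ) 1, 4 * s c ∂μ := by
        refine setLIntegral_mono' measurableSet_Icc fun c hc => ?_
        have : (fun x => K.indicator (fun q => 2 * b q.1) (x, c)) =
            {x | (x, c) ∈ K}.indicator (fun x => 2 * b x) := by
          ext x; simp [indicator]
        rw [this, lintegral_indicator (hKc c), Measure.restrict_restrict (hKc c), inter_comm,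
          lintegral_const_mul _ hb]
        calc _ ≤ 2 * (2 * s c) := by gcongr; exact h2 c hc
          _ = _ := by ring
    _ = _ := lintegral_const_mul' _ _ (by simp)

lemma core
    (νF : Measure ℝ) [IsProbabilityMeasure νF]
    (F : ℝ → ℝ) (hFcdf : ∀ x, F x = (νF (Iic x)).toReal)
    (hFcont : ContinuousOn F (Icc 0 1))
    (hFmono : StrictMonoOn F (Icc 0 1))
    (hF0 : F 0 = 0) (hF1 : F 1 = 1)
    (νG : Measure ℝ) [IsProbabilityMeasure νG]
    (G : ℝ → ℝ) (hGcdf : ∀ x, G x = (νG (Iic x)).toReal)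
    (hGcont : ContinuousOn G (Icc 0 1))
    (hGmono : StrictMonoOn G (Icc 0 1))
    (hG0 : G 0 = 0) (hG1 : G 1 = 1)
    (S B : ℝ → ℝ)
    (hS : ∀ c ∈ Icc (0:ℝ) 1, ∀ p ∈ Icc (0:ℝ) 1, (p - c) * (1 - F p) ≤ S c)
    (hB : ∀ v ∈ Icc (0:ℝ) 1, ∀ p ∈ Icc (0:ℝ) 1, (v - p) * G p ≤ B v) :
    ∫⁻ x in Ioo (0:ℝ) 1, νG (Iic x) * νF (Ioi x) ≤
      4 * (∫⁻ c in Icc (0:ℝ) 1, ENNReal.ofReal (S c) ∂νG) +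
      4 * (∫⁻ v in Icc (0:ℝ) 1, ENNReal.ofReal (B v) ∂νF) := by
  have hFm : Monotone F := fun x y h => by
    rw [hFcdf, hFcdf]; exact ENNReal.toReal_mono (measure_ne_top _ _) (measure_mono (Iic_subset_Iic.2 h))
  have hGm : Monotone G := fun x y h => by
    rw [hGcdf, hGcdf]; exact ENNReal.toReal_mono (measure_ne_top _ _) (measure_mono (Iic_subset_Iic.2 h))
  have hFmeas : Measurable F := hFm.measurable
  have hGmeas : Measurable G := hGm.measurable
  have hGof : ∀ x, νG (Iic x) = ENNReal.ofReal (G x) := fun x => by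
    rw [hGcdf, ENNReal.ofReal_toReal (measure_ne_top _ _)]
  have hFof' : ∀ x, νF (Iic x) = ENNReal.ofReal (F x) := fun x => by
    rw [hFcdf, ENNReal.ofReal_toReal (measure_ne_top _ _)]
  have hFn : ∀ x, 0 ≤ F x := fun x => by rw [hFcdf]; positivity
  have hGn : ∀ x, 0 ≤ G x := fun x => by rw [hGcdf]; positivity
  have hF1' : ∀ x, F x ≤ 1 := fun x => by
    rw [hFcdf]; exact ENNReal.toReal_le_of_le_ofReal zero_le_one (by simpa using prob_le_one)
  have hFof : ∀ x, νF (Ioi x) = ENNReal.ofReal (1 - F x) := fun x => by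
    rw [← compl_Iic, prob_compl_eq_one_sub measurableSet_Iic, hFof', 
      ENNReal.ofReal_sub _ (hFn x), ENNReal.ofReal_one]
  have hGIoc : ∀ x y, x ≤ y → νG (Ioc x y) = ENNReal.ofReal (G y - G x) := fun x y h => by
    rw [show Ioc x y = Iic y \ Iic x by ext z; simp [and_comm], measure_sdiff (Iic_subset_Iic.2 h) nullMeasurableSet_Iic (measure_ne_top _ _),
      hGof, hGof, ENNReal.ofReal_sub _ (hGn x)]
  have hFIoc : ∀ x y, x ≤ y → νF (Ioc x y) = ENNReal.ofReal (F y - F x) := fun x y h => by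
    rw [show Ioc x y = Iic y \ Iic x by ext z; simp [and_comm], measure_sdiff (Iic_subset_Iic.2 h) nullMeasurableSet_Iic (measure_ne_top _ _),
      hFof', hFof', ENNReal.ofReal_sub _ (hFn x)]
  have hS0 : ∀ c ∈ Icc (0:ℝ) 1, 0 ≤ S c := fun c hc => by simpa using hS c hc c hc
  have hB0 : ∀ c ∈ Icc (0:ℝ) 1, 0 ≤ B c := fun c hc => by simpa using hB c hc c hc
  set N : Set ℝ := ⋃ y ∈ Icc (0:ℝ) 1, {x | x ∈ Ioo 0 y ∧ G y < 2 * G x ∧ 2 * (1 - F y) < 1 - F x}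
    with hN
  have hNo : IsOpen N := by
    refine isOpen_biUnion fun y hy => ?_
    have hsub : Ioo 0 y ⊆ Icc (0:ℝ) 1 := fun x hx => ⟨hx.1.le, hx.2.le.trans hy.2⟩
    have hc : ContinuousOn (fun x => (2 * G x, 1 - F x)) (Ioo 0 y) := by
      have := hFcont.mono hsub
      have := hGcont.mono hsub
      fun_prop
    have := hc.isOpen_inter_preimage isOpen_Ioo ((isOpen_Ioi (a := G y)).prod (isOpen_Ioi (a := 2 * (1 - F y))))
    convert this using 1
    ext x; simp
  have hNm : MeasurableSet N := hNo.measurableSet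
  have hNmem : ∀ x, x ∈ N ↔ ∃ y ∈ Icc (0:ℝ) 1, x ∈ Ioo 0 y ∧ G y < 2 * G x ∧ 2 * (1 - F y) < 1 - F x := by
    intro x; simp only [hN, mem_iUnion, mem_ofPred_eq, exists_prop]
  have hK1 : MeasurableSet {p : ℝ × ℝ | p.2 ≤ p.1 ∧ G p.1 < 2 * G p.2} :=
    (measurableSet_le measurable_snd measurable_fst).inter
      (measurableSet_lt (hGmeas.comp measurable_fst) ((hGmeas.comp measurable_snd).const_mul 2))
  have hK2 : MeasurableSet {p : ℝ × ℝ | p.1 ≤ p.2 ∧ 1 - F p.1 ≤ 2 * (1 - F p.2)} :=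
    (measurableSet_le measurable_fst measurable_snd).inter
      (measurableSet_le ((hFmeas.comp measurable_fst).const_sub 1)
        (((hFmeas.comp measurable_snd).const_sub 1).const_mul 2))
  have hunion : Ioo (0:ℝ) 1 ⊆ (Ioo 0 1 \ N) ∪ (Ioo 0 1 ∩ N) := by
    rw [sdiff_union_inter]
  refine (lintegral_mono_set hunion).trans ((lintegral_union_le _ _ _).trans (add_le_add ?_ ?_))
  · refine charge νG _ (measurableSet_Ioo.diff hNm) {p | p.2 ≤ p.1 ∧ G p.1 < 2 * G p.2} ?_ _ _ _ ?_ ?_ ?_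
    · exact hK1
    · simp_rw [hFof]; fun_prop
    · rintro x ⟨⟨hx0, hx1⟩, -⟩
      have hGx : 0 < G x := by
        rw [← hG0]; exact hGmono ⟨le_rfl, zero_le_one⟩ ⟨hx0.le, hx1.le⟩ hx0
      obtain ⟨c0, hc0, hGc0⟩ : G x / 2 ∈ G '' Icc 0 x := by
        refine intermediate_value_Icc hx0.le (hGcont.mono (Icc_subset_Icc le_rfl hx1.le)) ?_
        rw [hG0]; constructor <;> linarith
      have hsub : Ioc c0 x ⊆ {c | (x, c) ∈ {p : ℝ × ℝ | p.2 ≤ p.1 ∧ G p.1 < 2 * G p.2}} ∩ Icc 0 1 := by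
        intro c hc
        have hcI : c ∈ Icc (0:ℝ) 1 := ⟨hc0.1.trans hc.1.le, hc.2.trans hx1.le⟩
        refine ⟨⟨hc.2, ?_⟩, hcI⟩
        have := hGmono ⟨hc0.1, hc0.2.trans hx1.le⟩ hcI hc.1
        show G x < 2 * G c
        linarith
      have h3 : νG (Ioc c0 x) ≤ νG.restrict (Icc 0 1) {c | (x, c) ∈ {p : ℝ × ℝ | p.2 ≤ p.1 ∧ G p.1 < 2 * G p.2}} := by
        rw [Measure.restrict_apply' measurableSet_Icc]
        exact measure_mono hsub
      calc νG (Iic x) = 2 * νG (Ioc c0 x) := by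
            rw [hGof, hGIoc _ _ hc0.2, hGc0, ← ENNReal.ofReal_ofNat 2, ← ENNReal.ofReal_mul (by norm_num)]
            congr 1; ring
        _ ≤ _ := by gcongr
    · intro c hc
      simp_rw [hFof]
      rw [← ENNReal.ofReal_ofNat 2, ← ENNReal.ofReal_mul (by norm_num)]
      refine rect_left _ _ c _ (mul_nonneg zero_le_two (hS0 c hc)) ?_ ?_ ?_
      · rintro x ⟨⟨hx, -⟩, hx2⟩
        exact ⟨hx2.1, hx.2.le⟩
      · rintro x ⟨⟨hx, hxN⟩, hxc, hx2⟩ y ⟨⟨hy, hyN⟩, hyc, hy2⟩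
        simp only at hxc hx2 hyc hy2
        have key : 1 - F x ≤ 2 * (1 - F y) := by
          rcases lt_or_ge x y with h | h
          · by_contra hcon
            push Not at hcon
            refine hxN ((hNmem x).2 ⟨y, ⟨hy.1.le, hy.2.le⟩, ⟨hx.1, h⟩, ?_, hcon⟩)
            have := hGm hxc
            linarith
          · have := hFm h
            have := hF1' y
            linarith
        have := hS c hc y ⟨hy.1.le, hy.2.le⟩
        nlinarith [mul_le_mul_of_nonneg_right key (sub_nonneg.2 hyc)]
      · exact (measurableSet_Ioo.diff hNm).inter (measurable_prodMk_right hK1)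
  · simp_rw [mul_comm (νG _)]
    refine charge νF _ (measurableSet_Ioo.inter hNm) {p | p.1 ≤ p.2 ∧ 1 - F p.1 ≤ 2 * (1 - F p.2)} ?_ _ _ _ ?_ ?_ ?_
    · exact hK2
    · simp_rw [hGof]; fun_prop
    · rintro x ⟨⟨hx0, hx1⟩, -⟩
      have hFx : F x < 1 := by
        rw [← hF1]; exact hFmono ⟨hx0.le, hx1.le⟩ ⟨zero_le_one, le_rfl⟩ hx1
      obtain ⟨c0, hc0, hFc0⟩ : (1 + F x) / 2 ∈ F '' Icc x 1 := by
        refine intermediate_value_Icc hx1.le (hFcont.mono (Icc_subset_Icc hx0.le le_rfl)) ?_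
        rw [hF1]; constructor <;> linarith
      have hsub : Ioc x c0 ⊆ {c | (x, c) ∈ {p : ℝ × ℝ | p.1 ≤ p.2 ∧ 1 - F p.1 ≤ 2 * (1 - F p.2)}} ∩ Icc 0 1 := by
        intro c hc
        refine ⟨⟨hc.1.le, ?_⟩, ⟨hx0.le.trans hc.1.le, hc.2.trans hc0.2⟩⟩
        have := hFm hc.2
        show 1 - F x ≤ 2 * (1 - F c)
        linarith
      have h3 : νF (Ioc x c0) ≤ νF.restrict (Icc 0 1) {c | (x, c) ∈ {p : ℝ × ℝ | p.1 ≤ p.2 ∧ 1 - F p.1 ≤ 2 * (1 - F p.2)}} := by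
        rw [Measure.restrict_apply' measurableSet_Icc]
        exact measure_mono hsub
      calc νF (Ioi x) = 2 * νF (Ioc x c0) := by
            rw [hFof, hFIoc _ _ hc0.1, hFc0, ← ENNReal.ofReal_ofNat 2, ← ENNReal.ofReal_mul (by norm_num)]
            congr 1; ring
        _ ≤ _ := by gcongr
    · intro v hv
      simp_rw [hGof]
      rw [← ENNReal.ofReal_ofNat 2, ← ENNReal.ofReal_mul (by norm_num)]
      refine rect_right _ _ v _ (mul_nonneg zero_le_two (hB0 v hv)) ?_ ?_ ?_
      · rintro x ⟨⟨hx, -⟩, hx2⟩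
        exact ⟨hx.1.le, hx2.1⟩
      · rintro y ⟨⟨hy, hyN⟩, hyv, hy2⟩ x ⟨⟨hx, hxN⟩, hxv, hx2⟩
        simp only at hxv hx2 hyv hy2
        have key : G y ≤ 2 * G x := by
          rcases lt_or_ge x y with h | h
          · obtain ⟨z, hz, hxz, hGz, hFz⟩ := (hNmem x).1 hxN
            have hyz : y ≤ z := by
              by_contra hcon
              push Not at hcon
              have h1 := hFm hcon.le
              have h2 := hFm hyv
              linarith
            have := hGm hyz
            linarith
          · have := hGm h
            have := hGn x
            linarith
        have := hB v hv x ⟨hx.1.le, hx.2.le⟩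
        nlinarith [mul_le_mul_of_nonneg_right key (sub_nonneg.2 hxv)]
      · exact (measurableSet_Ioo.inter hNm).inter (measurable_prodMk_right hK2)

lemma ofReal_int_le (μ : Measure ℝ) (f : ℝ → ℝ) (hf : ∀ᵐ x ∂μ, 0 ≤ f x) :
    ENNReal.ofReal (∫ x, f x ∂μ) ≤ ∫⁻ x, ENNReal.ofReal (f x) ∂μ := by
  rw [← Real.enorm_of_nonneg (integral_nonneg_of_ae hf)]
  refine (enorm_integral_le_lintegral_enorm _).trans (lintegral_mono_ae ?_)
  filter_upwards [hf] with x hx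
  rw [Real.enorm_of_nonneg hx]

/-- First-best as an integral over prices (upper bound). -/
lemma fb_le (μ ν : Measure ℝ) [IsProbabilityMeasure μ] [IsProbabilityMeasure ν] :
    ENNReal.ofReal (∫ c in Icc (0:ℝ) 1, (∫ v in Icc c 1, (v - c) ∂μ) ∂ν) ≤
      ∫⁻ x in Ioo (0:ℝ) 1, ν (Iic x) * μ (Ioi x) := by
  have e1 : ∀ c, 0 ≤ ∫ v in Icc c 1, (v - c) ∂μ := fun c =>
    setIntegral_nonneg measurableSet_Icc fun v hv => sub_nonneg.2 hv.1
  have hm : Measurable (fun q : (ℝ × ℝ) × ℝ =>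
      {q : (ℝ × ℝ) × ℝ | q.1.2 < q.1.1 ∧ q.1.1 < q.2}.indicator (fun _ => (1:ENNReal)) q) := by
    refine measurable_const.indicator ?_
    exact (measurableSet_lt measurable_fst.snd measurable_fst.fst).inter
      (measurableSet_lt measurable_fst.fst measurable_snd)
  calc ENNReal.ofReal (∫ c in Icc (0:ℝ) 1, (∫ v in Icc c 1, (v - c) ∂μ) ∂ν)
      ≤ ∫⁻ c in Icc (0:ℝ) 1, ENNReal.ofReal (∫ v in Icc c 1, (v - c) ∂μ) ∂ν := by
        exact ofReal_int_le _ _ (Filter.Eventually.of_forall e1)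
    _ ≤ ∫⁻ c in Icc (0:ℝ) 1, ∫⁻ v in Icc c 1, ENNReal.ofReal (v - c) ∂μ ∂ν := by
        refine lintegral_mono fun c => ?_
        exact ofReal_int_le _ _ ((ae_restrict_iff' measurableSet_Icc).2
          (Filter.Eventually.of_forall fun v hv => sub_nonneg.2 hv.1))
    _ ≤ ∫⁻ c in Icc (0:ℝ) 1, ∫⁻ v, ∫⁻ x in Ioo (0:ℝ) 1, 
          {q : (ℝ × ℝ) × ℝ | q.1.2 < q.1.1 ∧ q.1.1 < q.2}.indicator (fun _ => (1:ENNReal)) ((x, c), v) ∂volume ∂μ ∂ν := by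
        refine setLIntegral_mono' measurableSet_Icc fun c hc => ?_
        refine le_trans (setLIntegral_mono' measurableSet_Icc fun v hv => ?_) (setLIntegral_le_lintegral _ _)
        have : (fun x => {q : (ℝ × ℝ) × ℝ | q.1.2 < q.1.1 ∧ q.1.1 < q.2}.indicator
            (fun _ => (1:ENNReal)) ((x, c), v)) = (Ioo c v).indicator (fun _ => 1) := by
          ext x; simp [indicator]
        rw [this, lintegral_indicator measurableSet_Ioo, Measure.restrict_restrict measurableSet_Ioo,
          inter_eq_self_of_subset_left (Ioo_subset_Ioo hc.1 hv.2)]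
        simp
    _ = ∫⁻ c in Icc (0:ℝ) 1, ∫⁻ x in Ioo (0:ℝ) 1, ∫⁻ v, 
          {q : (ℝ × ℝ) × ℝ | q.1.2 < q.1.1 ∧ q.1.1 < q.2}.indicator (fun _ => (1:ENNReal)) ((x, c), v) ∂μ ∂volume ∂ν := by
        refine lintegral_congr fun c => ?_
        refine lintegral_lintegral_swap (Measurable.aemeasurable ?_)
        exact hm.comp (by fun_prop : Measurable fun p : ℝ × ℝ => ((p.2, c), p.1))
    _ = ∫⁻ x in Ioo (0:ℝ) 1, ∫⁻ c in Icc (0:ℝ) 1, ∫⁻ v, 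
          {q : (ℝ × ℝ) × ℝ | q.1.2 < q.1.1 ∧ q.1.1 < q.2}.indicator (fun _ => (1:ENNReal)) ((x, c), v) ∂μ ∂ν := by
        refine lintegral_lintegral_swap (Measurable.aemeasurable ?_)
        exact (hm.lintegral_prod_right' (ν := μ)).comp (by fun_prop : Measurable fun p : ℝ × ℝ => (p.2, p.1))
    _ ≤ ∫⁻ x in Ioo (0:ℝ) 1, ν (Iic x) * μ (Ioi x) := by
        refine lintegral_mono fun x => ?_
        calc _ ≤ ∫⁻ c, ∫⁻ v, (Iic x).indicator (fun _ => 1) c * (Ioi x).indicator (fun _ => 1) v ∂μ ∂ν := by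
              refine le_trans (setLIntegral_le_lintegral _ _) ?_
              refine lintegral_mono fun c => lintegral_mono fun v => ?_
              simp only [indicator, mem_ofPred_eq, mem_Iic, mem_Ioi]
              split_ifs with h1 h2 h3 <;> simp_all <;> grind
          _ = _ := by
              rw [lintegral_lintegral_mul (by fun_prop (disch := measurability)) (by fun_prop (disch := measurability))]
              simp

/-- Lower bound for the mechanism surplus. -/
lemma mech_ge (μ : Measure ℝ) [IsProbabilityMeasure μ] (h S : ℝ → ℝ) (hm : StronglyMeasurable h)
    (h0 : ∀ c ∈ Icc (0:ℝ) 1, 0 ≤ h c) (h1 : ∀ c ∈ Icc (0:ℝ) 1, h c ≤ 1)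
    (hS : ∀ c ∈ Icc (0:ℝ) 1, S c ≤ h c) :
    ∫⁻ c in Icc (0:ℝ) 1, ENNReal.ofReal (S c) ∂μ ≤ ENNReal.ofReal (∫ c in Icc (0:ℝ) 1, h c ∂μ) := by
  rw [ofReal_integral_eq_lintegral_ofReal]
  · exact setLIntegral_mono' measurableSet_Icc fun c hc => ENNReal.ofReal_le_ofReal (hS c hc)
  · refine Measure.integrableOn_of_bounded (M := 1) (measure_ne_top _ _) hm.aestronglyMeasurable ?_
    refine (ae_restrict_iff' measurableSet_Icc).2 (Filter.Eventually.of_forall fun c hc => ?_)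
    rw [Real.norm_of_nonneg (h0 c hc)]; exact h1 c hc
  · exact (ae_restrict_iff' measurableSet_Icc).2 (Filter.Eventually.of_forall h0)

theorem stmt1
    (νF : Measure ℝ) [IsProbabilityMeasure νF]
    (F : ℝ → ℝ) (hFcdf : ∀ x, F x = (νF (Iic x)).toReal)
    (hFcont : ContinuousOn F (Icc 0 1))
    (hFmono : StrictMonoOn F (Icc 0 1))
    (hF0 : F 0 = 0) (hF1 : F 1 = 1)
    (νG : Measure ℝ) [IsProbabilityMeasure νG]
    (G : ℝ → ℝ) (hGcdf : ∀ x, G x = (νG (Iic x)).toReal)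
    (hGcont : ContinuousOn G (Icc 0 1))
    (hGmono : StrictMonoOn G (Icc 0 1))
    (hG0 : G 0 = 0) (hG1 : G 1 = 1)
    (r : ℝ → ℝ) (hrmeas : Measurable r)
    (hrmem : ∀ c ∈ Icc (0:ℝ) 1, r c ∈ Icc (0:ℝ) 1)
    (hrmax : ∀ c ∈ Icc (0:ℝ) 1, ∀ p ∈ Icc (0:ℝ) 1,
      (p - c) * (1 - F p) ≤ (r c - c) * (1 - F (r c)))
    (r' : ℝ → ℝ) (hr'meas : Measurable r')
    (hr'mem : ∀ v ∈ Icc (0:ℝ) 1, r' v ∈ Icc (0:ℝ) 1)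
    (hr'max : ∀ v ∈ Icc (0:ℝ) 1, ∀ p ∈ Icc (0:ℝ) 1,
      (v - p) * G p ≤ (v - r' v) * G (r' v))
    (FB SP BuyerP : ℝ)
    (hFB : FB = ∫ c in Icc (0:ℝ) 1, (∫ v in Icc c 1, (v - c) ∂νF) ∂νG)
    (hSP : SP = ∫ c in Icc (0:ℝ) 1, (∫ v in Icc (r c) 1, (v - c) ∂νF) ∂νG)
    (hBuyerP : BuyerP = ∫ v in Icc (0:ℝ) 1, (∫ c in Icc 0 (r' v), (v - c) ∂νG) ∂νF)
    : FB ≤ 10 * max SP BuyerP := by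
  have hFm : Monotone F := fun x y h => by
    rw [hFcdf, hFcdf]; exact ENNReal.toReal_mono (measure_ne_top _ _) (measure_mono (Iic_subset_Iic.2 h))
  have hF1' : ∀ x, F x ≤ 1 := fun x => by
    rw [hFcdf]; exact ENNReal.toReal_le_of_le_ofReal zero_le_one (by simpa using prob_le_one)
  have hGn : ∀ x, 0 ≤ G x := fun x => by rw [hGcdf]; positivity
  have hrc : ∀ c ∈ Icc (0:ℝ) 1, c ≤ r c := by
    intro c hc
    by_contra hcon
    push Not at hcon
    have h1 := hrmax c hc c hc
    have h2 := hFmono (hrmem c hc) hc hcon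
    have h3 := hF1' c
    nlinarith
  have hrv : ∀ v ∈ Icc (0:ℝ) 1, r' v ≤ v := by
    intro v hv
    by_contra hcon
    push Not at hcon
    have h1 := hr'max v hv v hv
    have h2 := hGmono hv (hr'mem v hv) hcon
    have h3 := hGn v
    nlinarith
  have hintF : ∀ a b c : ℝ, IntegrableOn (fun v => v - c) (Icc a b) νF := fun a b c =>
    (by fun_prop : Continuous fun v : ℝ => v - c).continuousOn.integrableOn_compact isCompact_Icc
  have hintG : ∀ a b c : ℝ, IntegrableOn (fun v => c - v) (Icc a b) νG := fun a b c =>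
    (by fun_prop : Continuous fun v : ℝ => c - v).continuousOn.integrableOn_compact isCompact_Icc
  -- seller side
  have hSPge : ∫⁻ c in Icc (0:ℝ) 1, ENNReal.ofReal ((r c - c) * (1 - F (r c))) ∂νG ≤ ENNReal.ofReal SP := by
    rw [hSP]
    refine mech_ge νG _ _ ?_ ?_ ?_ ?_
    · have hD : MeasurableSet {p : ℝ × ℝ | r p.1 ≤ p.2 ∧ p.2 ≤ 1} :=
        (measurableSet_le (hrmeas.comp measurable_fst) measurable_snd).inter
          (measurableSet_le measurable_snd measurable_const)
      have hsm : StronglyMeasurable ({p : ℝ × ℝ | r p.1 ≤ p.2 ∧ p.2 ≤ 1}.indicator (fun p => p.2 - p.1)) :=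
        ((measurable_snd.sub measurable_fst).indicator hD).stronglyMeasurable
      have := hsm.integral_prod_right' (ν := νF)
      convert this using 2 with c
      rw [← integral_indicator measurableSet_Icc]
      congr 1
    · intro c hc
      exact setIntegral_nonneg measurableSet_Icc fun v hv => sub_nonneg.2 ((hrc c hc).trans hv.1)
    · intro c hc
      calc ∫ v in Icc (r c) 1, (v - c) ∂νF ≤ ∫ v in Icc (r c) 1, (1:ℝ) ∂νF := by
            refine setIntegral_mono_on (hintF _ _ _) (by simp) measurableSet_Icc fun v hv => ?_
            linarith [hv.2, hc.1]
        _ ≤ 1 := by simpa using measureReal_le_one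
    · intro c hc
      calc (r c - c) * (1 - F (r c)) ≤ (r c - c) * νF.real (Icc (r c) 1) := by
            have h1 : νF.real (Iic 1) ≤ νF.real (Iic (r c)) + νF.real (Icc (r c) 1) := by
              refine le_trans (measureReal_mono ?_) (measureReal_union_le _ _)
              intro x hx
              rcases le_total x (r c) with h | h
              · exact Or.inl h
              · exact Or.inr ⟨h, hx⟩
            have h2 := hFcdf 1
            have h3 := hFcdf (r c)
            simp only [Measure.real] at *
            refine mul_le_mul_of_nonneg_left ?_ (sub_nonneg.2 (hrc c hc))
            linarith
        _ = ∫ v in Icc (r c) 1, (r c - c) ∂νF := by simp [mul_comm]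
        _ ≤ _ := by
            refine setIntegral_mono_on (by simp) (hintF _ _ _) measurableSet_Icc fun v hv => ?_
            linarith [hv.1]
  -- buyer side
  have hBPge : ∫⁻ v in Icc (0:ℝ) 1, ENNReal.ofReal ((v - r' v) * G (r' v)) ∂νF ≤ ENNReal.ofReal BuyerP := by
    rw [hBuyerP]
    refine mech_ge νF _ _ ?_ ?_ ?_ ?_
    · have hD : MeasurableSet {p : ℝ × ℝ | 0 ≤ p.2 ∧ p.2 ≤ r' p.1} :=
        (measurableSet_le measurable_const measurable_snd).inter
          (measurableSet_le measurable_snd (hr'meas.comp measurable_fst))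
      have hsm : StronglyMeasurable ({p : ℝ × ℝ | 0 ≤ p.2 ∧ p.2 ≤ r' p.1}.indicator (fun p => p.1 - p.2)) :=
        ((measurable_fst.sub measurable_snd).indicator hD).stronglyMeasurable
      have := hsm.integral_prod_right' (ν := νG)
      convert this using 2 with c
      rw [← integral_indicator measurableSet_Icc]
      congr 1
    · intro v hv
      exact setIntegral_nonneg measurableSet_Icc fun c hc => sub_nonneg.2 (hc.2.trans (hrv v hv))
    · intro v hv
      calc ∫ c in Icc 0 (r' v), (v - c) ∂νG ≤ ∫ c in Icc 0 (r' v), (1:ℝ) ∂νG := by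
            refine setIntegral_mono_on (hintG _ _ _) (by simp) measurableSet_Icc fun c hc => ?_
            linarith [hc.1, hv.2]
        _ ≤ 1 := by simpa using measureReal_le_one
    · intro v hv
      calc (v - r' v) * G (r' v) ≤ (v - r' v) * νG.real (Icc 0 (r' v)) := by
            have h1 : νG.real (Iic (r' v)) ≤ νG.real (Iic 0) + νG.real (Icc 0 (r' v)) := by
              refine le_trans (measureReal_mono ?_) (measureReal_union_le _ _)
              intro x hx
              rcases le_total x 0 with h | h
              · exact Or.inl h
              · exact Or.inr ⟨h, hx⟩
            have h2 := hGcdf 0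
            have h3 := hGcdf (r' v)
            simp only [Measure.real] at *
            refine mul_le_mul_of_nonneg_left ?_ (sub_nonneg.2 (hrv v hv))
            linarith
        _ = ∫ c in Icc 0 (r' v), (v - r' v) ∂νG := by simp [mul_comm]
        _ ≤ _ := by
            refine setIntegral_mono_on (by simp) (hintG _ _ _) measurableSet_Icc fun c hc => ?_
            linarith [hc.2]
  have hSP0 : 0 ≤ SP := by
    rw [hSP]
    refine setIntegral_nonneg measurableSet_Icc fun c hc => ?_
    exact setIntegral_nonneg measurableSet_Icc fun v hv => sub_nonneg.2 ((hrc c hc).trans hv.1)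
  have hBP0 : 0 ≤ BuyerP := by
    rw [hBuyerP]
    refine setIntegral_nonneg measurableSet_Icc fun v hv => ?_
    exact setIntegral_nonneg measurableSet_Icc fun c hc => sub_nonneg.2 (hc.2.trans (hrv v hv))
  have hcore := core νF F hFcdf hFcont hFmono hF0 hF1 νG G hGcdf hGcont hGmono hG0 hG1
    (fun c => (r c - c) * (1 - F (r c))) (fun v => (v - r' v) * G (r' v)) hrmax hr'max
  have hfb : ENNReal.ofReal FB ≤ ENNReal.ofReal (4 * SP + 4 * BuyerP) := by
    rw [ENNReal.ofReal_add (by positivity) (by positivity), ENNReal.ofReal_mul (by norm_num),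
      ENNReal.ofReal_mul (by norm_num), ENNReal.ofReal_ofNat]
    calc ENNReal.ofReal FB ≤ _ := by rw [hFB]; exact fb_le νF νG
      _ ≤ _ := hcore
      _ ≤ _ := by gcongr
  have := (ENNReal.ofReal_le_ofReal_iff (by positivity)).1 hfb
  have := le_max_left SP BuyerP
  have := le_max_right SP BuyerP
  linarith
end

section
/- For every α ∈ [1/5, 4/5], FB ≤ 10·(α·SP + (1 − α)·BuyerP). That is, the randomized mechanism that runs the seller-pricing mechanism with probability α and the buyer-pricing mechanism with probability 1 − α is a 10-approximation to the first-best gains-from-trade. -/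
open MeasureTheory Set

lemma cdf_ae_mem (ν : Measure ℝ) [IsProbabilityMeasure ν] (F : ℝ → ℝ)
    (hF : ∀ x, F x = (ν (Iic x)).toReal) (hF0 : F 0 = 0) (hF1 : F 1 = 1) :
    ∀ᵐ x ∂ν, x ∈ Icc (0:ℝ) 1 := by
  have h0 : ν (Iic 0) = 0 := by
    have := hF 0
    rw [hF0] at this
    rcases (ENNReal.toReal_eq_zero_iff _).1 this.symm with h | h
    · exact h
    · exact absurd h (measure_ne_top _ _)
  have h1 : ν (Iic 1) = 1 := by
    have := hF 1
    rw [hF1] at this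
    rw [← ENNReal.ofReal_toReal (measure_ne_top ν (Iic 1)), ← this]; simp
  have h1' : ∀ᵐ x ∂ν, x ∈ Iic (1:ℝ) := by
    rw [← prob_compl_eq_zero_iff measurableSet_Iic] at h1
    exact mem_ae_iff.2 h1
  have h0' : ∀ᵐ x ∂ν, x ∉ Iic (0:ℝ) := measure_eq_zero_iff_ae_notMem.1 h0
  filter_upwards [h0', h1'] with x hx hx1
  simp only [mem_Iic, not_le] at hx hx1
  exact ⟨hx.le, hx1⟩

lemma integrable_of_bdd (μ ν : Measure ℝ) [IsProbabilityMeasure μ] [IsProbabilityMeasure ν]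
    (hμ : ∀ᵐ x ∂μ, x ∈ Icc (0:ℝ) 1) (hν : ∀ᵐ x ∂ν, x ∈ Icc (0:ℝ) 1)
    (h : ℝ × ℝ → ℝ) (hm : Measurable h)
    (hb : ∀ x ∈ Icc (0:ℝ) 1, ∀ y ∈ Icc (0:ℝ) 1, |h (x, y)| ≤ 1) :
    Integrable h (μ.prod ν) := by
  refine (integrable_const (1:ℝ)).mono' hm.aestronglyMeasurable ?_
  filter_upwards [Measure.quasiMeasurePreserving_fst.ae hμ,
    Measure.quasiMeasurePreserving_snd.ae hν] with z h1 h2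
  exact hb z.1 h1 z.2 h2

lemma integrable_of_bdd1 (μ : Measure ℝ) [IsProbabilityMeasure μ]
    (hμ : ∀ᵐ x ∂μ, x ∈ Icc (0:ℝ) 1)
    (h : ℝ → ℝ) (hm : Measurable h)
    (hb : ∀ x ∈ Icc (0:ℝ) 1, |h x| ≤ 1) :
    Integrable h μ := by
  refine (integrable_const (1:ℝ)).mono' hm.aestronglyMeasurable ?_
  filter_upwards [hμ] with z h1
  exact hb z h1

/-- Existence of the half-quantile shift `m` and its inverse `u`. -/
lemma exists_quantile (ν : Measure ℝ) [IsProbabilityMeasure ν] (F : ℝ → ℝ)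
    (hF : ∀ x, F x = (ν (Iic x)).toReal)
    (hFcont : ContinuousOn F (Icc 0 1))
    (hFmono : StrictMonoOn F (Icc 0 1))
    (hF0 : F 0 = 0) (hF1 : F 1 = 1) :
    ∃ m u : ℝ → ℝ, Measurable u ∧ (∀ x, m x ∈ Icc (0:ℝ) 1) ∧ (∀ x, u x ∈ Icc (0:ℝ) 1) ∧
      (∀ x, F (m x) = (1 + F x) / 2) ∧
      (∀ v ∈ Icc (0:ℝ) 1, u v ≤ v) ∧ (∀ v ∈ Icc (0:ℝ) 1, v ≤ m v) ∧
      (∀ v ∈ Icc (0:ℝ) 1, ∀ x, 0 ≤ x → (u v ≤ x ↔ v ≤ m x)) ∧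
      Measure.map u (ν.restrict (Ioi (m 0))) = (1/2 : ENNReal) • ν := by
  have hmono : Monotone F := by
    intro x y hxy
    rw [hF, hF]
    exact ENNReal.toReal_mono (measure_ne_top _ _) (measure_mono (Iic_subset_Iic.2 hxy))
  have hFle : ∀ x, F x ≤ 1 := fun x => by
    rw [hF]; exact ENNReal.toReal_le_of_le_ofReal (by norm_num) (by simpa using prob_le_one)
  have hFnn : ∀ x, 0 ≤ F x := fun x => by rw [hF]; exact ENNReal.toReal_nonneg
  have hsurj : ∀ t : ℝ, ∃ x ∈ Icc (0:ℝ) 1, F x = max 0 (min 1 t) := by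
    intro t
    have := intermediate_value_Icc (zero_le_one' ℝ) hFcont
    rw [hF0, hF1] at this
    exact this ⟨le_max_left _ _, max_le zero_le_one (min_le_left _ _)⟩
  choose Q hQmem hQ using hsurj
  have hle : ∀ x ∈ Icc (0:ℝ) 1, ∀ y ∈ Icc (0:ℝ) 1, (x ≤ y ↔ F x ≤ F y) :=
    fun x hx y hy => (hFmono.le_iff_le hx hy).symm
  have hQmono : Monotone Q := by
    intro s t hst
    rw [hle _ (hQmem s) _ (hQmem t), hQ, hQ]
    exact max_le_max le_rfl (min_le_min le_rfl hst)
  have hFm : ∀ x, F (Q ((1 + F x)/2)) = (1 + F x)/2 := by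
    intro x
    rw [hQ, min_eq_right, max_eq_right] <;> linarith [hFle x, hFnn x]
  have hFu : ∀ x, F (Q (2 * F x - 1)) = max 0 (2 * F x - 1) := by
    intro x
    rw [hQ, min_eq_right]; linarith [hFle x]
  have humono : Monotone (fun x => Q (2 * F x - 1)) := fun x y hxy =>
    hQmono (by linarith [hmono hxy])
  have hgal : ∀ v ∈ Icc (0:ℝ) 1, ∀ x, 0 ≤ x →
      (Q (2 * F v - 1) ≤ x ↔ v ≤ Q ((1 + F x)/2)) := by
    intro v hv x hx
    rcases le_total x 1 with h1 | h1
    · rw [hle _ (hQmem _) _ ⟨hx, h1⟩, hle _ hv _ (hQmem _), hFu, hFm, max_le_iff]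
      constructor
      · rintro ⟨_, h⟩; linarith
      · intro h; exact ⟨hFnn x, by linarith⟩
    · have : F x = 1 := le_antisymm (hFle x) (hF1 ▸ hmono h1)
      constructor
      · intro _
        rw [hle _ hv _ (hQmem _), hFm, this]; linarith [hFle v]
      · intro _; exact (hQmem _).2.trans h1
  have hae := cdf_ae_mem ν F hF hF0 hF1
  refine ⟨fun x => Q ((1 + F x)/2), fun x => Q (2 * F x - 1), humono.measurable,
    fun x => hQmem _, fun x => hQmem _, hFm, ?_, ?_, hgal, ?_⟩
  · intro v hv
    rw [hle _ (hQmem _) _ hv, hFu]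
    exact max_le (hFnn v) (by linarith [hFle v])
  · intro v hv
    rw [hle _ hv _ (hQmem _), hFm]; linarith [hFle v]
  · refine Measure.ext_of_Iic _ _ fun x => ?_
    rw [Measure.map_apply humono.measurable measurableSet_Iic,
      Measure.restrict_apply (humono.measurable measurableSet_Iic), Measure.smul_apply]
    rcases lt_or_ge x 0 with hx | hx
    · have e1 : ν (Iic x) = 0 := by
        refine measure_eq_zero_iff_ae_notMem.2 ?_
        filter_upwards [hae] with y hy hyx
        exact absurd (hy.1.trans hyx) (not_le.2 hx)
      have e2 : (fun x => Q (2 * F x - 1)) ⁻¹' Iic x = ∅ := by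
        ext y
        simp only [mem_preimage, mem_Iic, mem_empty_iff_false, iff_false, not_le]
        exact hx.trans_le (hQmem _).1
      rw [e1, e2]; simp
    · have e1 : ν ((fun x => Q (2 * F x - 1)) ⁻¹' Iic x ∩ Ioi (Q ((1 + F 0)/2)))
          = ν (Iic (Q ((1 + F x)/2)) \ Iic (Q ((1 + F 0)/2))) := by
        refine measure_congr ?_
        filter_upwards [hae] with v hv
        have := hgal v hv x hx
        apply propext
        change (Q (2 * F v - 1) ≤ x ∧ Q ((1 + F 0)/2) < v) ↔ 
          (v ≤ Q ((1 + F x)/2) ∧ ¬ (v ≤ Q ((1 + F 0)/2)))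
        rw [this, not_le]
      rw [e1, measure_sdiff (Iic_subset_Iic.2 (hQmono (by linarith [hmono hx])))
        measurableSet_Iic.nullMeasurableSet (measure_ne_top _ _)]
      have e : ∀ y, ν (Iic y) = ENNReal.ofReal (F y) := fun y => by
        rw [hF, ENNReal.ofReal_toReal (measure_ne_top _ _)]
      rw [e, e, e, hFm, hFm, ← ENNReal.ofReal_sub _ (by linarith [hFnn 0]), hF0, smul_eq_mul]
      have : (1/2 : ENNReal) = ENNReal.ofReal (1/2) := by
        rw [ENNReal.ofReal_div_of_pos (by norm_num)]; simp
      rw [this, ← ENNReal.ofReal_mul (by norm_num)]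
      congr 1; ring

theorem stmt3
    (νF : Measure ℝ) [IsProbabilityMeasure νF]
    (F : ℝ → ℝ) (hFcdf : ∀ x, F x = (νF (Iic x)).toReal)
    (hFcont : ContinuousOn F (Icc 0 1))
    (hFmono : StrictMonoOn F (Icc 0 1))
    (hF0 : F 0 = 0) (hF1 : F 1 = 1)
    (νG : Measure ℝ) [IsProbabilityMeasure νG]
    (G : ℝ → ℝ) (hGcdf : ∀ x, G x = (νG (Iic x)).toReal)
    (hGcont : ContinuousOn G (Icc 0 1))
    (hGmono : StrictMonoOn G (Icc 0 1))
    (hG0 : G 0 = 0) (hG1 : G 1 = 1)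
    (r : ℝ → ℝ) (hrmeas : Measurable r)
    (hrmem : ∀ c ∈ Icc (0:ℝ) 1, r c ∈ Icc (0:ℝ) 1)
    (hrmax : ∀ c ∈ Icc (0:ℝ) 1, ∀ p ∈ Icc (0:ℝ) 1,
      (p - c) * (1 - F p) ≤ (r c - c) * (1 - F (r c)))
    (r' : ℝ → ℝ) (hr'meas : Measurable r')
    (hr'mem : ∀ v ∈ Icc (0:ℝ) 1, r' v ∈ Icc (0:ℝ) 1)
    (hr'max : ∀ v ∈ Icc (0:ℝ) 1, ∀ p ∈ Icc (0:ℝ) 1,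
      (v - p) * G p ≤ (v - r' v) * G (r' v))
    (FB SP BuyerP : ℝ)
    (hFB : FB = ∫ c in Icc (0:ℝ) 1, (∫ v in Icc c 1, (v - c) ∂νF) ∂νG)
    (hSP : SP = ∫ c in Icc (0:ℝ) 1, (∫ v in Icc (r c) 1, (v - c) ∂νF) ∂νG)
    (hBuyerP : BuyerP = ∫ v in Icc (0:ℝ) 1, (∫ c in Icc 0 (r' v), (v - c) ∂νG) ∂νF)
    : ∀ α ∈ Icc (1/5 : ℝ) (4/5),
      FB ≤ 10 * (α * SP + (1 - α) * BuyerP) := by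
  have haeF := cdf_ae_mem νF F hFcdf hF0 hF1
  have haeG := cdf_ae_mem νG G hGcdf hG0 hG1
  rw [Measure.restrict_eq_self_of_ae_mem haeG] at hFB hSP
  rw [Measure.restrict_eq_self_of_ae_mem haeF] at hBuyerP
  obtain ⟨m, u, humeas, hmmem, humem, hFm, hule, hlem, hgal, hmap⟩ :=
    exists_quantile νF F hFcdf hFcont hFmono hF0 hF1
  have hFle : ∀ x, F x ≤ 1 := fun x => by
    rw [hFcdf]; exact ENNReal.toReal_le_of_le_ofReal (by norm_num) (by simpa using prob_le_one)
  have hGnn : ∀ x, 0 ≤ G x := fun x => by rw [hGcdf]; exact ENNReal.toReal_nonneg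
  have hFreal : ∀ x, νF.real (Iic x) = F x := fun x => (hFcdf x).symm
  have hGreal : ∀ x, νG.real (Iic x) = G x := fun x => (hGcdf x).symm
  -- first best, inner integral
  have hφ : ∀ c ∈ Icc (0:ℝ) 1, ∫ v in Icc c 1, (v - c) ∂νF = ∫ v, max (v - c) 0 ∂νF := by
    intro c hc
    rw [← integral_indicator measurableSet_Icc]
    refine integral_congr_ae ?_
    filter_upwards [haeF] with v hv
    by_cases h : c ≤ v
    · rw [indicator_of_mem (show v ∈ Icc c 1 from ⟨h, hv.2⟩), max_eq_left (by linarith)]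
    · rw [indicator_of_notMem (fun h' => h h'.1), max_eq_right (by linarith)]
  -- seller profit
  have hS : ∀ c ∈ Icc (0:ℝ) 1, ∀ p ∈ Icc (0:ℝ) 1,
      (p - c) * (1 - F p) ≤ ∫ v in Icc (r c) 1, (v - c) ∂νF := by
    intro c hc p hp
    refine (hrmax c hc p hp).trans ?_
    have hr := hrmem c hc
    have hrc : c ≤ r c := by
      by_contra! hlt
      have h1 := hrmax c hc c hc
      have h2 : F (r c) < 1 := hF1 ▸ hFmono hr ⟨zero_le_one, le_rfl⟩ (hlt.trans_le hc.2)
      nlinarith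
    have hmeas : 1 - F (r c) ≤ νF.real (Icc (r c) 1) := by
      have e1 : νF.real (Iic 1 \ Iic (r c)) = 1 - F (r c) := by
        rw [measureReal_sdiff (Iic_subset_Iic.2 hr.2) measurableSet_Iic, hFreal, hFreal, hF1]
      rw [← e1]
      refine measureReal_mono ?_
      rintro x ⟨hx1, hx2⟩
      exact ⟨(not_le.1 hx2).le, hx1⟩
    calc (r c - c) * (1 - F (r c)) ≤ (r c - c) * νF.real (Icc (r c) 1) :=
          mul_le_mul_of_nonneg_left hmeas (by linarith)
      _ = ∫ v in Icc (r c) 1, (r c - c) ∂νF := by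
          rw [setIntegral_const, smul_eq_mul, mul_comm]
      _ ≤ _ := by
          refine setIntegral_mono_on (integrable_const _).integrableOn ?_ measurableSet_Icc ?_
          · refine (integrable_of_bdd1 νF haeF _ (by fun_prop) ?_).integrableOn
            intro x hx
            rw [abs_le]; constructor <;> linarith [hx.1, hx.2, hc.1, hc.2]
          · intro v hv; linarith [hv.1]
  -- buyer profit
  have hB : ∀ v ∈ Icc (0:ℝ) 1, ∀ p ∈ Icc (0:ℝ) 1,
      (v - p) * G p ≤ ∫ c in Icc 0 (r' v), (v - c) ∂νG := by
    intro v hv p hp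
    refine (hr'max v hv p hp).trans ?_
    have hmeas : G (r' v) = νG.real (Icc 0 (r' v)) := by
      rw [← hGreal]
      refine measureReal_congr ?_
      filter_upwards [haeG] with x hx
      exact propext ⟨fun h => ⟨hx.1, h⟩, fun h => h.2⟩
    calc (v - r' v) * G (r' v) = (v - r' v) * νG.real (Icc 0 (r' v)) := by rw [hmeas]
      _ = ∫ c in Icc 0 (r' v), (v - r' v) ∂νG := by
          rw [setIntegral_const, smul_eq_mul, mul_comm]
      _ ≤ _ := by
          refine setIntegral_mono_on (integrable_const _).integrableOn ?_ measurableSet_Icc ?_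
          · refine (integrable_of_bdd1 νG haeG _ (by fun_prop) ?_).integrableOn
            intro x hx
            rw [abs_le]; constructor <;> linarith [hx.1, hx.2, hv.1, hv.2]
          · intro c hc; linarith [hc.2]
  -- integrability of the three outer integrands
  have hSint : Integrable (fun c => ∫ v in Icc (r c) 1, (v - c) ∂νF) νG := by
    have hset : MeasurableSet {z : ℝ × ℝ | r z.1 ≤ z.2 ∧ z.2 ≤ 1} :=
      (measurableSet_le (hrmeas.comp measurable_fst) measurable_snd).inter
        (measurableSet_le measurable_snd measurable_const)
    have := (integrable_of_bdd νG νF haeG haeF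
      ({z : ℝ × ℝ | r z.1 ≤ z.2 ∧ z.2 ≤ 1}.indicator (fun z => z.2 - z.1))
      ((measurable_snd.sub measurable_fst).indicator hset) ?_).integral_prod_left
    · refine this.congr (Filter.Eventually.of_forall fun c => ?_)
      simp only
      rw [← integral_indicator measurableSet_Icc]
      rfl
    · intro x hx y hy
      by_cases h : (x, y) ∈ {z : ℝ × ℝ | r z.1 ≤ z.2 ∧ z.2 ≤ 1}
      · rw [indicator_of_mem h, abs_le]
        constructor <;> simp only <;> linarith [hx.1, hx.2, hy.1, hy.2]
      · rw [indicator_of_notMem h]; simp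
  have hBint : Integrable (fun v => ∫ c in Icc 0 (r' v), (v - c) ∂νG) νF := by
    have hset : MeasurableSet {z : ℝ × ℝ | 0 ≤ z.2 ∧ z.2 ≤ r' z.1} :=
      (measurableSet_le measurable_const measurable_snd).inter
        (measurableSet_le measurable_snd (hr'meas.comp measurable_fst))
    have := (integrable_of_bdd νF νG haeF haeG
      ({z : ℝ × ℝ | 0 ≤ z.2 ∧ z.2 ≤ r' z.1}.indicator (fun z => z.1 - z.2))
      ((measurable_fst.sub measurable_snd).indicator hset) ?_).integral_prod_left
    · refine this.congr (Filter.Eventually.of_forall fun c => ?_)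
      simp only
      rw [← integral_indicator measurableSet_Icc]
      rfl
    · intro x hx y hy
      by_cases h : (x, y) ∈ {z : ℝ × ℝ | 0 ≤ z.2 ∧ z.2 ≤ r' z.1}
      · rw [indicator_of_mem h, abs_le]
        constructor <;> simp only <;> linarith [hx.1, hx.2, hy.1, hy.2]
      · rw [indicator_of_notMem h]; simp
  -- the coupling term
  set A : Set (ℝ × ℝ) := {z | z.1 < u z.2} with hA
  have hAset : MeasurableSet A := measurableSet_lt measurable_fst (humeas.comp measurable_snd)
  set k : ℝ × ℝ → ℝ := A.indicator (fun z => z.2 - u z.2) with hk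
  have hkmeas : Measurable k :=
    (measurable_snd.sub (humeas.comp measurable_snd)).indicator hAset
  have hkb : ∀ x, ∀ y ∈ Icc (0:ℝ) 1, |k (x, y)| ≤ 1 := by
    intro x y hy
    by_cases h : (x, y) ∈ A
    · rw [hk, indicator_of_mem h, abs_le]
      constructor <;> simp only <;> linarith [hule y hy, hy.1, hy.2, (humem y).1]
    · rw [hk, indicator_of_notMem h]; simp
  have hkint : Integrable k (νG.prod νF) :=
    integrable_of_bdd νG νF haeG haeF k hkmeas fun x _ y hy => hkb x y hy
  -- pointwise inequality
  have hpt : ∀ c ∈ Icc (0:ℝ) 1, ∫ v, max (v - c) 0 ∂νF ≤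
      2 * (∫ v in Icc (r c) 1, (v - c) ∂νF) + 2 * ∫ v, k (c, v) ∂νF := by
    intro c hc
    have i1 : Integrable (fun v => max (v - c) 0) νF := by
      refine integrable_of_bdd1 νF haeF _ (by fun_prop) ?_
      intro x hx
      rw [abs_le]
      exact ⟨by linarith [le_max_right (x - c) 0], max_le (by linarith [hx.2, hc.1]) zero_le_one⟩
    have i2 : Integrable (fun v => k (c, v)) νF :=
      integrable_of_bdd1 νF haeF _ (hkmeas.comp measurable_prodMk_left) fun y hy => hkb c y hy
    have i3 : Integrable ((Ioi (m 0)).indicator (fun v => max (u v - c) 0)) νF := by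
      refine Integrable.indicator ?_ measurableSet_Ioi
      refine integrable_of_bdd1 νF haeF _ (by fun_prop) ?_
      intro x hx
      rw [abs_le]
      exact ⟨by linarith [le_max_right (u x - c) 0],
        max_le (by linarith [(humem x).2, hc.1]) zero_le_one⟩
    have i4 : Integrable ((Ioc c (m c)).indicator (fun _ => m c - c)) νF :=
      (integrable_const _).indicator measurableSet_Ioc
    have e3 : ∫ v, (Ioi (m 0)).indicator (fun v => max (u v - c) 0) v ∂νF
        = (1/2) * ∫ v, max (v - c) 0 ∂νF := by
      rw [integral_indicator measurableSet_Ioi]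
      have hme : Measurable fun v : ℝ => max (v - c) 0 := by fun_prop
      have := integral_map (μ := νF.restrict (Ioi (m 0))) humeas.aemeasurable
        (f := fun v => max (v - c) 0) hme.aestronglyMeasurable
      rw [← this, hmap, integral_smul_measure]
      simp
    have e4 : ∫ v, (Ioc c (m c)).indicator (fun _ => m c - c) v ∂νF
        = (m c - c) * (1 - F (m c)) := by
      rw [integral_indicator measurableSet_Ioc, setIntegral_const, smul_eq_mul, ← Iic_sdiff_Iic,
        measureReal_sdiff (Iic_subset_Iic.2 (hlem c hc)) measurableSet_Iic, hFreal, hFreal, hFm]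
      ring
    have key : ∫ v, max (v - c) 0 ∂νF ≤ ∫ v, ((Ioc c (m c)).indicator (fun _ => m c - c) v
        + k (c, v) + (Ioi (m 0)).indicator (fun v => max (u v - c) 0) v) ∂νF := by
      refine integral_mono_ae i1 ((i4.add i2).add i3) ?_
      filter_upwards [haeF] with v hv
      have hg := hgal v hv c hc.1
      have n3 : 0 ≤ (Ioi (m 0)).indicator (fun v => max (u v - c) 0) v :=
        indicator_nonneg (fun _ _ => le_max_right _ _) v
      have n4 : 0 ≤ (Ioc c (m c)).indicator (fun _ => m c - c) v :=
        indicator_nonneg (fun _ _ => by linarith [hlem c hc]) v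
      have n2 : 0 ≤ k (c, v) := by
        by_cases h : (c, v) ∈ A
        · rw [hk, indicator_of_mem h]; simp only; linarith [hule v hv]
        · rw [hk, indicator_of_notMem h]
      rcases le_or_gt v c with h1 | h1
      · rw [max_eq_right (by linarith)]; linarith
      rw [max_eq_left (by linarith)]
      rcases le_or_gt v (m c) with h2 | h2
      · rw [indicator_of_mem (show v ∈ Ioc c (m c) from ⟨h1, h2⟩)]; linarith
      · have h3 : c < u v := by rw [← not_le, hg, not_le]; exact h2
        have h4 : m 0 < v := by
          rw [← not_le, ← hgal v hv 0 le_rfl, not_le]; exact hc.1.trans_lt h3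
        have e5 : k (c, v) = v - u v := by rw [hk, indicator_of_mem (show (c, v) ∈ A from h3)]
        rw [e5, indicator_of_mem (show v ∈ Ioi (m 0) from h4), max_eq_left (by linarith)]
        linarith
    have i42 : Integrable (fun v => (Ioc c (m c)).indicator (fun _ => m c - c) v + k (c, v)) νF :=
      i4.add i2
    rw [integral_add i42 i3, integral_add i4 i2, e3, e4] at key
    have := hS c hc (m c) (hmmem c)
    linarith
  -- integrate
  have hFBle : FB ≤ 2 * SP + 2 * ∫ c, ∫ v, k (c, v) ∂νF ∂νG := by
    have hφint : Integrable (fun c => ∫ v, max (v - c) 0 ∂νF) νG := by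
      refine (integrable_of_bdd νG νF haeG haeF (fun z => max (z.2 - z.1) 0)
        (by fun_prop) ?_).integral_prod_left
      intro x hx y hy
      rw [abs_le]
      exact ⟨by linarith [le_max_right (y - x) 0], max_le (by linarith [hy.2, hx.1]) zero_le_one⟩
    have e1 : FB = ∫ c, ∫ v, max (v - c) 0 ∂νF ∂νG := by
      rw [hFB]
      refine integral_congr_ae ?_
      filter_upwards [haeG] with c hc using hφ c hc
    have hki := hkint.integral_prod_left
    rw [e1, hSP, ← integral_const_mul, ← integral_const_mul,
      ← integral_add (hSint.const_mul 2) (hki.const_mul 2)]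
    refine integral_mono_ae hφint ((hSint.const_mul 2).add (hki.const_mul 2)) ?_
    filter_upwards [haeG] with c hc using hpt c hc
  have hkle : ∫ c, ∫ v, k (c, v) ∂νF ∂νG ≤ BuyerP := by
    rw [integral_integral_swap (f := fun c v => k (c, v)) hkint, hBuyerP]
    refine integral_mono_ae hkint.integral_prod_right hBint ?_
    filter_upwards [haeF] with v hv
    refine le_trans ?_ (hB v hv (u v) (humem v))
    have : (fun c => k (c, v)) = (Iio (u v)).indicator (fun _ => v - u v) := by
      ext c; rfl
    rw [this, integral_indicator measurableSet_Iio, setIntegral_const, smul_eq_mul, mul_comm,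
      ← hGreal]
    exact mul_le_mul_of_nonneg_left (measureReal_mono Iio_subset_Iic_self)
      (by linarith [hule v hv])
  have hSP0 : 0 ≤ SP := by
    rw [hSP]
    refine integral_nonneg_of_ae ?_
    filter_upwards [haeG] with c hc
    have := hS c hc c hc
    simpa using this
  have hBP0 : 0 ≤ BuyerP := by
    rw [hBuyerP]
    refine integral_nonneg_of_ae ?_
    filter_upwards [haeF] with v hv
    have := hB v hv v hv
    simpa using this
  intro α hα
  nlinarith [mul_nonneg (sub_nonneg.2 hα.1) hSP0, mul_nonneg (sub_nonneg.2 hα.2) hBP0]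
end

section
/- Pointwise key lemma: for every c ∈ [0,1], FB(c) ≤ 2·SP(c) + 8·BuyerP(c), where FB(c) := 2·∫_{v∈[μ(c),1]} (v − c) dF(v), SP(c) := (μ(c) − c)·(1 − F(μ(c))), and BuyerP(c) := ∫_{v∈[μ^(2)(c),1]} (v − μ^(−2)(v)) dF(v). -/
open MeasureTheory Set

theorem stmt4
    (ν : Measure ℝ) [IsProbabilityMeasure ν]
    (F : ℝ → ℝ) (hFcdf : ∀ x, F x = (ν (Iic x)).toReal)
    (hFcont : ContinuousOn F (Icc 0 1))
    (hFmono : StrictMonoOn F (Icc 0 1))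
    (hF0 : F 0 = 0) (hF1 : F 1 = 1)
    (μ : ℝ → ℝ)
    (hμmem : ∀ x ∈ Icc (0:ℝ) 1, μ x ∈ Icc (0:ℝ) 1)
    (hμdef : ∀ x ∈ Icc (0:ℝ) 1, F (μ x) = (1 + F x) / 2)
    (μinv2 : ℝ → ℝ)
    (hinvmem : ∀ v ∈ Icc (0:ℝ) 1, μinv2 v ∈ Icc (0:ℝ) 1)
    (hinvdef : ∀ v ∈ Icc (0:ℝ) 1, 3/4 ≤ F v → μ (μ (μinv2 v)) = v)
    (hinvzero : ∀ v ∈ Icc (0:ℝ) 1, F v < 3/4 → μinv2 v = 0)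
    : ∀ c ∈ Icc (0:ℝ) 1,
      2 * ∫ v in Icc (μ c) 1, (v - c) ∂ν ≤
        2 * ((μ c - c) * (1 - F (μ c))) +
        8 * ∫ v in Icc (μ (μ c)) 1, (v - μinv2 v) ∂ν := by
  have h01 : (1:ℝ) ∈ Icc (0:ℝ) 1 := by simp
  have h00 : (0:ℝ) ∈ Icc (0:ℝ) 1 := by simp
  have hFr : ∀ x, F x = ν.real (Iic x) := hFcdf
  have hIoc : ∀ x y, x ≤ y → ν.real (Ioc x y) = F y - F x := by
    intro x y hxy
    have h : Ioc x y = Iic y \ Iic x := by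
      ext v; simp only [mem_Ioc, mem_diff, mem_Iic, not_le]; tauto
    rw [hFr, hFr, h, measureReal_diff (Iic_subset_Iic.2 hxy) measurableSet_Iic]
  have hatom : ∀ p ∈ Icc (0:ℝ) 1, ν.real {p} = 0 := by
    intro p hp
    rcases hp.1.eq_or_lt with h | h
    · have : ν.real {p} ≤ ν.real (Iic 0) := measureReal_mono (by simp [← h])
      rw [← hFr, hF0] at this
      exact le_antisymm this measureReal_nonneg
    · refine le_antisymm ?_ measureReal_nonneg
      have hc : ContinuousWithinAt F (Ico 0 p) p :=
        (hFcont p hp).mono (fun y hy => ⟨hy.1, hy.2.le.trans hp.2⟩)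
      have hne : (nhdsWithin p (Ico 0 p)).NeBot := by
        rw [← mem_closure_iff_nhdsWithin_neBot, closure_Ico h.ne]
        exact ⟨h.le, le_rfl⟩
      have ht : Filter.Tendsto (fun y => F p - F y) (nhdsWithin p (Ico 0 p)) (nhds (F p - F p)) :=
        tendsto_const_nhds.sub hc
      rw [sub_self] at ht
      refine ge_of_tendsto ht ?_
      filter_upwards [self_mem_nhdsWithin] with y hy
      rw [← hIoc y p hy.2.le]
      exact measureReal_mono (by simpa using hy.2)
  have hIcc : ∀ x ∈ Icc (0:ℝ) 1, ∀ y, x ≤ y → ν.real (Icc x y) = F y - F x := by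
    intro x hx y hxy
    rw [← Ioc_union_left hxy, measureReal_union (by simp) (measurableSet_singleton x),
      hatom x hx, hIoc x y hxy, add_zero]
  have hIco : ∀ x ∈ Icc (0:ℝ) 1, ∀ y ∈ Icc (0:ℝ) 1, x ≤ y → ν.real (Ico x y) = F y - F x := by
    intro x hx y hy hxy
    have h := hIcc x hx y hxy
    rw [← Ico_union_right hxy, measureReal_union (by simp) (measurableSet_singleton y),
      hatom y hy, add_zero] at h
    exact h
  have hle1 : ∀ x ∈ Icc (0:ℝ) 1, F x ≤ 1 := fun x hx => hF1 ▸ (hFmono.le_iff_le hx h01).2 hx.2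
  have hge0 : ∀ x ∈ Icc (0:ℝ) 1, 0 ≤ F x := fun x hx => hF0 ▸ (hFmono.le_iff_le h00 hx).2 hx.1
  intro c hc
  have hd := hμmem c hc
  have he := hμmem _ hd
  have hFd := hμdef c hc
  have hFe := hμdef _ hd
  have hcd : c ≤ μ c := (hFmono.le_iff_le hc hd).1 (by linarith [hle1 c hc])
  have hde : μ c ≤ μ (μ c) := (hFmono.le_iff_le hd he).1 (by linarith [hle1 c hc])
  generalize μ (μ c) = e at *
  generalize μ c = d at *
  have hJ : ∀ v ∈ Icc e 1, v ∈ Icc (0:ℝ) 1 := fun v hv => ⟨he.1.trans hv.1, hv.2⟩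
  have hg : ∀ v ∈ Icc e 1, F (μinv2 v) = 4 * F v - 3 := by
    intro v hv
    have h1 : F e ≤ F v := (hFmono.le_iff_le he (hJ v hv)).2 hv.1
    have h2 := hinvdef v (hJ v hv) (by linarith [hge0 c hc])
    have h3 := hinvmem v (hJ v hv)
    have h4 := hμdef _ (hμmem _ h3)
    rw [h2, hμdef _ h3] at h4
    linarith
  have hgc : ∀ v ∈ Icc e 1, c ≤ μinv2 v := by
    intro v hv
    have h1 : F e ≤ F v := (hFmono.le_iff_le he (hJ v hv)).2 hv.1
    refine (hFmono.le_iff_le hc (hinvmem v (hJ v hv))).1 ?_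
    rw [hg v hv]; linarith
  have hgmono : MonotoneOn μinv2 (Icc e 1) := by
    intro v hv w hw hvw
    refine (hFmono.le_iff_le (hinvmem v (hJ v hv)) (hinvmem w (hJ w hw))).1 ?_
    rw [hg v hv, hg w hw]
    linarith [(hFmono.le_iff_le (hJ v hv) (hJ w hw)).2 hvw]
  have hgm : AEMeasurable μinv2 (ν.restrict (Icc e 1)) :=
    aemeasurable_restrict_of_monotoneOn measurableSet_Icc hgmono
  have hgi : IntegrableOn μinv2 (Icc e 1) ν := by
    refine Integrable.of_mem_Icc 0 1 hgm ?_
    filter_upwards [ae_restrict_mem measurableSet_Icc] with v hv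
    exact hinvmem v (hJ v hv)
  have hid : ∀ x y : ℝ, IntegrableOn (fun v : ℝ => v) (Icc x y) ν :=
    fun x y => continuous_id.continuousOn.integrableOn_Icc
  -- pushforward
  have hmap : (4:ENNReal) • (ν.restrict (Icc e 1)).map μinv2 = ν.restrict (Icc c 1) := by
    have : IsFiniteMeasure ((4:ENNReal) • (ν.restrict (Icc e 1)).map μinv2) :=
      Measure.smul_finite _ (by simp)
    refine Measure.ext_of_Iic _ _ fun x => ?_
    rw [← measureReal_eq_measureReal_iff, measureReal_ennreal_smul_apply, 
      measureReal_restrict_apply measurableSet_Iic, map_measureReal_apply_of_aemeasurable hgm measurableSet_Iic,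
      measureReal_restrict_apply₀ (hgm.nullMeasurableSet_preimage measurableSet_Iic)]
    rcases lt_or_ge x c with hx | hx
    · have h1 : μinv2 ⁻¹' Iic x ∩ Icc e 1 = ∅ := by
        ext v
        simp only [mem_inter_iff, mem_preimage, mem_Iic, mem_empty_iff_false, iff_false, not_and]
        intro h h'
        linarith [hgc v h']
      have h2 : Iic x ∩ Icc c 1 = ∅ := by
        ext v
        simp only [mem_inter_iff, mem_Iic, mem_empty_iff_false, iff_false, not_and]
        intro h h'
        linarith [h'.1]
      simp [h1, h2]
    · have hcy : c ≤ min x 1 := le_min hx hc.2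
      have hy : min x 1 ∈ Icc (0:ℝ) 1 := ⟨hc.1.trans hcy, min_le_right _ _⟩
      have hym := hμmem _ (hμmem _ hy)
      have hFy : F (μ (μ (min x 1))) = (3 + F (min x 1)) / 4 := by
        rw [hμdef _ (hμmem _ hy), hμdef _ hy]; ring
      have hFcy := (hFmono.le_iff_le hc hy).2 hcy
      have h1 : μinv2 ⁻¹' Iic x ∩ Icc e 1 = Icc e (μ (μ (min x 1))) := by
        ext v
        have key : ∀ hv : v ∈ Icc e 1, (μinv2 v ≤ x ↔ v ≤ μ (μ (min x 1))) := by
          intro hv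
          have hm := hinvmem v (hJ v hv)
          have : μinv2 v ≤ x ↔ μinv2 v ≤ min x 1 := by simp [hm.2]
          rw [this, ← hFmono.le_iff_le hm hy, ← hFmono.le_iff_le (hJ v hv) hym, hg v hv, hFy]
          constructor <;> intro h <;> linarith
        constructor
        · rintro ⟨h, hv⟩
          exact ⟨hv.1, (key hv).1 h⟩
        · intro hv
          have hv' : v ∈ Icc e 1 := ⟨hv.1, hv.2.trans hym.2⟩
          exact ⟨(key hv').2 hv.2, hv'⟩
      have h2 : Iic x ∩ Icc c 1 = Icc c (min x 1) := by
        ext v; simp only [mem_inter_iff, mem_Iic, mem_Icc, le_min_iff]; tauto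
      rw [h1, h2, hIcc c hc _ hcy, hIcc e he _ ((hFmono.le_iff_le he hym).1 (by rw [hFy]; linarith)), hFy]
      norm_num
      linarith
  have hint : 4 * ∫ v in Icc e 1, μinv2 v ∂ν = ∫ v in Icc c 1, v ∂ν := by
    rw [← hmap, integral_smul_measure, integral_map hgm (by fun_prop)]
    simp
  have hsplit : ∀ x ∈ Icc (0:ℝ) 1, ∀ y ∈ Icc (0:ℝ) 1, x ≤ y →
      ∫ v in Icc x 1, v ∂ν ≤ y * (F y - F x) + ∫ v in Icc y 1, v ∂ν := by
    intro x hx y hy hxy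
    have hi : IntegrableOn (fun v : ℝ => v) (Ico x y) ν := (hid x y).mono_set Ico_subset_Icc_self
    rw [← Ico_union_Icc_eq_Icc hxy hy.2, setIntegral_union
      (by rw [Set.disjoint_left]; intro v h h'; exact absurd h.2 (not_lt.2 h'.1))
      measurableSet_Icc hi (hid y 1)]
    have : ∫ v in Ico x y, v ∂ν ≤ ∫ v in Ico x y, y ∂ν :=
      setIntegral_mono_on hi (by simp) measurableSet_Ico (fun v hv => hv.2.le)
    rw [setIntegral_const, hIco x hx y hy hxy, smul_eq_mul] at this
    linarith
  have hlow : e * (F 1 - F e) ≤ ∫ v in Icc e 1, v ∂ν := by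
    have : ∫ v in Icc e 1, e ∂ν ≤ ∫ v in Icc e 1, v ∂ν :=
      setIntegral_mono_on (by simp) (hid e 1) measurableSet_Icc (fun v hv => hv.1)
    rw [setIntegral_const, hIcc e he 1 he.2, smul_eq_mul] at this
    linarith
  have hs1 := hsplit c hc d hd hcd
  have hs2 := hsplit d hd e he hde
  rw [integral_sub (hid e 1) hgi, integral_sub (hid d 1) (by simp), setIntegral_const,
    hIcc d hd 1 hd.2, smul_eq_mul]
  rw [hF1] at *
  rw [hFe, hFd] at *
  nlinarith
end

section
/- Median halving bound: for every c ∈ [0,1], ∫_{v∈[c,1]} (v − c) dF(v) ≤ 2·∫_{v∈[μ(c),1]} (v − c) dF(v). -/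
open MeasureTheory Set

theorem stmt5
    (ν : Measure ℝ) [IsProbabilityMeasure ν]
    (F : ℝ → ℝ) (hFcdf : ∀ x, F x = (ν (Iic x)).toReal)
    (hFcont : ContinuousOn F (Icc 0 1))
    (hFmono : StrictMonoOn F (Icc 0 1))
    (hF0 : F 0 = 0) (hF1 : F 1 = 1)
    (μ : ℝ → ℝ)
    (hμmem : ∀ x ∈ Icc (0:ℝ) 1, μ x ∈ Icc (0:ℝ) 1)
    (hμdef : ∀ x ∈ Icc (0:ℝ) 1, F (μ x) = (1 + F x) / 2)
    : ∀ c ∈ Icc (0:ℝ) 1,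
      ∫ v in Icc c 1, (v - c) ∂ν ≤ 2 * ∫ v in Icc (μ c) 1, (v - c) ∂ν := by
  intro c hc
  have hm := hμmem c hc
  have hd := hμdef c hc
  set m := μ c with hmdef
  have hFc1 : F c ≤ 1 := by
    rw [← hF1]; exact hFmono.monotoneOn hc ⟨zero_le_one, le_rfl⟩ hc.2
  have hcm : c ≤ m := by
    rw [← hFmono.le_iff_le hc hm, hd]; linarith
  have hmass : ∀ a b : ℝ, a ≤ b → ν.real (Ioc a b) = F b - F a := by
    intro a b hab
    rw [← Iic_sdiff_Iic, measureReal_sdiff (Iic_subset_Iic.2 hab) measurableSet_Iic, hFcdf, hFcdf]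
    rfl
  have hint : ∀ a b : ℝ, IntegrableOn (fun v : ℝ => v - c) (Icc a b) ν := fun a b =>
    ContinuousOn.integrableOn_compact isCompact_Icc (by fun_prop)
  have hint' : ∀ a b : ℝ, IntegrableOn (fun v : ℝ => v - c) (Ioc a b) ν := fun a b =>
    (hint a b).mono_set Ioc_subset_Icc_self
  have e1 : ∫ v in Icc c 1, (v - c) ∂ν = ∫ v in Ioc c 1, (v - c) ∂ν := by
    refine setIntegral_eq_of_subset_of_forall_sdiff_eq_zero measurableSet_Icc
      Ioc_subset_Icc_self ?_
    rintro x ⟨⟨h1, h2⟩, h3⟩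
    by_contra hne
    exact h3 ⟨lt_of_le_of_ne h1 (fun h => hne (by rw [h, sub_self])), h2⟩
  have e2 : ∫ v in Ioc c 1, (v - c) ∂ν
      = ∫ v in Ioc c m, (v - c) ∂ν + ∫ v in Ioc m 1, (v - c) ∂ν := by
    rw [← Ioc_union_Ioc_eq_Ioc hcm hm.2]
    exact setIntegral_union (Ioc_disjoint_Ioc_of_le le_rfl) measurableSet_Ioc
      (hint' _ _) (hint' _ _)
  have e3 : ∫ v in Ioc m 1, (v - c) ∂ν ≤ ∫ v in Icc m 1, (v - c) ∂ν := by
    refine setIntegral_mono_set (hint m 1) ?_ Ioc_subset_Icc_self.eventuallyLE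
    filter_upwards [ae_restrict_mem measurableSet_Icc] with x hx
    exact sub_nonneg.2 (hcm.trans hx.1)
  have e4 : ∫ v in Ioc c m, (v - c) ∂ν ≤ ∫ _v in Ioc c m, (m - c) ∂ν := by
    refine setIntegral_mono_on (hint' _ _) (integrable_const _) measurableSet_Ioc ?_
    intro x hx
    linarith [hx.2]
  have e5 : ∫ _v in Ioc m 1, (m - c) ∂ν ≤ ∫ v in Ioc m 1, (v - c) ∂ν := by
    refine setIntegral_mono_on (integrable_const _) (hint' _ _) measurableSet_Ioc ?_
    intro x hx
    linarith [hx.1]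
  rw [setIntegral_const, smul_eq_mul, hmass _ _ hcm] at e4
  rw [setIntegral_const, smul_eq_mul, hmass _ _ hm.2] at e5
  have e6 : F m - F c = F 1 - F m := by rw [hd, hF1]; ring
  rw [e6] at e4
  linarith
end

section
/- The gains-from-trade of the utility-maximizing buyer dominate any posted-price utility: for every v ∈ [0,1], every r' ∈ argmax_{p∈[0,1]} (v − p)·G(p), and every q ∈ [0,1], we have ∫_{c∈[0,r']} (v − c) dG(c) ≥ (v − q)·G(q). -/
open MeasureTheory Set

theorem stmt7
    (ν : Measure ℝ) [IsProbabilityMeasure ν]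
    (G : ℝ → ℝ) (hGcdf : ∀ x, G x = (ν (Iic x)).toReal)
    (hGcont : ContinuousOn G (Icc 0 1))
    (hGmono : StrictMonoOn G (Icc 0 1))
    (hG0 : G 0 = 0) (hG1 : G 1 = 1)
    : ∀ v ∈ Icc (0:ℝ) 1, ∀ r' ∈ Icc (0:ℝ) 1,
      (∀ p ∈ Icc (0:ℝ) 1, (v - p) * G p ≤ (v - r') * G r') →
      ∀ q ∈ Icc (0:ℝ) 1,
        (v - q) * G q ≤ ∫ c in Icc 0 r', (v - c) ∂ν := by
  intro v _ r hr hmax q hq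
  refine (hmax q hq).trans ?_
  have h0 : ν (Iic 0) = 0 := by
    have h := hGcdf 0
    rw [hG0] at h
    rcases (ENNReal.toReal_eq_zero_iff _).1 h.symm with h | h
    · exact h
    · exact absurd h (measure_ne_top ν _)
  have hI : ν (Icc 0 r) = ν (Iic r) := by
    refine le_antisymm (measure_mono Icc_subset_Iic_self) ?_
    calc ν (Iic r) ≤ ν (Iic 0 ∪ Icc 0 r) := by
          refine measure_mono fun x hx => ?_
          rcases le_total x 0 with h | h
          · exact Or.inl h
          · exact Or.inr ⟨h, hx⟩
      _ ≤ ν (Iic 0) + ν (Icc 0 r) := measure_union_le _ _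
      _ = ν (Icc 0 r) := by rw [h0, zero_add]
  have hc : (v - r) * G r = ∫ c in Icc 0 r, (v - r) ∂ν := by
    rw [setIntegral_const, measureReal_def, hI, ← hGcdf, smul_eq_mul, mul_comm]
  rw [hc]
  refine setIntegral_mono_on (integrable_const _) ?_ measurableSet_Icc ?_
  · exact (Continuous.continuousOn (by fun_prop)).integrableOn_compact isCompact_Icc
  · intro x hx
    linarith [hx.2]
end

section
/- Telescoping upper bound: for every c ∈ [0,1], ∫_{v∈[μ(c),1]} (v − μ(c)) dF(v) ≤ 2·Σ_{t=1}^∞ (μ^(t+1)(c) − μ^(t)(c))·(F(μ^(t+1)(c)) − F(μ^(t)(c))). -/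
open MeasureTheory Set

lemma aux_int (ν : Measure ℝ) [IsProbabilityMeasure ν] (a b d : ℝ) :
    IntegrableOn (fun v : ℝ => v - d) (Ioc a b) ν := by
  have h : IntegrableOn (fun v : ℝ => v - d) (Icc a b) ν :=
    (by fun_prop : Continuous fun v : ℝ => v - d).continuousOn.integrableOn_compact isCompact_Icc
  exact h.mono_set Ioc_subset_Icc_self

lemma aux_step (ν : Measure ℝ) [IsProbabilityMeasure ν] (a b : ℝ) (hab : a ≤ b) :
    ∫ v in Ioc a 1, (v - a) ∂ν ≤ (b - a) * ν.real (Ioc a 1) + ∫ v in Ioc b 1, (v - b) ∂ν := by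
  have e1 : ∫ v in Ioc b 1, (v - b) ∂ν
      = ∫ v in Ioc a 1, (Ioc b 1).indicator (fun v => v - b) v ∂ν := by
    rw [setIntegral_indicator measurableSet_Ioc,
      inter_eq_self_of_subset_right (Ioc_subset_Ioc_left hab)]
  have i2 : IntegrableOn ((Ioc b 1).indicator (fun v : ℝ => v - b)) (Ioc a 1) ν :=
    ((aux_int ν b 1 b).integrable_indicator measurableSet_Ioc).integrableOn
  have i1 : IntegrableOn (fun _ : ℝ => b - a) (Ioc a 1) ν := integrableOn_const (by simp)
  have e2 : (b - a) * ν.real (Ioc a 1) = ∫ v in Ioc a 1, (b - a) ∂ν := by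
    rw [setIntegral_const, smul_eq_mul, mul_comm]
  rw [e1, e2, ← integral_add i1 i2]
  refine setIntegral_mono_on (aux_int ν a 1 a) (i1.add i2) measurableSet_Ioc ?_
  intro v hv
  by_cases h : v ∈ Ioc b 1
  · simp [indicator_of_mem h]
  · have : v ≤ b := by
      by_contra hh
      exact h ⟨not_le.mp hh, hv.2⟩
    simp [this]

lemma aux_last (ν : Measure ℝ) [IsProbabilityMeasure ν] (a : ℝ) (ha : 0 ≤ a) (ha1 : a ≤ 1) :
    ∫ v in Ioc a 1, (v - a) ∂ν ≤ ν.real (Ioc a 1) := by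
  have h := aux_step ν a 1 ha1
  simp only [Ioc_self, Measure.restrict_empty, integral_zero_measure, add_zero] at h
  have := measureReal_nonneg (μ := ν) (s := Ioc a 1)
  nlinarith

theorem stmt9
    (ν : Measure ℝ) [IsProbabilityMeasure ν]
    (F : ℝ → ℝ) (hFcdf : ∀ x, F x = (ν (Iic x)).toReal)
    (hFcont : ContinuousOn F (Icc 0 1))
    (hFmono : StrictMonoOn F (Icc 0 1))
    (hF0 : F 0 = 0) (hF1 : F 1 = 1)
    (μ : ℝ → ℝ)
    (hμmem : ∀ x ∈ Icc (0:ℝ) 1, μ x ∈ Icc (0:ℝ) 1)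
    (hμdef : ∀ x ∈ Icc (0:ℝ) 1, F (μ x) = (1 + F x) / 2)
    : ∀ c ∈ Icc (0:ℝ) 1,
      ∫ v in Icc (μ c) 1, (v - μ c) ∂ν ≤
        2 * ∑' t : ℕ, (μ^[t + 2] c - μ^[t + 1] c) * (F (μ^[t + 2] c) - F (μ^[t + 1] c)) := by
  intro c hc
  have hm : ∀ n, μ^[n] c ∈ Icc (0:ℝ) 1 := by
    intro n
    induction n with
    | zero => exact hc
    | succ n ih => rw [Function.iterate_succ_apply']; exact hμmem _ ih
  have hF : ∀ n, F (μ^[n + 1] c) = (1 + F (μ^[n] c)) / 2 := by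
    intro n
    rw [Function.iterate_succ_apply']; exact hμdef _ (hm n)
  have hle1 : ∀ x ∈ Icc (0:ℝ) 1, F x ≤ 1 := by
    intro x hx
    rw [← hF1]
    exact hFmono.monotoneOn hx (by simp) hx.2
  have hge0 : ∀ x ∈ Icc (0:ℝ) 1, 0 ≤ F x := by
    intro x hx
    rw [hFcdf]; exact ENNReal.toReal_nonneg
  have hpow : ∀ n, 1 - F (μ^[n] c) = (1 - F c) * (1 / 2) ^ n := by
    intro n
    induction n with
    | zero => simp
    | succ n ih => rw [hF, pow_succ, ← mul_assoc, ← ih]; ring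
  have hinc : ∀ n, μ^[n] c ≤ μ^[n + 1] c := by
    intro n
    rw [← hFmono.le_iff_le (hm n) (hm (n + 1)), hF]
    linarith [hle1 _ (hm n)]
  have hIoc : ∀ x ∈ Icc (0:ℝ) 1, ν.real (Ioc x 1) = 1 - F x := by
    intro x hx
    rw [← Iic_sdiff_Iic, measureReal_sdiff (Iic_subset_Iic.mpr hx.2) measurableSet_Iic]
    have h1 : ν.real (Iic 1) = 1 := (hFcdf 1).symm.trans hF1
    have h2 : ν.real (Iic x) = F x := (hFcdf x).symm
    rw [h1, h2]
  set T : ℕ → ℝ := fun t =>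
    (μ^[t + 2] c - μ^[t + 1] c) * (F (μ^[t + 2] c) - F (μ^[t + 1] c)) with hT
  have hTeq : ∀ t, 2 * T t = (μ^[t + 2] c - μ^[t + 1] c) * (1 - F (μ^[t + 1] c)) := by
    intro t
    simp only [hT]
    rw [hF (t + 1)]; ring
  have hT0 : ∀ t, 0 ≤ T t := by
    intro t
    have h1 := hinc (t + 1)
    have h2 := hle1 _ (hm (t + 1))
    have := mul_nonneg (sub_nonneg.2 h1) (sub_nonneg.2 h2)
    linarith [hTeq t]
  have hTs : Summable T := by
    refine Summable.of_nonneg_of_le hT0 (fun t => ?_) summable_geometric_two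
    have h1 := hinc (t + 1)
    have h2 := hle1 _ (hm (t + 1))
    have h3 := hTeq t
    have h4 := hpow (t + 1)
    have h5 := (hm (t + 2)).2
    have h6 := (hm (t + 1)).1
    have h7 := hge0 c hc
    have h8 : (0:ℝ) ≤ (1 / 2) ^ t := by positivity
    rw [pow_succ] at h4
    have h9 : (μ^[t + 2] c - μ^[t + 1] c) * (1 - F (μ^[t + 1] c)) ≤ 1 * (1 - F (μ^[t + 1] c)) :=
      mul_le_mul_of_nonneg_right (by linarith) (by linarith)
    nlinarith
  have hind : ∀ n, ∫ v in Ioc (μ c) 1, (v - μ c) ∂ν ≤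
      2 * ∑ t ∈ Finset.range n, T t + ∫ v in Ioc (μ^[n + 1] c) 1, (v - μ^[n + 1] c) ∂ν := by
    intro n
    induction n with
    | zero => simp
    | succ n ih =>
      have h := aux_step ν _ _ (hinc (n + 1))
      rw [hIoc _ (hm (n + 1)), ← hTeq] at h
      rw [Finset.sum_range_succ]
      linarith
  have hIcc : ∫ v in Icc (μ c) 1, (v - μ c) ∂ν = ∫ v in Ioc (μ c) 1, (v - μ c) ∂ν := by
    refine setIntegral_eq_of_subset_of_forall_sdiff_eq_zero measurableSet_Icc
      Ioc_subset_Icc_self ?_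
    rintro v ⟨hv, hv2⟩
    have : ¬ μ c < v := fun h => hv2 ⟨h, hv.2⟩
    linarith [hv.1]
  rw [hIcc]
  have hfin : ∀ n, ∫ v in Ioc (μ c) 1, (v - μ c) ∂ν ≤
      2 * ∑' t, T t + (1 - F c) * (1 / 2) ^ (n + 1) := by
    intro n
    have h1 := hind n
    have h2 := aux_last ν _ (hm (n + 1)).1 (hm (n + 1)).2
    rw [hIoc _ (hm (n + 1)), hpow] at h2
    have h3 := hTs.sum_le_tsum (Finset.range n) (fun t _ => hT0 t)
    linarith
  have hlim : Filter.Tendsto (fun n : ℕ => 2 * ∑' t, T t + (1 - F c) * (1 / 2 : ℝ) ^ (n + 1))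
      Filter.atTop (nhds (2 * ∑' t, T t + (1 - F c) * 0)) :=
    (((tendsto_pow_atTop_nhds_zero_of_lt_one (by norm_num) (by norm_num)).comp
      (Filter.tendsto_add_atTop_nat 1)).const_mul _).const_add _
  rw [mul_zero, add_zero] at hlim
  exact ge_of_tendsto' hlim hfin
end

section
/- Telescoping lower bound: for every c ∈ [0,1], ∫_{v∈[μ^(2)(c),1]} (v − μ^(−2)(v)) dF(v) ≥ (1/2)·Σ_{t=1}^∞ (μ^(t+1)(c) − μ^(t)(c))·(F(μ^(t+1)(c)) − F(μ^(t)(c))). -/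
open MeasureTheory Set

theorem stmt10
    (ν : Measure ℝ) [IsProbabilityMeasure ν]
    (F : ℝ → ℝ) (hFcdf : ∀ x, F x = (ν (Iic x)).toReal)
    (hFcont : ContinuousOn F (Icc 0 1))
    (hFmono : StrictMonoOn F (Icc 0 1))
    (hF0 : F 0 = 0) (hF1 : F 1 = 1)
    (μ : ℝ → ℝ)
    (hμmem : ∀ x ∈ Icc (0:ℝ) 1, μ x ∈ Icc (0:ℝ) 1)
    (hμdef : ∀ x ∈ Icc (0:ℝ) 1, F (μ x) = (1 + F x) / 2)
    (μinv2 : ℝ → ℝ)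
    (hinvmem : ∀ v ∈ Icc (0:ℝ) 1, μinv2 v ∈ Icc (0:ℝ) 1)
    (hinvdef : ∀ v ∈ Icc (0:ℝ) 1, 3/4 ≤ F v → μ (μ (μinv2 v)) = v)
    (hinvzero : ∀ v ∈ Icc (0:ℝ) 1, F v < 3/4 → μinv2 v = 0)
    : ∀ c ∈ Icc (0:ℝ) 1,
      (1/2) * ∑' t : ℕ, (μ^[t + 2] c - μ^[t + 1] c) * (F (μ^[t + 2] c) - F (μ^[t + 1] c)) ≤
        ∫ v in Icc (μ (μ c)) 1, (v - μinv2 v) ∂ν := by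
  have hle : ∀ x ∈ Icc (0:ℝ) 1, ∀ y ∈ Icc (0:ℝ) 1, (F x ≤ F y ↔ x ≤ y) :=
    fun x hx y hy => hFmono.le_iff_le hx hy
  have hFle1 : ∀ x ∈ Icc (0:ℝ) 1, F x ≤ 1 := by
    intro x hx
    rw [← hF1]; exact (hle x hx 1 (by simp)).2 hx.2
  have hFge0 : ∀ x ∈ Icc (0:ℝ) 1, 0 ≤ F x := by
    intro x hx
    rw [← hF0]; exact (hle 0 (by simp) x hx).2 hx.1
  have hinvF : ∀ v ∈ Icc (0:ℝ) 1, 3/4 ≤ F v → F (μinv2 v) = 4 * F v - 3 := by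
    intro v hv h
    have h1 := hμdef _ (hinvmem v hv)
    have h2 := hμdef _ (hμmem _ (hinvmem v hv))
    rw [hinvdef v hv h] at h2
    linarith
  have hgt : ∀ c ∈ Icc (0:ℝ) 1, ∀ v ∈ Icc (μ (μ c)) 1, v ∈ Icc (0:ℝ) 1 ∧ 3/4 ≤ F v := by
    intro c hc v hv
    have h0 := hμmem _ (hμmem c hc)
    have hv' : v ∈ Icc (0:ℝ) 1 := ⟨h0.1.trans hv.1, hv.2⟩
    refine ⟨hv', ?_⟩
    have h1 := (hle _ h0 v hv').2 hv.1
    have h2 := hμdef c hc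
    have h3 := hμdef _ (hμmem c hc)
    have := hFge0 c hc
    linarith
  have hnn : ∀ c ∈ Icc (0:ℝ) 1, ∀ v ∈ Icc (μ (μ c)) 1, 0 ≤ v - μinv2 v := by
    intro c hc v hv
    obtain ⟨hv', h⟩ := hgt c hc v hv
    have h1 := hinvF v hv' h
    have h2 := hFle1 v hv'
    have := (hle _ (hinvmem v hv') v hv').1 (by linarith)
    linarith
  have hIntegr : ∀ c ∈ Icc (0:ℝ) 1, IntegrableOn (fun v => v - μinv2 v) (Icc (μ (μ c)) 1) ν := by
    intro c hc
    have hm : MonotoneOn μinv2 (Icc (μ (μ c)) 1) := by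
      intro v hv w hw hvw
      obtain ⟨hv', h⟩ := hgt c hc v hv
      obtain ⟨hw', h'⟩ := hgt c hc w hw
      refine (hle _ (hinvmem v hv') _ (hinvmem w hw')).1 ?_
      rw [hinvF v hv' h, hinvF w hw' h']
      have := (hle v hv' w hw').2 hvw
      linarith
    have hcpt : IsCompact (Icc (μ (μ c)) 1) := isCompact_Icc
    have h1 : IntegrableOn μinv2 (Icc (μ (μ c)) 1) ν := hm.integrableOn_isCompact hcpt
    have h2 : IntegrableOn (fun v : ℝ => v) (Icc (μ (μ c)) 1) ν :=
      continuousOn_id.integrableOn_compact hcpt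
    exact h2.sub h1
  have hstepx : ∀ c ∈ Icc (0:ℝ) 1, c ≤ μ c := by
    intro c hc
    refine (hle c hc _ (hμmem c hc)).1 ?_
    have := hμdef c hc
    have := hFle1 c hc
    linarith
  have hIoc : ∀ x y, x ≤ y → ν.real (Ioc x y) = F y - F x := by
    intro x y hxy
    have h : Iic y = Iic x ∪ Ioc x y := (Iic_union_Ioc_eq_Iic hxy).symm
    have h2 : ν.real (Iic y) = ν.real (Iic x) + ν.real (Ioc x y) := by
      rw [h]
      exact measureReal_union (Set.Iic_disjoint_Ioc le_rfl) measurableSet_Ioc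
    rw [hFcdf, hFcdf]
    simp only [Measure.real] at h2 ⊢
    linarith
  have hstep : ∀ c ∈ Icc (0:ℝ) 1,
      (1/2) * ((μ (μ c) - μ c) * (F (μ (μ c)) - F (μ c))) +
        ∫ v in Ioc (μ (μ (μ c))) 1, (v - μinv2 v) ∂ν
        ≤ ∫ v in Ioc (μ (μ c)) 1, (v - μinv2 v) ∂ν := by
    intro c hc
    have m1 := hμmem c hc
    have m2 := hμmem _ m1
    have m3 := hμmem _ m2
    have l3 := hstepx _ m2
    have hi := hIntegr c hc
    have i1 : IntegrableOn (fun v => v - μinv2 v) (Ioc (μ (μ c)) (μ (μ (μ c)))) ν :=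
      hi.mono_set (fun v hv => ⟨hv.1.le, hv.2.trans m3.2⟩)
    have i2 : IntegrableOn (fun v => v - μinv2 v) (Ioc (μ (μ (μ c))) 1) ν :=
      hi.mono_set (fun v hv => ⟨l3.trans hv.1.le, hv.2⟩)
    rw [← Ioc_union_Ioc_eq_Ioc l3 m3.2, setIntegral_union
      (Set.Ioc_disjoint_Ioc_of_le le_rfl) measurableSet_Ioc i1 i2]
    have e1 := hμdef _ m1
    have e2 := hμdef _ m2
    have hb : (μ (μ c) - μ c) * ν.real (Ioc (μ (μ c)) (μ (μ (μ c)))) ≤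
        ∫ v in Ioc (μ (μ c)) (μ (μ (μ c))), (v - μinv2 v) ∂ν := by
      refine setIntegral_ge_of_const_le_real measurableSet_Ioc (measure_ne_top _ _) ?_ i1
      intro v hv
      obtain ⟨hv', h⟩ := hgt c hc v ⟨hv.1.le, hv.2.trans m3.2⟩
      have h1 := hinvF v hv' h
      have h2 := (hle v hv' _ m3).2 hv.2
      have := (hle _ (hinvmem v hv') _ m1).1 (by linarith)
      linarith [hv.1]
    rw [hIoc _ _ l3] at hb
    have e : F (μ (μ (μ c))) - F (μ (μ c)) = (1/2) * (F (μ (μ c)) - F (μ c)) := by linarith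
    rw [e] at hb
    linarith
  have hsum : ∀ n : ℕ, ∀ c ∈ Icc (0:ℝ) 1,
      (1/2) * ∑ t ∈ Finset.range n,
        (μ^[t + 2] c - μ^[t + 1] c) * (F (μ^[t + 2] c) - F (μ^[t + 1] c)) ≤
        ∫ v in Ioc (μ (μ c)) 1, (v - μinv2 v) ∂ν := by
    intro n
    induction n with
    | zero =>
      intro c hc
      simp only [Finset.range_zero, Finset.sum_empty, mul_zero]
      exact setIntegral_nonneg measurableSet_Ioc (fun v hv => hnn c hc v ⟨hv.1.le, hv.2⟩)
    | succ n ih =>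
      intro c hc
      have h1 := ih (μ c) (hμmem c hc)
      have h2 := hstep c hc
      rw [Finset.sum_range_succ']
      simp only [Function.iterate_succ, Function.comp_apply, Function.iterate_zero, id] at h1 ⊢
      linarith
  intro c hc
  have hitmem : ∀ n : ℕ, μ^[n] c ∈ Icc (0:ℝ) 1 := by
    intro n
    induction n with
    | zero => exact hc
    | succ n ih => rw [Function.iterate_succ_apply']; exact hμmem _ ih
  have hfin : ∑' t : ℕ, (μ^[t + 2] c - μ^[t + 1] c) * (F (μ^[t + 2] c) - F (μ^[t + 1] c)) ≤
      2 * ∫ v in Ioc (μ (μ c)) 1, (v - μinv2 v) ∂ν := by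
    refine Real.tsum_le_of_sum_range_le ?_ ?_
    · intro t
      have h1 : μ^[t + 1] c ≤ μ^[t + 2] c := by
        rw [Function.iterate_succ_apply' μ (t + 1)]; exact hstepx _ (hitmem _)
      have h2 := (hle _ (hitmem _) _ (hitmem _)).2 h1
      exact mul_nonneg (by linarith) (by linarith)
    · intro n
      have := hsum n c hc
      linarith
  have hmono : ∫ v in Ioc (μ (μ c)) 1, (v - μinv2 v) ∂ν ≤
      ∫ v in Icc (μ (μ c)) 1, (v - μinv2 v) ∂ν := by
    refine setIntegral_mono_set (hIntegr c hc) ?_ Ioc_subset_Icc_self.eventuallyLE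
    exact (ae_restrict_iff' measurableSet_Icc).2 (Filter.Eventually.of_forall (hnn c hc))
  linarith
end

section
/- λ-halving bound: for every λ ∈ (0,1) and every c ∈ [0,1], ∫_{v∈[c,1]} (v − c) dF(v) ≤ (1/(1 − λ))·∫_{v∈[μ_λ(c),1]} (v − c) dF(v). -/
open MeasureTheory Set

theorem stmt14
    (ν : Measure ℝ) [IsProbabilityMeasure ν]
    (F : ℝ → ℝ) (hFcdf : ∀ x, F x = (ν (Iic x)).toReal)
    (hFcont : ContinuousOn F (Icc 0 1))
    (hFmono : StrictMonoOn F (Icc 0 1))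
    (hF0 : F 0 = 0) (hF1 : F 1 = 1)
    (lam : ℝ) (hlam : lam ∈ Ioo (0:ℝ) 1)
    (μ : ℝ → ℝ)
    (hμmem : ∀ x ∈ Icc (0:ℝ) 1, μ x ∈ Icc (0:ℝ) 1)
    (hμdef : ∀ x ∈ Icc (0:ℝ) 1, F (μ x) = lam + (1 - lam) * F x)
    : ∀ c ∈ Icc (0:ℝ) 1,
      ∫ v in Icc c 1, (v - c) ∂ν ≤ (1 / (1 - lam)) * ∫ v in Icc (μ c) 1, (v - c) ∂ν := by
  intro c hc
  obtain ⟨hl0, hl1⟩ := hlam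
  have hm := hμmem c hc
  have hd := hμdef c hc
  generalize μ c = m at hm hd ⊢
  have hFle1 : F c ≤ 1 := by
    rw [← hF1]; exact hFmono.monotoneOn hc ⟨zero_le_one, le_rfl⟩ hc.2
  have hcm : c ≤ m := by
    refine (hFmono.le_iff_le hc hm).1 ?_
    rw [hd]; nlinarith
  have hmeas : ∀ a b : ℝ, a ≤ b → ν.real (Ioc a b) = F b - F a := by
    intro a b hab
    have h1 : Ioc a b = Iic b \ Iic a := by
      ext x; simp [and_comm]
    rw [h1, measureReal_diff (Iic_subset_Iic.2 hab) measurableSet_Iic, hFcdf, hFcdf]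
    rfl
  have hint : ∀ s : Set ℝ, MeasurableSet s → s ⊆ Icc c 1 →
      IntegrableOn (fun v => v - c) s ν := by
    intro s _ hs2
    refine IntegrableOn.mono_set ?_ hs2
    exact (by fun_prop : Continuous fun v : ℝ => v - c).continuousOn.integrableOn_Icc
  have hi1 := hint (Ioc c m) measurableSet_Ioc
    (fun x hx => ⟨hx.1.le, hx.2.trans hm.2⟩)
  have hi2 := hint (Ioc m 1) measurableSet_Ioc
    (fun x hx => ⟨hcm.trans hx.1.le, hx.2⟩)
  have hi3 := hint (Icc m 1) measurableSet_Icc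
    (fun x hx => ⟨hcm.trans hx.1, hx.2⟩)
  have e1 : ∫ v in Icc c 1, (v - c) ∂ν = ∫ v in Ioc c 1, (v - c) ∂ν := by
    refine setIntegral_eq_of_subset_of_forall_diff_eq_zero measurableSet_Icc Ioc_subset_Icc_self ?_
    rintro x ⟨hx, hx2⟩
    by_contra h
    exact hx2 ⟨lt_of_le_of_ne hx.1 (fun h' => h (by rw [h', sub_self])), hx.2⟩
  have e2 : ∫ v in Ioc c 1, (v - c) ∂ν
      = ∫ v in Ioc c m, (v - c) ∂ν + ∫ v in Ioc m 1, (v - c) ∂ν := by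
    rw [← Ioc_union_Ioc_eq_Ioc hcm hm.2]
    exact setIntegral_union (Ioc_disjoint_Ioc_of_le le_rfl) measurableSet_Ioc hi1 hi2
  have b1 : ∫ v in Ioc c m, (v - c) ∂ν ≤ (F m - F c) * (m - c) := by
    have := setIntegral_mono_on hi1 (integrableOn_const (C := m - c) (by simp)) measurableSet_Ioc
      (fun x hx => sub_le_sub_right hx.2 c)
    simpa [setIntegral_const, hmeas c m hcm] using this
  have b2 : (F 1 - F m) * (m - c) ≤ ∫ v in Ioc m 1, (v - c) ∂ν := by
    have := setIntegral_mono_on (integrableOn_const (C := m - c) (by simp)) hi2 measurableSet_Ioc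
      (fun x hx => sub_le_sub_right hx.1.le c)
    simpa [setIntegral_const, hmeas m 1 hm.2] using this
  have b3 : ∫ v in Ioc m 1, (v - c) ∂ν ≤ ∫ v in Icc m 1, (v - c) ∂ν := by
    refine setIntegral_mono_set hi3 ?_ Ioc_subset_Icc_self.eventuallyLE
    refine (ae_restrict_iff' measurableSet_Icc).2 (Filter.Eventually.of_forall ?_)
    intro x hx
    exact sub_nonneg.2 (hcm.trans hx.1)
  rw [e1, e2, one_div, ← div_eq_inv_mul, le_div_iff₀ (by linarith)]
  rw [hd] at b1 b2
  rw [hF1] at b2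
  have h1 := mul_le_mul_of_nonneg_left b1 (by linarith : 0 ≤ 1 - lam)
  have h2 := mul_le_mul_of_nonneg_left b2 hl0.le
  nlinarith
end

section
/- λ-telescoping upper bound: for every λ ∈ (0,1) and every c ∈ [0,1], ∫_{v∈[μ_λ(c),1]} (v − μ_λ(c)) dF(v) ≤ (1/λ)·Σ_{t=1}^∞ (μ_λ^(t+1)(c) − μ_λ^(t)(c))·(F(μ_λ^(t+1)(c)) − F(μ_λ^(t)(c))). -/
open MeasureTheory Set

theorem stmt15_aux
    (ν : Measure ℝ) [IsProbabilityMeasure ν]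
    (F : ℝ → ℝ) (hFcdf : ∀ x, F x = (ν (Iic x)).toReal) (hF1 : F 1 = 1)
    (a : ℝ) (ha1 : a ≤ 1) : ν.real (Ioc a 1) = 1 - F a := by
  have h : Ioc a 1 = Iic 1 \ Iic a := by
    ext x; simp [and_comm]
  rw [h, measureReal_diff (Iic_subset_Iic.2 ha1) measurableSet_Iic]
  simp only [Measure.real]
  rw [← hFcdf, ← hFcdf, hF1]

theorem stmt15_int (ν : Measure ℝ) [IsProbabilityMeasure ν] (a : ℝ) :
    Integrable ((Icc a 1).indicator (fun v => v - a)) ν := by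
  rw [integrable_indicator_iff measurableSet_Icc]
  exact (by fun_prop : Continuous fun v : ℝ => v - a).continuousOn.integrableOn_compact isCompact_Icc

theorem stmt15_step
    (ν : Measure ℝ) [IsProbabilityMeasure ν]
    (F : ℝ → ℝ) (hFcdf : ∀ x, F x = (ν (Iic x)).toReal) (hF1 : F 1 = 1)
    (a b : ℝ) (hab : a ≤ b) (hb1 : b ≤ 1) :
    ∫ v in Icc a 1, (v - a) ∂ν ≤ ∫ v in Icc b 1, (v - b) ∂ν + (b - a) * (1 - F a) := by
  have hm := stmt15_aux ν F hFcdf hF1 a (hab.trans hb1)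
  have hi : Integrable ((Ioc a 1).indicator (fun _ => b - a)) ν :=
    (integrable_const _).indicator measurableSet_Ioc
  have h3 : ∫ v, (Ioc a 1).indicator (fun _ => b - a) v ∂ν = (b - a) * (1 - F a) := by
    rw [integral_indicator measurableSet_Ioc, setIntegral_const, hm, smul_eq_mul, mul_comm]
  rw [← h3, ← integral_indicator measurableSet_Icc, ← integral_indicator measurableSet_Icc,
    ← integral_add (stmt15_int ν b) hi]
  refine integral_mono (stmt15_int ν a) ((stmt15_int ν b).add hi) ?_
  intro v
  simp only [indicator, mem_Icc, mem_Ioc]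
  split_ifs <;> grind

theorem stmt15_bd
    (ν : Measure ℝ) [IsProbabilityMeasure ν]
    (F : ℝ → ℝ) (hFcdf : ∀ x, F x = (ν (Iic x)).toReal) (hF1 : F 1 = 1)
    (a : ℝ) (ha0 : 0 ≤ a) (ha1 : a ≤ 1) :
    ∫ v in Icc a 1, (v - a) ∂ν ≤ 1 - F a := by
  have hm := stmt15_aux ν F hFcdf hF1 a ha1
  have hi : Integrable ((Ioc a 1).indicator (fun _ => (1:ℝ))) ν :=
    (integrable_const _).indicator measurableSet_Ioc
  have h3 : ∫ v, (Ioc a 1).indicator (fun _ => (1:ℝ)) v ∂ν = (1 - F a) := by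
    rw [integral_indicator measurableSet_Ioc, setIntegral_const, hm, smul_eq_mul, mul_one]
  rw [← h3, ← integral_indicator measurableSet_Icc]
  refine integral_mono (stmt15_int ν a) hi ?_
  intro v
  simp only [indicator, mem_Icc, mem_Ioc]
  split_ifs <;> grind

theorem stmt15
    (ν : Measure ℝ) [IsProbabilityMeasure ν]
    (F : ℝ → ℝ) (hFcdf : ∀ x, F x = (ν (Iic x)).toReal)
    (hFcont : ContinuousOn F (Icc 0 1))
    (hFmono : StrictMonoOn F (Icc 0 1))
    (hF0 : F 0 = 0) (hF1 : F 1 = 1)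
    (lam : ℝ) (hlam : lam ∈ Ioo (0:ℝ) 1)
    (μ : ℝ → ℝ)
    (hμmem : ∀ x ∈ Icc (0:ℝ) 1, μ x ∈ Icc (0:ℝ) 1)
    (hμdef : ∀ x ∈ Icc (0:ℝ) 1, F (μ x) = lam + (1 - lam) * F x)
    : ∀ c ∈ Icc (0:ℝ) 1,
      ∫ v in Icc (μ c) 1, (v - μ c) ∂ν ≤
        (1 / lam) * ∑' t : ℕ, (μ^[t + 2] c - μ^[t + 1] c) * (F (μ^[t + 2] c) - F (μ^[t + 1] c)) := by
  intro c hc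
  obtain ⟨hl0, hl1⟩ := hlam
  have hmem : ∀ t, μ^[t] c ∈ Icc (0:ℝ) 1 := by
    intro t
    induction t with
    | zero => exact hc
    | succ t ih => rw [Function.iterate_succ_apply']; exact hμmem _ ih
  have hF : ∀ t, F (μ^[t+1] c) = lam + (1 - lam) * F (μ^[t] c) := by
    intro t
    rw [Function.iterate_succ_apply']; exact hμdef _ (hmem t)
  have hle1 : ∀ t, F (μ^[t] c) ≤ 1 := fun t =>
    hF1 ▸ hFmono.monotoneOn (hmem t) (by simp) (hmem t).2
  have hmono : ∀ t, μ^[t] c ≤ μ^[t+1] c := by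
    intro t
    rw [← hFmono.le_iff_le (hmem t) (hmem (t+1)), hF t]
    nlinarith [hle1 t]
  have hgeo : ∀ t, 1 - F (μ^[t] c) = (1 - lam)^t * (1 - F c) := by
    intro t
    induction t with
    | zero => simp
    | succ t ih => rw [hF, pow_succ]; linear_combination (1 - lam) * ih
  have hc0 : 0 ≤ F c := hF0 ▸ hFmono.monotoneOn (by simp) hc hc.1
  have hgeo' : ∀ t, 1 - F (μ^[t] c) ≤ (1 - lam)^t := by
    intro t
    rw [hgeo]
    exact mul_le_of_le_one_right (pow_nonneg (by linarith) _) (by linarith)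
  have hterm : ∀ t, (μ^[t + 2] c - μ^[t + 1] c) * (F (μ^[t + 2] c) - F (μ^[t + 1] c))
      = lam * ((μ^[t + 2] c - μ^[t + 1] c) * (1 - F (μ^[t + 1] c))) := by
    intro t
    rw [hF (t+1)]; ring
  simp_rw [hterm]
  rw [tsum_mul_left, ← mul_assoc, one_div, inv_mul_cancel₀ hl0.ne', one_mul]
  have hsum : Summable fun t : ℕ => (μ^[t + 2] c - μ^[t + 1] c) * (1 - F (μ^[t + 1] c)) := by
    refine Summable.of_nonneg_of_le (fun t => ?_) (fun t => ?_)
      (summable_geometric_of_lt_one (by linarith) (by linarith : 1 - lam < 1))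
    · exact mul_nonneg (sub_nonneg.2 (hmono (t+1))) (sub_nonneg.2 (hle1 _))
    · have h1 : μ^[t + 2] c - μ^[t + 1] c ≤ 1 := by
        linarith [(hmem (t+2)).2, (hmem (t+1)).1]
      calc _ ≤ 1 - F (μ^[t + 1] c) := mul_le_of_le_one_left (sub_nonneg.2 (hle1 _)) h1
        _ ≤ (1 - lam)^(t+1) := hgeo' _
        _ ≤ (1 - lam)^t := pow_le_pow_of_le_one (by linarith) (by linarith) (Nat.le_succ t)
  have hpart : ∀ n : ℕ, ∫ v in Icc (μ c) 1, (v - μ c) ∂ν ≤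
      ∑ t ∈ Finset.range n, (μ^[t + 2] c - μ^[t + 1] c) * (1 - F (μ^[t + 1] c))
        + ∫ v in Icc (μ^[n+1] c) 1, (v - μ^[n+1] c) ∂ν := by
    intro n
    induction n with
    | zero => simp
    | succ n ih =>
      rw [Finset.sum_range_succ]
      have := stmt15_step ν F hFcdf hF1 _ _ (hmono (n+1)) (hmem (n+2)).2
      linarith
  have hlim := hsum.hasSum.tendsto_sum_nat.add
    ((tendsto_pow_atTop_nhds_zero_of_lt_one (by linarith) (by linarith : 1 - lam < 1)).comp
      (Filter.tendsto_add_atTop_nat 1))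
  rw [add_zero] at hlim
  refine ge_of_tendsto' hlim fun n => ?_
  have h1 := stmt15_bd ν F hFcdf hF1 _ (hmem (n+1)).1 (hmem (n+1)).2
  have h2 := hgeo' (n+1)
  have h3 := hpart n
  simp only [Function.comp]
  linarith
end

section
/- λ-telescoping lower bound: for every λ ∈ (0,1) and every c ∈ [0,1], ∫_{v∈[μ_λ^(2)(c),1]} (v − μ_λ^(−2)(v)) dF(v) ≥ (1 − λ)·Σ_{t=1}^∞ (μ_λ^(t+1)(c) − μ_λ^(t)(c))·(F(μ_λ^(t+1)(c)) − F(μ_λ^(t)(c))). -/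
open MeasureTheory Set

theorem stmt16
    (ν : Measure ℝ) [IsProbabilityMeasure ν]
    (F : ℝ → ℝ) (hFcdf : ∀ x, F x = (ν (Iic x)).toReal)
    (hFcont : ContinuousOn F (Icc 0 1))
    (hFmono : StrictMonoOn F (Icc 0 1))
    (hF0 : F 0 = 0) (hF1 : F 1 = 1)
    (lam : ℝ) (hlam : lam ∈ Ioo (0:ℝ) 1)
    (μ : ℝ → ℝ)
    (hμmem : ∀ x ∈ Icc (0:ℝ) 1, μ x ∈ Icc (0:ℝ) 1)
    (hμdef : ∀ x ∈ Icc (0:ℝ) 1, F (μ x) = lam + (1 - lam) * F x)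
    (μinv2 : ℝ → ℝ)
    (hinvmem : ∀ v ∈ Icc (0:ℝ) 1, μinv2 v ∈ Icc (0:ℝ) 1)
    (hinvdef : ∀ v ∈ Icc (0:ℝ) 1, 1 - (1 - lam)^2 ≤ F v → μ (μ (μinv2 v)) = v)
    (hinvzero : ∀ v ∈ Icc (0:ℝ) 1, F v < 1 - (1 - lam)^2 → μinv2 v = 0)
    : ∀ c ∈ Icc (0:ℝ) 1,
      (1 - lam) * ∑' t : ℕ, (μ^[t + 2] c - μ^[t + 1] c) * (F (μ^[t + 2] c) - F (μ^[t + 1] c)) ≤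
        ∫ v in Icc (μ (μ c)) 1, (v - μinv2 v) ∂ν := by
  obtain ⟨hl0, hl1⟩ := hlam
  intro c hc
  have hl : 0 < 1 - lam := by linarith
  have hx : ∀ n, μ^[n] c ∈ Icc (0:ℝ) 1 := by
    intro n
    induction n with
    | zero => simpa using hc
    | succ k ih => rw [Function.iterate_succ_apply']; exact hμmem _ ih
  have hFx : ∀ n, F (μ^[n+1] c) = lam + (1 - lam) * F (μ^[n] c) := by
    intro n
    rw [Function.iterate_succ_apply']; exact hμdef _ (hx n)
  have hFle : ∀ x ∈ Icc (0:ℝ) 1, F x ≤ 1 := by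
    intro x h
    rw [← hF1]
    exact hFmono.monotoneOn h (by simp) h.2
  have hF0le : ∀ x ∈ Icc (0:ℝ) 1, 0 ≤ F x := by
    intro x h
    rw [← hF0]
    exact hFmono.monotoneOn (by simp) h h.1
  have hle : ∀ x ∈ Icc (0:ℝ) 1, ∀ y ∈ Icc (0:ℝ) 1, F x ≤ F y → x ≤ y :=
    fun x h y h' hh => (hFmono.le_iff_le h h').1 hh
  have hstep : ∀ n, F (μ^[n] c) ≤ F (μ^[n+1] c) := by
    intro n
    rw [hFx]
    nlinarith [hFle _ (hx n)]
  have hstep' : ∀ n, μ^[n] c ≤ μ^[n+1] c := fun n =>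
    hle _ (hx n) _ (hx (n+1)) (hstep n)
  have hmono : Monotone (fun n => μ^[n] c) := monotone_nat_of_le_succ hstep'
  have h2 : μ (μ c) = μ^[2] c := rfl
  rw [h2]
  have hF2 : 1 - (1 - lam)^2 ≤ F (μ^[2] c) := by
    rw [hFx 1, hFx 0]
    have := hF0le _ (hx 0)
    nlinarith [mul_nonneg (mul_nonneg hl.le hl.le) this]
  have hsub : ∀ v ∈ Icc (μ^[2] c) 1, v ∈ Icc (0:ℝ) 1 := fun v hv => ⟨(hx 2).1.trans hv.1, hv.2⟩
  have hFv : ∀ v ∈ Icc (μ^[2] c) 1, F v = lam + (1 - lam) * (lam + (1 - lam) * F (μinv2 v)) := by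
    intro v hv
    have hm := hinvmem v (hsub v hv)
    have h1 := hinvdef v (hsub v hv) (hF2.trans (hFmono.monotoneOn (hx 2) (hsub v hv) hv.1))
    rw [← hμdef _ hm, ← hμdef _ (hμmem _ hm), h1]
  have hcmp : ∀ a b : ℝ, lam + (1 - lam) * (lam + (1 - lam) * a) ≤
      lam + (1 - lam) * (lam + (1 - lam) * b) → a ≤ b := by
    intro a b h
    have h1 := le_of_mul_le_mul_left (by linarith : (1 - lam) * (lam + (1 - lam) * a) ≤
      (1 - lam) * (lam + (1 - lam) * b)) hl
    exact le_of_mul_le_mul_left (by linarith : (1 - lam) * a ≤ (1 - lam) * b) hl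
  have hinvmono : MonotoneOn μinv2 (Icc (μ^[2] c) 1) := by
    intro v hv w hw hvw
    apply hle _ (hinvmem v (hsub v hv)) _ (hinvmem w (hsub w hw))
    apply hcmp
    rw [← hFv v hv, ← hFv w hw]
    exact hFmono.monotoneOn (hsub v hv) (hsub w hw) hvw
  have hint : IntegrableOn (fun v => v - μinv2 v) (Icc (μ^[2] c) 1) ν :=
    (continuous_id.continuousOn.integrableOn_compact isCompact_Icc).sub
      (hinvmono.integrableOn_isCompact isCompact_Icc)
  have hnn : ∀ v ∈ Icc (μ^[2] c) 1, 0 ≤ v - μinv2 v := by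
    intro v hv
    have hm := hinvmem v (hsub v hv)
    have := hle _ hm _ (hsub v hv) (by
      rw [hFv v hv]
      nlinarith [hFle _ hm, mul_nonneg hl.le (mul_nonneg hl0.le (sub_nonneg.2 (hFle _ hm)))])
    linarith
  have hν : ∀ a b : ℝ, a ≤ b → ν.real (Ioc a b) = F b - F a := by
    intro a b hab
    rw [hFcdf, hFcdf, show Ioc a b = Iic b \ Iic a by ext x; simp [and_comm], measureReal_diff (Iic_subset_Iic.2 hab) measurableSet_Iic]
    rfl
  have hIoc : ∀ n, Ioc (μ^[2] c) (μ^[n+2] c) ⊆ Icc (μ^[2] c) 1 := fun n v hv =>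
    ⟨hv.1.le, hv.2.trans (hx _).2⟩
  have hpart : ∀ n, ∑ t ∈ Finset.range n, (1 - lam) * ((μ^[t + 2] c - μ^[t + 1] c) *
      (F (μ^[t + 2] c) - F (μ^[t + 1] c))) ≤ ∫ v in Ioc (μ^[2] c) (μ^[n+2] c), (v - μinv2 v) ∂ν := by
    intro n
    induction n with
    | zero => simp
    | succ n ih =>
      have hsub2 : Ioc (μ^[n+2] c) (μ^[n+3] c) ⊆ Icc (μ^[2] c) 1 := fun v hv =>
        ⟨(hmono (by omega : 2 ≤ n + 2)).trans hv.1.le, hv.2.trans (hx _).2⟩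
      rw [Finset.sum_range_succ, show n + 1 + 2 = n + 3 from rfl,
        ← Ioc_union_Ioc_eq_Ioc (hmono (by omega : 2 ≤ n + 2)) (hstep' (n+2)),
        setIntegral_union (Ioc_disjoint_Ioc_of_le le_rfl) measurableSet_Ioc
          (hint.mono_set (hIoc n)) (hint.mono_set hsub2)]
      refine add_le_add ih ?_
      have hb : ∀ v ∈ Ioc (μ^[n+2] c) (μ^[n+3] c), μ^[n+2] c - μ^[n+1] c ≤ v - μinv2 v := by
        intro v hv
        have hv' := hsub2 hv
        have : μinv2 v ≤ μ^[n+1] c := by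
          apply hle _ (hinvmem v (hsub v hv')) _ (hx _)
          apply hcmp
          rw [← hFv v hv', ← hFx, ← hFx]
          exact hFmono.monotoneOn (hsub v hv') (hx _) hv.2
        linarith [hv.1]
      have := setIntegral_ge_of_const_le_real (μ := ν) measurableSet_Ioc (measure_ne_top _ _) hb
        (hint.mono_set hsub2)
      rw [hν _ _ (hstep' (n+2)), hFx (n+2)] at this
      have e := hFx (n+1)
      rw [show n + 1 + 1 = n + 2 from rfl] at e
      refine le_trans (le_of_eq ?_) this
      rw [e]
      ring
  rw [← tsum_mul_left]
  apply Real.tsum_le_of_sum_range_le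
  · intro t
    exact mul_nonneg hl.le (mul_nonneg (sub_nonneg.2 (hstep' (t+1))) (sub_nonneg.2 (hstep (t+1))))
  · intro n
    refine (hpart n).trans (setIntegral_mono_set hint ?_ (hIoc n).eventuallyLE)
    exact (ae_restrict_iff' measurableSet_Icc).2 (Filter.Eventually.of_forall hnn)
end

section
/- λ-pointwise lemma: for every λ ∈ (0,1) and every c ∈ [0,1], ∫_{v∈[c,1]} (v − c) dF(v) ≤ (1/(1 − λ))·(μ_λ(c) − c)·(1 − F(μ_λ(c))) + (1/(λ·(1 − λ)²))·∫_{v∈[μ_λ^(2)(c),1]} (v − μ_λ^(−2)(v)) dF(v). -/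
open MeasureTheory Set

lemma aux_sing (ν : Measure ℝ) [IsProbabilityMeasure ν]
    (F : ℝ → ℝ) (hFcdf : ∀ x, F x = (ν (Iic x)).toReal)
    (hFcont : ContinuousOn F (Icc 0 1)) (hF0 : F 0 = 0) (x : ℝ) (hx : x ∈ Icc (0:ℝ) 1) :
    ν.real {x} = 0 := by
  have hF : ∀ x, F x = ν.real (Iic x) := hFcdf
  apply le_antisymm _ measureReal_nonneg
  rcases eq_or_lt_of_le hx.1 with h | h
  · subst h
    calc ν.real {(0:ℝ)} ≤ ν.real (Iic 0) := measureReal_mono (by simp)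
      _ = 0 := by rw [← hF, hF0]
  · have key : ∀ y ∈ Ioo 0 x, ν.real {x} ≤ F x - F y := by
      intro y hy
      have h1 : ν.real ({x} ∪ Iic y) = ν.real {x} + ν.real (Iic y) :=
        measureReal_union (by simpa using hy.2) measurableSet_Iic
      have h2 : ν.real ({x} ∪ Iic y) ≤ ν.real (Iic x) := by
        refine measureReal_mono ?_
        intro z hz
        rcases hz with hz | hz
        · exact le_of_eq hz
        · exact le_trans hz hy.2.le
      rw [hF, hF]; linarith
    have hc : Filter.Tendsto F (nhdsWithin x (Ioo 0 x)) (nhds (F x)) :=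
      (hFcont x hx).mono_left (nhdsWithin_mono _ (fun z hz => ⟨hz.1.le, hz.2.le.trans hx.2⟩))
    have hc2 : Filter.Tendsto (fun y => F x - F y) (nhdsWithin x (Ioo 0 x)) (nhds 0) := by
      simpa using hc.const_sub (F x)
    have : (nhdsWithin x (Ioo 0 x)).NeBot := by
      rw [nhdsWithin_Ioo_eq_nhdsLT h]; infer_instance
    exact ge_of_tendsto hc2 (Filter.eventually_of_mem self_mem_nhdsWithin key)

lemma aux_Ico (ν : Measure ℝ) [IsProbabilityMeasure ν]
    (F : ℝ → ℝ) (hFcdf : ∀ x, F x = (ν (Iic x)).toReal)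
    (hFcont : ContinuousOn F (Icc 0 1)) (hF0 : F 0 = 0) (x y : ℝ) (hx : x ∈ Icc (0:ℝ) 1)
    (hy : y ∈ Icc (0:ℝ) 1) (hxy : x ≤ y) :
    ν.real (Ico x y) = F y - F x ∧ ν.real (Icc x y) = F y - F x := by
  have hF : ∀ x, F x = ν.real (Iic x) := hFcdf
  have sx := aux_sing ν F hFcdf hFcont hF0 x hx
  have sy := aux_sing ν F hFcdf hFcont hF0 y hy
  have h1 : ν.real (Iic x ∪ Ioc x y) = ν.real (Iic x) + ν.real (Ioc x y) :=
    measureReal_union (Iic_disjoint_Ioc le_rfl) measurableSet_Ioc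
  rw [Iic_union_Ioc_eq_Iic hxy] at h1
  have h2 : ν.real (Icc x y) = ν.real {x} + ν.real (Ioc x y) := by
    rw [← Ioc_insert_left hxy, insert_eq]
    exact measureReal_union (by simp) measurableSet_Ioc
  have h3 : ν.real (Icc x y) = ν.real (Ico x y) + ν.real {y} := by
    rw [← Ico_union_right hxy]
    exact measureReal_union (by simp) (measurableSet_singleton y)
  rw [hF, hF]
  constructor <;> linarith

lemma aux_arith (lam f c c1 c2 I0 I1 I2 : ℝ) (hl0 : 0 < lam) (hl1 : lam < 1)
    (k0 : I0 ≤ (c1 - c) * (lam + (1 - lam) * f - f))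
    (k1 : (c1 - c) * (1 - (1 - lam) ^ 2 + (1 - lam) ^ 2 * f - (lam + (1 - lam) * f)) ≤ I1)
    (k2 : I1 ≤ (c2 - c) * (1 - (1 - lam) ^ 2 + (1 - lam) ^ 2 * f - (lam + (1 - lam) * f)))
    (k3 : (c2 - c) * (1 - (1 - (1 - lam) ^ 2 + (1 - lam) ^ 2 * f)) ≤ I2) :
    I0 + I1 + I2 ≤ (1 / (1 - lam)) * ((c1 - c) * (1 - (lam + (1 - lam) * f))) +
        (1 / (lam * (1 - lam)^2)) * (I2 - (1 - lam)^2 * (I0 + I1 + I2)) := by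
  obtain ⟨X, hX⟩ : ∃ X, X = (c1 - c) * (1 - f) := ⟨_, rfl⟩
  obtain ⟨Y, hY⟩ : ∃ Y, Y = (c2 - c) * (1 - f) := ⟨_, rfl⟩
  have hq0 : 0 < 1 - lam := by linarith
  have k0' : I0 ≤ lam * X := by rw [hX]; linarith
  have k1' : lam * (1 - lam) * X ≤ I1 := by rw [hX]; linarith
  have k2' : I1 ≤ lam * (1 - lam) * Y := by rw [hY]; linarith
  have k3' : (1 - lam)^2 * Y ≤ I2 := by rw [hY]; linarith
  have k4 : (1 - lam) * I1 ≤ lam * I2 := by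
    have := mul_le_mul_of_nonneg_left k2' hq0.le
    have := mul_le_mul_of_nonneg_left k3' hl0.le
    linarith
  have hD : 0 < lam * (1 - lam)^2 := by positivity
  have e : 1 / (1 - lam) * ((c1 - c) * (1 - (lam + (1 - lam) * f))) + 1 / (lam * (1 - lam)^2) *
      (I2 - (1 - lam)^2 * (I0 + I1 + I2))
      = X + (I2 - (1 - lam)^2 * (I0 + I1 + I2)) / (lam * (1 - lam)^2) := by
    rw [hX, show 1 - (lam + (1 - lam) * f) = (1 - lam) * (1 - f) by ring]
    field_simp
  rw [e, ← sub_le_iff_le_add', le_div_iff₀ hD]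
  have hcoef : 0 ≤ 1 + lam - lam^2 := by nlinarith
  have m1 := mul_le_mul_of_nonneg_left k4 hcoef
  have m2 := mul_le_mul_of_nonneg_left k1' (mul_pos hq0 hl0).le
  have m3 := mul_le_mul_of_nonneg_left k0'
    (mul_pos (pow_pos hq0 2) (by linarith : 0 < 1 + lam)).le
  linarith

theorem stmt17
    (ν : Measure ℝ) [IsProbabilityMeasure ν]
    (F : ℝ → ℝ) (hFcdf : ∀ x, F x = (ν (Iic x)).toReal)
    (hFcont : ContinuousOn F (Icc 0 1))
    (hFmono : StrictMonoOn F (Icc 0 1))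
    (hF0 : F 0 = 0) (hF1 : F 1 = 1)
    (lam : ℝ) (hlam : lam ∈ Ioo (0:ℝ) 1)
    (μ : ℝ → ℝ)
    (hμmem : ∀ x ∈ Icc (0:ℝ) 1, μ x ∈ Icc (0:ℝ) 1)
    (hμdef : ∀ x ∈ Icc (0:ℝ) 1, F (μ x) = lam + (1 - lam) * F x)
    (μinv2 : ℝ → ℝ)
    (hinvmem : ∀ v ∈ Icc (0:ℝ) 1, μinv2 v ∈ Icc (0:ℝ) 1)
    (hinvdef : ∀ v ∈ Icc (0:ℝ) 1, 1 - (1 - lam)^2 ≤ F v → μ (μ (μinv2 v)) = v)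
    (hinvzero : ∀ v ∈ Icc (0:ℝ) 1, F v < 1 - (1 - lam)^2 → μinv2 v = 0)
    : ∀ c ∈ Icc (0:ℝ) 1,
      ∫ v in Icc c 1, (v - c) ∂ν ≤
        (1 / (1 - lam)) * ((μ c - c) * (1 - F (μ c))) +
        (1 / (lam * (1 - lam)^2)) * ∫ v in Icc (μ (μ c)) 1, (v - μinv2 v) ∂ν := by
  intro c hc
  have hl0 := hlam.1
  have hl1 := hlam.2
  have hm := fun x y hx hy => aux_Ico ν F hFcdf hFcont hF0 x y hx hy
  have hle : ∀ x ∈ Icc (0:ℝ) 1, ∀ y ∈ Icc (0:ℝ) 1, (F x ≤ F y ↔ x ≤ y) :=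
    fun x hx y hy => hFmono.le_iff_le hx hy
  have h1I : (1:ℝ) ∈ Icc (0:ℝ) 1 := by simp
  have h0I : (0:ℝ) ∈ Icc (0:ℝ) 1 := by simp
  have hFle1 : ∀ x ∈ Icc (0:ℝ) 1, F x ≤ 1 := fun x hx => by
    rw [← hF1]; exact (hle x hx 1 h1I).2 hx.2
  have hFge0 : ∀ x ∈ Icc (0:ℝ) 1, 0 ≤ F x := fun x hx => by
    rw [← hF0]; exact (hle 0 h0I x hx).2 hx.1
  have hμge : ∀ x ∈ Icc (0:ℝ) 1, x ≤ μ x := by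
    intro x hx
    rw [← hle x hx _ (hμmem x hx), hμdef x hx]
    nlinarith [hFle1 x hx]
  have hg : ∀ x ∈ Icc (0:ℝ) 1, F (μ (μ x)) = 1 - (1-lam)^2 + (1-lam)^2 * F x := by
    intro x hx
    rw [hμdef _ (hμmem x hx), hμdef x hx]; ring
  have hgm : ∀ x ∈ Icc (0:ℝ) 1, μ (μ x) ∈ Icc (0:ℝ) 1 := fun x hx => hμmem _ (hμmem x hx)
  have hq : 0 < (1-lam)^2 := by have : 0 < 1 - lam := by linarith
                                positivity
  have hgle : ∀ x ∈ Icc (0:ℝ) 1, ∀ y ∈ Icc (0:ℝ) 1, (μ (μ x) ≤ μ (μ y) ↔ x ≤ y) := by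
    intro x hx y hy
    rw [← hle _ (hgm x hx) _ (hgm y hy), hg x hx, hg y hy, ← hle x hx y hy]
    constructor
    · intro h; exact le_of_mul_le_mul_left (by linarith) hq
    · intro h; have := mul_le_mul_of_nonneg_left h hq.le; linarith
  set c1 := μ c with hc1
  set c2 := μ c1 with hc2
  have hc1m : c1 ∈ Icc (0:ℝ) 1 := hμmem c hc
  have hc2m : c2 ∈ Icc (0:ℝ) 1 := hμmem c1 hc1m
  have hcc1 : c ≤ c1 := hμge c hc
  have hc12 : c1 ≤ c2 := hμge c1 hc1m
  have hsub : ∀ v ∈ Icc c2 1, v ∈ Icc (0:ℝ) 1 := fun v hv => ⟨hc2m.1.trans hv.1, hv.2⟩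
  have hinv : ∀ v ∈ Icc c2 1, μ (μ (μinv2 v)) = v := by
    intro v hv
    apply hinvdef v (hsub v hv)
    have h1 := (hle c2 hc2m v (hsub v hv)).2 hv.1
    have h2 := hg c hc
    have := mul_nonneg hq.le (hFge0 c hc)
    rw [← hc1, ← hc2] at h2
    linarith
  have hinvm : ∀ v ∈ Icc c2 1, μinv2 v ∈ Icc (0:ℝ) 1 := fun v hv => hinvmem v (hsub v hv)
  have hmono : MonotoneOn μinv2 (Icc c2 1) := by
    intro v hv w hw hvw
    rw [← hgle _ (hinvm v hv) _ (hinvm w hw), hinv v hv, hinv w hw]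
    exact hvw
  have haem : AEMeasurable μinv2 (ν.restrict (Icc c2 1)) :=
    aemeasurable_restrict_of_monotoneOn measurableSet_Icc hmono
  have hFc1 := hμdef c hc
  have hFc2 := hg c hc
  rw [← hc1] at hFc1
  rw [← hc1, ← hc2] at hFc2
  -- pushforward
  have hinvc : ∀ v ∈ Icc c2 1, c ≤ μinv2 v := by
    intro v hv
    rw [← hgle c hc _ (hinvm v hv), hinv v hv]; exact hv.1
  have hmap : (ν.restrict (Icc c2 1)).map μinv2
      = (ENNReal.ofReal ((1-lam)^2)) • ν.restrict (Icc c 1) := by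
    have hfin : IsFiniteMeasure ((ν.restrict (Icc c2 1)).map μinv2) := inferInstance
    apply Measure.ext_of_Iic
    intro a
    rw [Measure.map_apply_of_aemeasurable haem measurableSet_Iic]
    rw [Measure.smul_apply, Measure.restrict_apply measurableSet_Iic,
      Measure.restrict_apply' measurableSet_Icc, smul_eq_mul]
    have hreal : ∀ s : Set ℝ, ν s = ENNReal.ofReal (ν.real s) := fun s => by simp
    by_cases ha : a < c
    · have e1 : μinv2 ⁻¹' Iic a ∩ Icc c2 1 = ∅ := by
        ext v; simp only [mem_inter_iff, mem_preimage, mem_Iic, mem_empty_iff_false, iff_false]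
        rintro ⟨h, hv⟩
        linarith [hinvc v hv]
      have e2 : Iic a ∩ Icc c 1 = ∅ := by
        ext v; simp only [mem_inter_iff, mem_Iic, mem_empty_iff_false, iff_false, mem_Icc]
        rintro ⟨h, hv, _⟩
        linarith
      rw [e1, e2]; simp
    · push Not at ha
      obtain ⟨b, hb, hcb, hab⟩ : ∃ b ∈ Icc (0:ℝ) 1, c ≤ b ∧ ∀ z ≤ (1:ℝ), (z ≤ a ↔ z ≤ b) := by
        refine ⟨min a 1, ⟨le_min (hc.1.trans ha) zero_le_one, min_le_right _ _⟩,
          le_min ha hc.2, fun z hz => ?_⟩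
        simp [hz]
      have e1 : μinv2 ⁻¹' Iic a ∩ Icc c2 1 = Icc c2 (μ (μ b)) := by
        ext v
        simp only [mem_inter_iff, mem_preimage, mem_Iic]
        constructor
        · rintro ⟨h, hv⟩
          rw [hab _ (hinvm v hv).2, ← hgle _ (hinvm v hv) _ hb, hinv v hv] at h
          exact ⟨hv.1, h⟩
        · intro h
          have hv : v ∈ Icc c2 1 := ⟨h.1, h.2.trans (hgm b hb).2⟩
          refine ⟨?_, hv⟩
          rw [hab _ (hinvm v hv).2, ← hgle _ (hinvm v hv) _ hb, hinv v hv]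
          exact h.2
      have e2 : Iic a ∩ Icc c 1 = Icc c b := by
        ext v
        simp only [mem_inter_iff, mem_Iic, mem_Icc]
        constructor
        · rintro ⟨h, h1, h2⟩
          exact ⟨h1, (hab v h2).1 h⟩
        · rintro ⟨h1, h2⟩
          exact ⟨(hab v (h2.trans hb.2)).2 h2, h1, h2.trans hb.2⟩
      have hcb' : c2 ≤ μ (μ b) := (hgle c hc b hb).2 hcb
      rw [e1, e2, hreal, hreal (Icc c b), ← ENNReal.ofReal_mul hq.le,
        (hm _ _ hc2m (hgm b hb) hcb').2, (hm _ _ hc hb hcb).2, hg b hb, hFc2]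
      congr 1; ring
  have hpush : ∫ v in Icc c2 1, (μinv2 v - c) ∂ν
      = (1-lam)^2 * ∫ v in Icc c 1, (v - c) ∂ν := by
    have h := integral_map (μ := ν.restrict (Icc c2 1)) haem (f := fun x => x - c)
      (by fun_prop)
    rw [← h, hmap, integral_smul_measure, ENNReal.toReal_ofReal hq.le, smul_eq_mul]
  have hintI : ∀ x y, IntegrableOn (fun v : ℝ => v - c) (Icc x y) ν := fun x y =>
    (by fun_prop : Continuous (fun v : ℝ => v - c)).continuousOn.integrableOn_Icc
  have hintO : ∀ x y, IntegrableOn (fun v : ℝ => v - c) (Ico x y) ν := fun x y =>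
    (hintI x y).mono_set Ico_subset_Icc_self
  have hintinv : IntegrableOn (fun v => μinv2 v - c) (Icc c2 1) ν := by
    have hb : ∀ᵐ v ∂(ν.restrict (Icc c2 1)), ‖μinv2 v - c‖ ≤ 1 := by
      filter_upwards [ae_restrict_mem measurableSet_Icc] with v hv
      have := hinvm v hv
      rw [Real.norm_eq_abs, abs_le]
      constructor <;> linarith [this.1, this.2, hc.1, hc.2]
    exact Integrable.of_bound (haem.sub_const c).aestronglyMeasurable 1 hb
  have hJ : ∫ v in Icc c2 1, (v - μinv2 v) ∂ν
      = (∫ v in Icc c2 1, (v - c) ∂ν) - (1-lam)^2 * ∫ v in Icc c 1, (v - c) ∂ν := by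
    rw [← hpush, ← integral_sub (hintI c2 1) hintinv]
    congr 1; ext v; ring
  have hsplit : ∫ v in Icc c 1, (v - c) ∂ν = (∫ v in Ico c c1, (v - c) ∂ν)
      + (∫ v in Ico c1 c2, (v - c) ∂ν) + ∫ v in Icc c2 1, (v - c) ∂ν := by
    rw [← setIntegral_union (by
        rw [Set.disjoint_left]; intro z hz hz'; exact absurd hz.2 (not_lt.2 hz'.1))
        measurableSet_Ico (hintO _ _) (hintO _ _), Ico_union_Ico_eq_Ico hcc1 hc12,
      ← setIntegral_union (by
        rw [Set.disjoint_left]; intro z hz hz'; exact absurd hz.2 (not_lt.2 hz'.1))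
        measurableSet_Icc (hintO _ _) (hintI _ _),
      Ico_union_Icc_eq_Icc (hcc1.trans hc12) hc2m.2]
  have hup : ∀ x ∈ Icc (0:ℝ) 1, ∀ y ∈ Icc (0:ℝ) 1, x ≤ y →
      ∫ v in Ico x y, (v - c) ∂ν ≤ (y - c) * (F y - F x) := by
    intro x hx y hy hxy
    have h : ∫ v in Ico x y, (v - c) ∂ν ≤ ∫ v in Ico x y, (y - c) ∂ν :=
      setIntegral_mono_on (hintO x y) (integrable_const _) measurableSet_Ico
        (fun v hv => by linarith [hv.2])
    rw [setIntegral_const, (hm x y hx hy hxy).1, smul_eq_mul] at h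
    linarith
  have hlo : ∀ x ∈ Icc (0:ℝ) 1, ∀ y ∈ Icc (0:ℝ) 1, x ≤ y →
      (x - c) * (F y - F x) ≤ ∫ v in Ico x y, (v - c) ∂ν := by
    intro x hx y hy hxy
    have h : ∫ v in Ico x y, (x - c) ∂ν ≤ ∫ v in Ico x y, (v - c) ∂ν :=
      setIntegral_mono_on (integrable_const _) (hintO x y) measurableSet_Ico
        (fun v hv => by linarith [hv.1])
    rw [setIntegral_const, (hm x y hx hy hxy).1, smul_eq_mul] at h
    linarith
  have hlo2 : (c2 - c) * (F 1 - F c2) ≤ ∫ v in Icc c2 1, (v - c) ∂ν := by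
    have h : ∫ v in Icc c2 1, (c2 - c) ∂ν ≤ ∫ v in Icc c2 1, (v - c) ∂ν :=
      setIntegral_mono_on (integrable_const _) (hintI c2 1) measurableSet_Icc
        (fun v hv => by linarith [hv.1])
    rw [setIntegral_const, (hm c2 1 hc2m h1I hc2m.2).2, smul_eq_mul] at h
    linarith
  have k0 := hup c hc c1 hc1m hcc1
  have k1 := hlo c1 hc1m c2 hc2m hc12
  have k2 := hup c1 hc1m c2 hc2m hc12
  rw [hJ, hsplit]
  generalize (∫ v in Ico c c1, (v - c) ∂ν) = I0 at *
  generalize (∫ v in Ico c1 c2, (v - c) ∂ν) = I1 at *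
  generalize (∫ v in Icc c2 1, (v - c) ∂ν) = I2 at *
  rw [hF1] at hlo2
  rw [hFc2] at k1 k2 hlo2
  rw [hFc1] at k0 k1 k2 ⊢
  exact aux_arith lam (F c) c c1 c2 I0 I1 I2 hl0 hl1 k0 k1 k2 hlo2
end

section
/- General λ-approximation theorem: for every λ ∈ (0,1), FB ≤ (1/(1 − λ))·SP + (1/(λ·(1 − λ)²))·BuyerP. -/
open MeasureTheory Set

lemma aux_null (μ : Measure ℝ) [IsProbabilityMeasure μ]
    (F : ℝ → ℝ) (hF : ∀ x, F x = (μ (Iic x)).toReal)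
    (hFcont : ContinuousOn F (Icc 0 1)) (hF0 : F 0 = 0) (hF1 : F 1 = 1) : NullSingletonClass μ := by
  have hF' : ∀ x, F x = μ.real (Iic x) := hF
  refine ⟨fun a => ?_⟩
  have key : μ.real {a} = 0 := by
    rcases le_or_gt a 0 with h | h
    · have : μ.real {a} ≤ μ.real (Iic 0) := measureReal_mono (by simpa using h)
      rw [← hF', hF0] at this
      exact le_antisymm this measureReal_nonneg
    rcases le_or_gt a 1 with h1 | h1
    · have hb : ∀ b, b < a → μ.real {a} ≤ F a - F b := by
        intro b hb
        have h2 : μ.real (Iic b ∪ {a}) = μ.real (Iic b) + μ.real {a} :=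
          measureReal_union (by simpa using hb) (measurableSet_singleton a)
        have h3 : μ.real (Iic b ∪ {a}) ≤ μ.real (Iic a) :=
          measureReal_mono (by
            intro y hy
            rcases hy with hy | hy
            · exact le_trans hy hb.le
            · exact le_of_eq hy)
        rw [hF', hF']; linarith
      have hc : ContinuousWithinAt F (Ioo 0 a) a :=
        (hFcont a ⟨h.le, h1⟩).mono (fun y hy => ⟨hy.1.le, hy.2.le.trans h1⟩)
      have hne : (nhdsWithin a (Ioo 0 a)).NeBot := by
        rw [← mem_closure_iff_nhdsWithin_neBot, closure_Ioo h.ne]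
        exact ⟨h.le, le_rfl⟩
      have ht : Filter.Tendsto (fun b => F a - F b) (nhdsWithin a (Ioo 0 a)) (nhds (F a - F a)) :=
        tendsto_const_nhds.sub hc
      have := ge_of_tendsto ht (by
        filter_upwards [self_mem_nhdsWithin] with b hb'
        exact hb b hb'.2)
      rw [sub_self] at this
      exact le_antisymm this measureReal_nonneg
    · have h2 : μ.real (Iic 1 ∪ {a}) = μ.real (Iic 1) + μ.real {a} :=
          measureReal_union (by simpa using h1) (measurableSet_singleton a)
      have h3 : μ.real (Iic 1 ∪ {a}) ≤ 1 := measureReal_le_one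
      rw [← hF', hF1] at h2
      exact le_antisymm (by linarith) measureReal_nonneg
  simpa [Measure.real, ENNReal.toReal_eq_zero_iff] using key

lemma aux_Ico_s18 (μ : Measure ℝ) [IsProbabilityMeasure μ] [NullSingletonClass μ]
    (F : ℝ → ℝ) (hF : ∀ x, F x = (μ (Iic x)).toReal) {s t : ℝ} (h : s ≤ t) :
    μ.real (Ico s t) = F t - F s := by
  have hF' : ∀ x, F x = μ.real (Iic x) := hF
  rw [measureReal_congr Ico_ae_eq_Ioc, ← Iic_sdiff_Iic,
    measureReal_sdiff (Iic_subset_Iic.2 h) measurableSet_Iic, hF', hF']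

lemma aux_int_s18 (μ : Measure ℝ) [IsProbabilityMeasure μ] (c s t : ℝ) :
    IntegrableOn (fun v => v - c) (Icc s t) μ :=
  (by fun_prop : Continuous fun v : ℝ => v - c).continuousOn.integrableOn_compact isCompact_Icc

lemma aux_split (μ : Measure ℝ) [IsProbabilityMeasure μ] (c : ℝ) {s t u : ℝ}
    (h : s ≤ t) (h' : t ≤ u) :
    ∫ v in Icc s u, (v - c) ∂μ = ∫ v in Ico s t, (v - c) ∂μ + ∫ v in Icc t u, (v - c) ∂μ := by
  rw [← Ico_union_Icc_eq_Icc h h', setIntegral_union _ measurableSet_Icc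
    ((aux_int_s18 μ c s t).mono_set Ico_subset_Icc_self) (aux_int_s18 μ c t u)]
  rw [Set.disjoint_left]
  intro y hy hy'
  exact absurd hy.2 (not_lt.2 hy'.1)

lemma aux_split' (μ : Measure ℝ) [IsProbabilityMeasure μ] (c : ℝ) {s t u : ℝ}
    (h : s ≤ t) (h' : t ≤ u) :
    ∫ v in Ico s u, (v - c) ∂μ = ∫ v in Ico s t, (v - c) ∂μ + ∫ v in Ico t u, (v - c) ∂μ := by
  rw [← Ico_union_Ico_eq_Ico h h', setIntegral_union _ measurableSet_Ico
    ((aux_int_s18 μ c s t).mono_set Ico_subset_Icc_self)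
    ((aux_int_s18 μ c t u).mono_set Ico_subset_Icc_self)]
  rw [Set.disjoint_left]
  intro y hy hy'
  exact absurd hy.2 (not_lt.2 hy'.1)

lemma aux_cell (μ : Measure ℝ) [IsProbabilityMeasure μ] [NullSingletonClass μ]
    (F : ℝ → ℝ) (hF : ∀ x, F x = (μ (Iic x)).toReal) (c : ℝ) {s t : ℝ} (h : s ≤ t) :
    ∫ v in Ico s t, (v - c) ∂μ ≤ (t - c) * (F t - F s) := by
  have h1 : ∫ v in Ico s t, (v - c) ∂μ ≤ ∫ v in Ico s t, (t - c) ∂μ := by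
    refine setIntegral_mono_on ((aux_int_s18 μ c s t).mono_set Ico_subset_Icc_self)
      (integrable_const _) measurableSet_Ico ?_
    intro v hv
    linarith [hv.2]
  rw [setIntegral_const, aux_Ico_s18 μ F hF h, smul_eq_mul] at h1
  linarith

lemma aux_top (μ : Measure ℝ) [IsProbabilityMeasure μ] [NullSingletonClass μ]
    (F : ℝ → ℝ) (hF : ∀ x, F x = (μ (Iic x)).toReal) (c : ℝ) {s t : ℝ} (h : s ≤ t) :
    (s - c) * (F t - F s) ≤ ∫ v in Icc s t, (v - c) ∂μ := by
  have h1 : ∫ v in Icc s t, (s - c) ∂μ ≤ ∫ v in Icc s t, (v - c) ∂μ := by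
    refine setIntegral_mono_on (integrable_const _) (aux_int_s18 μ c s t) measurableSet_Icc ?_
    intro v hv
    linarith [hv.1]
  rw [setIntegral_const, ← measureReal_congr Ico_ae_eq_Icc, aux_Ico_s18 μ F hF h, smul_eq_mul] at h1
  linarith

/-- Measurability and integrability of the parametrised inner integral. -/
lemma aux_param (μ ν : Measure ℝ) [IsProbabilityMeasure μ] [IsProbabilityMeasure ν]
    (A : Set (ℝ × ℝ)) (hA : MeasurableSet A) (f : ℝ × ℝ → ℝ) (hf : Measurable f)
    (hb : ∀ x ∈ Icc (0:ℝ) 1, ∀ y, (x, y) ∈ A → |f (x, y)| ≤ 1) :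
    IntegrableOn (fun x => ∫ y in {y | (x, y) ∈ A}, f (x, y) ∂μ) (Icc 0 1) ν := by
  have hm : StronglyMeasurable (fun x => ∫ y, A.indicator f (x, y) ∂μ) :=
    (hf.indicator hA).stronglyMeasurable.integral_prod_right'
  have he : (fun x => ∫ y in {y | (x, y) ∈ A}, f (x, y) ∂μ)
      = fun x => ∫ y, A.indicator f (x, y) ∂μ := by
    funext x
    have hs : MeasurableSet {y | (x, y) ∈ A} := measurable_prodMk_left hA
    rw [← integral_indicator hs]
    rfl
  rw [he]
  refine Measure.integrableOn_of_bounded (M := 1) (measure_ne_top _ _)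
    hm.aestronglyMeasurable ?_
  refine (ae_restrict_iff' measurableSet_Icc).2 (Filter.Eventually.of_forall fun x hx => ?_)
  have := norm_integral_le_of_norm_le_const (μ := μ) (f := fun y => A.indicator f (x, y)) (C := 1)
    (Filter.Eventually.of_forall fun y => by
      by_cases h : (x, y) ∈ A
      · simpa [h] using hb x hx y h
      · simp [h])
  simpa using this

/-- The telescoping estimate on quantile cells. -/
lemma aux_tele (μ : Measure ℝ) [IsProbabilityMeasure μ] [NullSingletonClass μ]
    (F : ℝ → ℝ) (hF : ∀ x, F x = (μ (Iic x)).toReal)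
    (w : ℕ → ℝ) (hw0 : w 0 = 0) (hwm : Monotone w)
    (c x : ℝ) (hcx : c ≤ x) (hx0 : 0 ≤ x)
    (hxw : ∀ k, x ≤ w (k + 1) → c ≤ w k) (K : ℕ) :
    ∀ t, x ≤ t → t ≤ w K →
      ∫ v in Ico x t, (v - c) ∂μ + (t - c) * (1 - F t) - (x - c) * (1 - F x) ≤
      ∑ k ∈ Finset.range K,
        (Iic (w k)).indicator (fun _ => (1 - F (w k)) * (w (k + 1) - w k)) c := by
  have hF' : ∀ x, F x = μ.real (Iic x) := hF
  have hle1 : ∀ y, F y ≤ 1 := fun y => by rw [hF']; exact measureReal_le_one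
  have hmono : ∀ {a b}, a ≤ b → F a ≤ F b := fun {a b} h => by
    rw [hF', hF']; exact measureReal_mono (Iic_subset_Iic.2 h)
  have hcell : ∀ s t, s ≤ t →
      ∫ v in Ico s t, (v - c) ∂μ + (t - c) * (1 - F t) - (s - c) * (1 - F s)
        ≤ (1 - F s) * (t - s) := fun s t h => by
    have := aux_cell μ F hF c h
    nlinarith
  induction K with
  | zero =>
    intro t h1 h2
    have : t = x := by rw [hw0] at h2; linarith
    subst this
    simp
  | succ K ih =>
    intro t h1 h2
    rw [Finset.sum_range_succ]
    have hnn : 0 ≤ ∑ k ∈ Finset.range K,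
        (Iic (w k)).indicator (fun _ => (1 - F (w k)) * (w (k + 1) - w k)) c := by
      refine Finset.sum_nonneg fun k _ => indicator_nonneg (fun _ _ => ?_) _
      exact mul_nonneg (by linarith [hle1 (w k)]) (by linarith [hwm (Nat.le_succ k)])
    have hck : c ≤ w K := hxw K (h1.trans h2)
    rw [indicator_of_mem (show c ∈ Iic (w K) from hck)]
    have hq := hle1 (w K)
    rcases le_total t (w K) with ht | ht
    · have := ih t h1 ht
      have h3 : 0 ≤ (1 - F (w K)) * (w (K + 1) - w K) :=
        mul_nonneg (by linarith) (by linarith [hwm (Nat.le_succ K)])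
      linarith
    rcases le_total x (w K) with hxK | hxK
    · have h3 := ih (w K) hxK le_rfl
      have h4 := hcell (w K) t ht
      rw [aux_split' μ c hxK ht]
      have h5 : (1 - F (w K)) * (t - w K) ≤ (1 - F (w K)) * (w (K + 1) - w K) :=
        mul_le_mul_of_nonneg_left (by linarith) (by linarith)
      linarith
    · have h4 := hcell x t h1
      have h5 : (1 - F x) * (t - x) ≤ (1 - F (w K)) * (w (K + 1) - w K) :=
        mul_le_mul (by linarith [hmono hxK]) (by linarith) (by linarith) (by linarith)
      linarith

theorem stmt18
    (νF : Measure ℝ) [IsProbabilityMeasure νF]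
    (F : ℝ → ℝ) (hFcdf : ∀ x, F x = (νF (Iic x)).toReal)
    (hFcont : ContinuousOn F (Icc 0 1))
    (hFmono : StrictMonoOn F (Icc 0 1))
    (hF0 : F 0 = 0) (hF1 : F 1 = 1)
    (νG : Measure ℝ) [IsProbabilityMeasure νG]
    (G : ℝ → ℝ) (hGcdf : ∀ x, G x = (νG (Iic x)).toReal)
    (hGcont : ContinuousOn G (Icc 0 1))
    (hGmono : StrictMonoOn G (Icc 0 1))
    (hG0 : G 0 = 0) (hG1 : G 1 = 1)
    (r : ℝ → ℝ) (hrmeas : Measurable r)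
    (hrmem : ∀ c ∈ Icc (0:ℝ) 1, r c ∈ Icc (0:ℝ) 1)
    (hrmax : ∀ c ∈ Icc (0:ℝ) 1, ∀ p ∈ Icc (0:ℝ) 1,
      (p - c) * (1 - F p) ≤ (r c - c) * (1 - F (r c)))
    (r' : ℝ → ℝ) (hr'meas : Measurable r')
    (hr'mem : ∀ v ∈ Icc (0:ℝ) 1, r' v ∈ Icc (0:ℝ) 1)
    (hr'max : ∀ v ∈ Icc (0:ℝ) 1, ∀ p ∈ Icc (0:ℝ) 1,
      (v - p) * G p ≤ (v - r' v) * G (r' v))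
    (FB SP BuyerP : ℝ)
    (hFB : FB = ∫ c in Icc (0:ℝ) 1, (∫ v in Icc c 1, (v - c) ∂νF) ∂νG)
    (hSP : SP = ∫ c in Icc (0:ℝ) 1, (∫ v in Icc (r c) 1, (v - c) ∂νF) ∂νG)
    (hBuyerP : BuyerP = ∫ v in Icc (0:ℝ) 1, (∫ c in Icc 0 (r' v), (v - c) ∂νG) ∂νF)
    : ∀ lam ∈ Ioo (0:ℝ) 1,
      FB ≤ (1 / (1 - lam)) * SP + (1 / (lam * (1 - lam)^2)) * BuyerP := by
  intro lam hlam
  obtain ⟨hl0, hl1⟩ := hlam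
  have hm : 0 < 1 - lam := by linarith
  have : NullSingletonClass νF := aux_null νF F hFcdf hFcont hF0 hF1
  have : NullSingletonClass νG := aux_null νG G hGcdf hGcont hG0 hG1
  have hF1' : ∀ y, F y ≤ 1 := fun y => by rw [hFcdf]; exact measureReal_le_one
  have hG0' : ∀ y, 0 ≤ G y := fun y => by rw [hGcdf]; exact measureReal_nonneg
  have hFm : ∀ {a b}, a ≤ b → F a ≤ F b := fun {a b} h => by
    rw [hFcdf, hFcdf]; exact measureReal_mono (Iic_subset_Iic.2 h)
  have hivt : ∀ y ∈ Icc (0:ℝ) 1, ∃ x ∈ Icc (0:ℝ) 1, F x = y := by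
    intro y hy
    have := intermediate_value_Icc (zero_le_one) hFcont
    rw [hF0, hF1] at this
    exact this hy
  have hFle : ∀ a ∈ Icc (0:ℝ) 1, ∀ b ∈ Icc (0:ℝ) 1, F a ≤ F b → a ≤ b :=
    fun a ha b hb h => (hFmono.le_iff_le ha hb).1 h
  -- quantile points
  have hpow : ∀ k : ℕ, 1 - (1 - lam)^k ∈ Icc (0:ℝ) 1 := fun k =>
    ⟨by linarith [pow_le_one₀ (n := k) hm.le (by linarith)], by linarith [pow_pos hm k]⟩
  choose w hwI hwF using fun k : ℕ => hivt _ (hpow k)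
  have hw0 : w 0 = 0 := by
    apply hFmono.injOn (hwI 0) ⟨le_rfl, zero_le_one⟩
    rw [hwF, hF0]; simp
  have hwm : Monotone w := monotone_nat_of_le_succ fun k => by
    apply hFle _ (hwI _) _ (hwI _)
    rw [hwF, hwF, pow_succ]
    nlinarith [pow_pos hm k]
  have hq : ∀ k, 1 - F (w k) = (1 - lam)^k := fun k => by rw [hwF]; ring
  -- r c ≥ c
  have hrc : ∀ c ∈ Icc (0:ℝ) 1, c ≤ r c := by
    intro c hc
    by_contra! h
    have h1 := hrmax c hc c hc
    have h2 : F (r c) < F 1 := hFmono (hrmem c hc) ⟨zero_le_one, le_rfl⟩ (h.trans_le hc.2)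
    rw [hF1] at h2
    nlinarith [mul_pos (sub_pos.2 h) (sub_pos.2 h2)]
  set a : ℕ → ℝ := fun k => (1 - F (w k)) * (w (k + 1) - w k) with ha
  have ha0 : ∀ k, 0 ≤ a k := fun k =>
    mul_nonneg (by linarith [hF1' (w k)]) (by linarith [hwm (Nat.le_succ k)])
  -- pointwise bound
  have hpt : ∀ K : ℕ, ∀ c ∈ Icc (0:ℝ) 1, ∫ v in Icc c 1, (v - c) ∂νF ≤
      (1 / (1 - lam)) * (∫ v in Icc (r c) 1, (v - c) ∂νF +
        (∑ k ∈ Finset.range K, (Iic (w k)).indicator (fun _ => a k) c + (1 - lam)^K)) := by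
    intro K c hc
    have hFc0 : 0 ≤ F c := by rw [← hF0]; exact hFm hc.1
    obtain ⟨x, hx, hxF⟩ := hivt (F c + lam * (1 - F c))
      ⟨by nlinarith [hF1' c], by nlinarith [hF1' c]⟩
    have hcx : c ≤ x := hFle _ hc _ hx (by rw [hxF]; nlinarith [hF1' c])
    have hxw : ∀ k, x ≤ w (k + 1) → c ≤ w k := by
      intro k hk
      apply hFle _ hc _ (hwI k)
      have h1 := hFm hk
      have h2 := hq (k + 1)
      have h3 := hq k
      rw [pow_succ, ← h3] at h2
      have : (1 - lam) * F c ≤ (1 - lam) * F (w k) := by nlinarith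
      exact le_of_mul_le_mul_left this hm
    have hsn : 0 ≤ ∑ k ∈ Finset.range K, (Iic (w k)).indicator (fun _ => a k) c :=
      Finset.sum_nonneg fun k _ => indicator_nonneg (fun _ _ => ha0 k) _
    have hpK := pow_pos hm K
    -- step 1
    have h1 : (1 - lam) * ∫ v in Icc c 1, (v - c) ∂νF ≤ ∫ v in Icc x 1, (v - c) ∂νF := by
      have e := aux_split νF c hcx hx.2
      have e1 := aux_cell νF F hFcdf c hcx
      have e2 := aux_top νF F hFcdf c hx.2
      rw [hF1] at e2
      have e3 : (1 - lam) * ((x - c) * (F x - F c)) = lam * ((x - c) * (1 - F x)) := by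
        rw [hxF]; ring
      have e4 := mul_le_mul_of_nonneg_left e1 hm.le
      have e5 := mul_le_mul_of_nonneg_left e2 hl0.le
      rw [e]; nlinarith
    -- step 2
    have h2 : ∫ v in Icc x 1, (v - c) ∂νF ≤ ∫ v in Icc (r c) 1, (v - c) ∂νF +
        (∑ k ∈ Finset.range K, (Iic (w k)).indicator (fun _ => a k) c + (1 - lam)^K) := by
      rcases le_total x (r c) with hxr | hxr
      · rw [aux_split νF c hxr (hrmem c hc).2]
        have hopt := hrmax c hc x hx
        have htel := aux_tele νF F hFcdf w hw0 hwm c x hcx hx.1 hxw K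
        have hr1 := (hrmem c hc).2
        rcases le_total (r c) (w K) with hrK | hrK
        · have := htel (r c) hxr hrK
          simp only [ha] at *
          linarith
        · have hcell : ∀ s, 0 ≤ s → w K ≤ s → s ≤ r c →
              ∫ v in Ico s (r c), (v - c) ∂νF + (r c - c) * (1 - F (r c))
                - (s - c) * (1 - F s) ≤ (1 - lam)^K := fun s h0 h h' => by
            have e := aux_cell νF F hFcdf c h'
            have e1 : 1 - F s ≤ (1 - lam)^K := by rw [← hq]; linarith [hFm h]
            have e2 : (1 - F s) * (r c - s) ≤ (1 - F s) * 1 :=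
              mul_le_mul_of_nonneg_left (by linarith) (by linarith [hF1' s])
            nlinarith
          rcases le_total x (w K) with hxK | hxK
          · have e1 := htel (w K) hxK le_rfl
            have e2 := hcell (w K) (hwI K).1 le_rfl hrK
            rw [aux_split' νF c hxK hrK]
            simp only [ha] at *
            linarith
          · have e2 := hcell x hx.1 hxK hxr
            linarith
      · have e : ∫ v in Icc x 1, (v - c) ∂νF ≤ ∫ v in Icc (r c) 1, (v - c) ∂νF := by
          refine setIntegral_mono_set (aux_int_s18 νF c _ _) ?_
            (Filter.Eventually.of_forall (Icc_subset_Icc_left hxr))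
          refine (ae_restrict_iff' measurableSet_Icc).2 (Filter.Eventually.of_forall fun v hv => ?_)
          have := hrc c hc
          simp only [Pi.zero_apply]
          linarith [hv.1]
        linarith
    rw [one_div, inv_mul_eq_div, le_div_iff₀ hm]
    linarith
  -- integrability
  have hSPint : IntegrableOn (fun c => ∫ v in Icc (r c) 1, (v - c) ∂νF) (Icc 0 1) νG := by
    refine aux_param νF νG {z | r z.1 ≤ z.2 ∧ z.2 ≤ 1} ?_ (fun z => z.2 - z.1) (by fun_prop) ?_
    · exact (measurableSet_le (hrmeas.comp measurable_fst) measurable_snd).inter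
        (measurableSet_le measurable_snd measurable_const)
    · intro c hc v hv
      have h1 : r c ≤ v := hv.1
      have h2 : v ≤ 1 := hv.2
      have := hrc c hc
      rw [abs_le]
      constructor <;> simp only <;> linarith [hc.1]
  have hBint : IntegrableOn (fun v => ∫ c in Icc 0 (r' v), (v - c) ∂νG) (Icc 0 1) νF := by
    refine aux_param νG νF {z | 0 ≤ z.2 ∧ z.2 ≤ r' z.1} ?_ (fun z => z.1 - z.2) (by fun_prop) ?_
    · exact (measurableSet_le measurable_const measurable_snd).inter
        (measurableSet_le measurable_snd (hr'meas.comp measurable_fst))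
    · intro v hv c hc
      have h1 : 0 ≤ c := hc.1
      have h2 : c ≤ r' v := hc.2
      have := hr'mem v hv
      rw [abs_le]
      constructor <;> simp only <;> linarith [hv.1, hv.2, this.2]
  -- buyer lower bound
  have hB : ∀ v ∈ Icc (0:ℝ) 1, ∀ p ∈ Icc (0:ℝ) 1,
      (v - p) * G p ≤ ∫ c in Icc 0 (r' v), (v - c) ∂νG := by
    intro v hv p hp
    refine (hr'max v hv p hp).trans ?_
    have e := aux_cell νG G hGcdf v (hr'mem v hv).1
    rw [setIntegral_congr_set (Ico_ae_eq_Icc (μ := νG)), hG0] at e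
    have e2 : ∫ c in Icc 0 (r' v), (v - c) ∂νG = - ∫ c in Icc 0 (r' v), (c - v) ∂νG := by
      rw [← integral_neg]; congr 1; funext c; ring
    rw [e2]; linarith
  have hBpart : ∀ K : ℕ, lam * (1 - lam) * ∑ k ∈ Finset.range K, a k * G (w k) ≤
      ∫ v in Ico 0 (w (K + 1)), (∫ c in Icc 0 (r' v), (v - c) ∂νG) ∂νF := by
    intro K
    induction K with
    | zero =>
      simp only [Finset.range_zero, Finset.sum_empty, mul_zero]
      refine setIntegral_nonneg measurableSet_Ico fun v hv => ?_
      have hv' : v ∈ Icc (0:ℝ) 1 := ⟨hv.1, hv.2.le.trans (hwI _).2⟩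
      simpa using hB v hv' v hv'
    | succ K ih =>
      have hsub : ∀ s t, 0 ≤ s → t ≤ 1 → Ico s t ⊆ Icc (0:ℝ) 1 := fun s t h h' y hy =>
        ⟨h.trans hy.1, hy.2.le.trans h'⟩
      have hle := hwm (Nat.le_succ (K + 1))
      have hdis : Disjoint (Ico 0 (w (K + 1))) (Ico (w (K + 1)) (w (K + 1 + 1))) := by
        rw [Set.disjoint_left]
        intro y hy hy'
        exact absurd hy.2 (not_lt.2 hy'.1)
      rw [← Ico_union_Ico_eq_Ico (hwI (K + 1)).1 hle,
        setIntegral_union hdis measurableSet_Ico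
          (hBint.mono_set (hsub _ _ le_rfl (hwI _).2))
          (hBint.mono_set (hsub _ _ (hwI _).1 (hwI _).2)), Finset.sum_range_succ, mul_add]
      refine add_le_add ih ?_
      have h1 : ∫ v in Ico (w (K + 1)) (w (K + 1 + 1)), (w (K + 1) - w K) * G (w K) ∂νF ≤
          ∫ v in Ico (w (K + 1)) (w (K + 1 + 1)), (∫ c in Icc 0 (r' v), (v - c) ∂νG) ∂νF := by
        refine setIntegral_mono_on (integrable_const _)
          (hBint.mono_set (hsub _ _ (hwI _).1 (hwI _).2)) measurableSet_Ico fun v hv => ?_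
        refine le_trans ?_ (hB v (hsub _ _ (hwI _).1 (hwI _).2 hv) (w K) (hwI K))
        exact mul_le_mul_of_nonneg_right (by linarith [hv.1]) (hG0' _)
      rw [setIntegral_const, aux_Ico_s18 νF F hFcdf hle, smul_eq_mul, hwF, hwF] at h1
      refine le_trans (le_of_eq ?_) h1
      simp only [ha, hq, Nat.succ_eq_add_one, pow_succ]
      ring
  have hBfull : ∀ K : ℕ, lam * (1 - lam) * ∑ k ∈ Finset.range K, a k * G (w k) ≤ BuyerP := by
    intro K
    refine (hBpart K).trans ?_
    rw [hBuyerP]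
    refine setIntegral_mono_set hBint ?_ (Filter.Eventually.of_forall
      (fun y hy => ⟨hy.1, hy.2.le.trans (hwI _).2⟩))
    refine (ae_restrict_iff' measurableSet_Icc).2 (Filter.Eventually.of_forall fun v hv => ?_)
    simpa using hB v hv v hv
  -- integrate over c
  have hfin : ∀ K : ℕ, FB ≤ (1 / (1 - lam)) * (SP +
      (1 / (lam * (1 - lam)) * BuyerP + (1 - lam)^K)) := by
    intro K
    have hind : ∀ k, IntegrableOn ((Iic (w k)).indicator (fun _ => a k)) (Icc 0 1) νG := fun k =>
      (integrable_const _).indicator measurableSet_Iic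
    have hsum : IntegrableOn
        (fun c => ∑ k ∈ Finset.range K, (Iic (w k)).indicator (fun _ => a k) c) (Icc 0 1) νG :=
      integrable_finsetSum _ fun k _ => hind k
    have hconst : IntegrableOn (fun _ : ℝ => (1 - lam)^K) (Icc 0 1) νG := integrable_const _
    have h1 : FB ≤ ∫ c in Icc (0:ℝ) 1, (1 / (1 - lam)) * (∫ v in Icc (r c) 1, (v - c) ∂νF +
        (∑ k ∈ Finset.range K, (Iic (w k)).indicator (fun _ => a k) c + (1 - lam)^K)) ∂νG := by
      rw [hFB]
      refine integral_mono_of_nonneg ?_ ((hSPint.add (hsum.add hconst)).const_mul _) ?_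
      · refine Filter.Eventually.of_forall fun c => setIntegral_nonneg measurableSet_Icc ?_
        intro v hv
        linarith [hv.1]
      · exact (ae_restrict_iff' measurableSet_Icc).2
          (Filter.Eventually.of_forall fun c hc => hpt K c hc)
    have hsc : IntegrableOn (fun c => ∑ k ∈ Finset.range K,
        (Iic (w k)).indicator (fun _ => a k) c + (1 - lam)^K) (Icc 0 1) νG := hsum.add hconst
    rw [integral_const_mul, integral_add hSPint hsc, integral_add hsum hconst,
      integral_finsetSum _ (fun k _ => hind k), ← hSP] at h1
    refine h1.trans (mul_le_mul_of_nonneg_left ?_ (by positivity))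
    have h2 : ∑ k ∈ Finset.range K, ∫ c in Icc (0:ℝ) 1, (Iic (w k)).indicator (fun _ => a k) c ∂νG
        ≤ ∑ k ∈ Finset.range K, a k * G (w k) := by
      refine Finset.sum_le_sum fun k _ => ?_
      rw [setIntegral_indicator measurableSet_Iic, setIntegral_const, smul_eq_mul, mul_comm, hGcdf]
      exact mul_le_mul_of_nonneg_left (measureReal_mono inter_subset_right) (ha0 k)
    have h3 : ∫ c in Icc (0:ℝ) 1, (1 - lam)^K ∂νG ≤ (1 - lam)^K := by
      rw [setIntegral_const, smul_eq_mul]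
      exact mul_le_of_le_one_left (pow_pos hm K).le measureReal_le_one
    have h4 : ∑ k ∈ Finset.range K, a k * G (w k) ≤ 1 / (lam * (1 - lam)) * BuyerP := by
      rw [one_div, inv_mul_eq_div, le_div_iff₀ (mul_pos hl0 hm)]
      linarith [hBfull K]
    linarith
  have hlim : Filter.Tendsto (fun K : ℕ => (1 / (1 - lam)) * (SP +
      (1 / (lam * (1 - lam)) * BuyerP + (1 - lam)^K))) Filter.atTop
      (nhds ((1 / (1 - lam)) * (SP + (1 / (lam * (1 - lam)) * BuyerP + 0)))) :=
    ((tendsto_pow_atTop_nhds_zero_of_lt_one hm.le (by linarith)).const_add _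
      |>.const_add _).const_mul _
  have := ge_of_tendsto' hlim hfin
  refine this.trans (le_of_eq ?_)
  field_simp
  ring
end
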